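/- arXiv:math/9902009 — 2 statements merged into one kernel-verified Lean document; each statement's English description precedes it below -/
import Mathlib

section
/- Let n ≥ 1 and let α = (α_1, ..., α_m) be a partition of n with m parts. Then c_1(α) = (1/24) · (n+m)! · (∏_{i=1}^m α_i^{α_i}/(α_i−1)!) · (n^m − n^{m−1} − Σ_{i=2}^m (i−2)! e_i n^{m−i}), where e_i denotes the i-th elementary symmetric function of α_1, ..., α_m (and e_1 = α_1 + ... + α_m = n). -/
open Finset Nat

/-- `a_r = r^r/(r-1)!` -/
noncomputable def aa (r : ℕ) : ℚ := (r : ℚ) ^ r / ((r - 1)! : ℚ)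

/-- `∏_{i=1}^m α_i^{α_i}/(α_i - 1)!` over the parts of a partition. -/
noncomputable def aProd {n : ℕ} (α : n.Partition) : ℚ :=
  (α.parts.map fun i : ℕ => (i : ℚ) ^ i / ((i - 1)! : ℚ)).prod

/-- `n^m − n^{m−1} − Σ_{i=2}^m (i−2)! e_i(α) n^{m−i}` where `m` is the number of parts
and `e_i` is the `i`-th elementary symmetric function of the parts. -/
noncomputable def npoly {n : ℕ} (α : n.Partition) : ℚ :=
  (n : ℚ) ^ α.parts.card - (n : ℚ) ^ (α.parts.card - 1) -
    ∑ i ∈ Finset.Icc 2 α.parts.card,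
      ((i - 2)! : ℚ) * (α.parts.map fun j => (j : ℚ)).esymm i * (n : ℚ) ^ (α.parts.card - i)

/-- Rational-valued functions on the finite subsets of `ι`, multiplied by convolution over
decompositions of a set into two disjoint pieces. -/
structure SetAlg (ι : Type*) where
  /-- The underlying function. -/
  coeff : Finset ι → ℚ

namespace SetAlg

variable {ι : Type*}

instance : CoeFun (SetAlg ι) (fun _ => Finset ι → ℚ) := ⟨coeff⟩

@[ext] theorem ext {f g : SetAlg ι} (h : ∀ J, f J = g J) : f = g := by
  cases f; cases g; congr; exact funext h

instance : Add (SetAlg ι) := ⟨fun f g => ⟨fun J => f J + g J⟩⟩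

instance : Neg (SetAlg ι) := ⟨fun f => ⟨fun J => -f J⟩⟩

instance : Sub (SetAlg ι) := ⟨fun f g => ⟨fun J => f J - g J⟩⟩

instance : Zero (SetAlg ι) := ⟨⟨fun _ => 0⟩⟩

instance : SMul ℚ (SetAlg ι) := ⟨fun c f => ⟨fun J => c * f J⟩⟩

@[simp] theorem add_apply (f g : SetAlg ι) (J : Finset ι) : (f + g) J = f J + g J := rfl

@[simp] theorem neg_apply (f : SetAlg ι) (J : Finset ι) : (-f) J = -f J := rfl

@[simp] theorem sub_apply (f g : SetAlg ι) (J : Finset ι) : (f - g) J = f J - g J := rfl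

@[simp] theorem zero_apply (J : Finset ι) : (0 : SetAlg ι) J = 0 := rfl

@[simp] theorem smul_apply (c : ℚ) (f : SetAlg ι) (J : Finset ι) : (c • f) J = c * f J := rfl

instance : AddCommGroup (SetAlg ι) where
  add_assoc f g h := by ext J; simp [add_assoc]
  zero_add f := by ext J; simp
  add_zero f := by ext J; simp
  add_comm f g := by ext J; simp [add_comm]
  neg_add_cancel f := by ext J; simp
  sub_eq_add_neg f g := by ext J; simp [sub_eq_add_neg]
  zsmul := zsmulRec
  nsmul := nsmulRec

instance : Module ℚ (SetAlg ι) where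
  one_smul f := by ext J; simp
  mul_smul a b f := by ext J; simp [mul_assoc]
  smul_zero a := by ext J; simp
  smul_add a f g := by ext J; simp [mul_add]
  add_smul a b f := by ext J; simp [add_mul]
  zero_smul f := by ext J; simp

@[simp] theorem sum_apply {κ : Type*} (s : Finset κ) (f : κ → SetAlg ι) (J : Finset ι) :
    (∑ k ∈ s, f k) J = ∑ k ∈ s, f k J := by
  classical
  induction s using Finset.induction_on with
  | empty => simp
  | insert a s ha ih => rw [Finset.sum_insert ha, Finset.sum_insert ha, add_apply, ih]

variable [DecidableEq ι]

instance : One (SetAlg ι) := ⟨⟨fun J => if J = ∅ then 1 else 0⟩⟩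

instance : Mul (SetAlg ι) := ⟨fun f g => ⟨fun J => ∑ S ∈ J.powerset, f S * g (J \ S)⟩⟩

theorem one_apply (J : Finset ι) : (1 : SetAlg ι) J = if J = ∅ then 1 else 0 := rfl

theorem mul_apply (f g : SetAlg ι) (J : Finset ι) :
    (f * g) J = ∑ S ∈ J.powerset, f S * g (J \ S) := rfl

protected theorem mul_comm' (f g : SetAlg ι) : f * g = g * f := by
  ext J
  rw [mul_apply, mul_apply]
  refine Finset.sum_nbij' (fun S => J \ S) (fun S => J \ S) ?_ ?_ ?_ ?_ ?_
  · intro S _; simp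
  · intro S _; simp
  · intro S hS; simpa using hS
  · intro S hS; simpa using hS
  · intro S hS
    rw [Finset.sdiff_sdiff_eq_self (Finset.mem_powerset.1 hS), mul_comm]

protected theorem one_mul' (f : SetAlg ι) : 1 * f = f := by
  ext J
  rw [mul_apply, Finset.sum_eq_single ∅]
  · simp [one_apply]
  · intro S _ hS; simp [one_apply, hS]
  · intro h; simp at h

protected theorem mul_assoc' (f g h : SetAlg ι) : f * g * h = f * (g * h) := by
  ext J
  simp only [mul_apply, Finset.sum_mul, Finset.mul_sum]
  rw [Finset.sum_sigma', Finset.sum_sigma']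
  refine Finset.sum_nbij' (fun x => ⟨x.2, x.1 \ x.2⟩) (fun x => ⟨x.1 ∪ x.2, x.1⟩) ?_ ?_ ?_ ?_ ?_
  · rintro ⟨S, T⟩ h
    simp only [Finset.mem_sigma, Finset.mem_powerset] at h ⊢
    exact ⟨h.2.trans h.1, Finset.sdiff_subset_sdiff h.1 le_rfl⟩
  · rintro ⟨S, T⟩ h
    simp only [Finset.mem_sigma, Finset.mem_powerset] at h ⊢
    exact ⟨Finset.union_subset h.1 (h.2.trans Finset.sdiff_subset), Finset.subset_union_left⟩
  · rintro ⟨S, T⟩ h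
    simp only [Finset.mem_sigma, Finset.mem_powerset] at h
    simp [Finset.union_sdiff_of_subset h.2]
  · rintro ⟨S, T⟩ h
    simp only [Finset.mem_sigma, Finset.mem_powerset] at h
    have : Disjoint S T := (Finset.subset_sdiff.1 h.2).2.symm
    simp [Finset.union_sdiff_cancel_left this]
  · rintro ⟨S, T⟩ h
    simp only [Finset.mem_sigma, Finset.mem_powerset] at h
    have : (J \ T) \ (S \ T) = J \ S := by
      ext x; simp only [Finset.mem_sdiff]
      constructor
      · rintro ⟨⟨h1, h2⟩, h3⟩; exact ⟨h1, fun h4 => h3 ⟨h4, h2⟩⟩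
      · rintro ⟨h1, h2⟩; exact ⟨⟨h1, fun h3 => h2 (h.2 h3)⟩, fun h3 => h2 h3.1⟩
    simp only [this]
    ring

protected theorem left_distrib' (f g h : SetAlg ι) : f * (g + h) = f * g + f * h := by
  ext J; simp [mul_apply, mul_add, Finset.sum_add_distrib]

instance : CommRing (SetAlg ι) where
  mul_comm := SetAlg.mul_comm'
  mul_assoc := SetAlg.mul_assoc'
  one_mul := SetAlg.one_mul'
  mul_one f := by rw [SetAlg.mul_comm', SetAlg.one_mul']
  left_distrib := SetAlg.left_distrib'
  right_distrib f g h := by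
    rw [SetAlg.mul_comm', SetAlg.left_distrib', SetAlg.mul_comm' h, SetAlg.mul_comm' h]
  zero_mul f := by ext J; simp [mul_apply]
  mul_zero f := by ext J; simp [mul_apply]
  neg_add_cancel := neg_add_cancel
  sub_eq_add_neg := sub_eq_add_neg
  zsmul := zsmulRec
  nsmul := nsmulRec

instance : Algebra ℚ (SetAlg ι) :=
  Algebra.ofModule
    (fun c f g => by ext J; simp [mul_apply, Finset.mul_sum, mul_assoc])
    (fun c f g => by
      ext J; simp only [mul_apply, Finset.mul_sum, smul_apply]
      exact Finset.sum_congr rfl fun _ _ => by ring)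

/-- The indicator function of the singleton `{i}`. -/
def single (i : ι) : SetAlg ι := ⟨fun J => if J = {i} then 1 else 0⟩

theorem single_mul_apply (i : ι) (f : SetAlg ι) (J : Finset ι) :
    (single i * f) J = if i ∈ J then f (J.erase i) else 0 := by
  rw [mul_apply]
  split_ifs with h
  · rw [Finset.sum_eq_single {i}]
    · have : single i {i} = 1 := if_pos rfl
      rw [this, one_mul, Finset.sdiff_singleton_eq_erase]
    · intro S _ hS
      have : single i S = 0 := if_neg hS
      rw [this, zero_mul]
    · intro h'; simp [h] at h'
  · refine Finset.sum_eq_zero fun S hS => ?_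
    have : single i S = 0 := if_neg (by
      rintro rfl; exact h (by simpa using hS))
    rw [this, zero_mul]

theorem sum_single_mul_apply [Fintype ι] (F : ι → SetAlg ι) (J : Finset ι) :
    (∑ i, single i * F i) J = ∑ i ∈ J, F i (J.erase i) := by
  simp [single_mul_apply, Finset.sum_ite_mem]

theorem sum_smul_single_mul_apply [Fintype ι] (c : ι → ℚ) (F : ι → SetAlg ι) (J : Finset ι) :
    (∑ i, c i • (single i * F i)) J = ∑ i ∈ J, c i * F i (J.erase i) := by
  simp [single_mul_apply, Finset.sum_ite_mem]

/-! ### Hurwitz's generalisation of Abel's identity -/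

section Hurwitz

variable (α : ι → ℕ)

/-- The coefficients of the `k`-th power of the solution `s` of `s = exp (∑ i, p i * s ^ α i)`. -/
def spow (k : ℕ) : SetAlg ι :=
  ⟨fun J => if J = ∅ then 1 else (k : ℚ) * ((k : ℚ) + ∑ i ∈ J, (α i : ℚ)) ^ (#J - 1)⟩

/-- The coefficients of the `k`-th power of `s` divided by `1 - ∑ i, α i * p i * s ^ α i`. -/
def spowU (k : ℕ) : SetAlg ι := ⟨fun J => ((k : ℚ) + ∑ i ∈ J, (α i : ℚ)) ^ #J⟩

theorem spow_apply (k : ℕ) (J : Finset ι) : spow α k J =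
    if J = ∅ then 1 else (k : ℚ) * ((k : ℚ) + ∑ i ∈ J, (α i : ℚ)) ^ (#J - 1) := rfl

omit [DecidableEq ι] in
theorem spowU_apply (k : ℕ) (J : Finset ι) :
    spowU α k J = ((k : ℚ) + ∑ i ∈ J, (α i : ℚ)) ^ #J := rfl

theorem spow_zero : spow α 0 = 1 := by
  ext J; simp [spow_apply, one_apply]

theorem card_erase_add_sum {J : Finset ι} {a : ι} (ha : a ∈ J) (k : ℕ) :
    ((k + α a : ℕ) : ℚ) + ∑ i ∈ J.erase a, (α i : ℚ) = k + ∑ i ∈ J, (α i : ℚ) := by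
  rw [← Finset.add_sum_erase _ _ ha]; push_cast; ring

/-- `∑ i, α i ^ j * p i * s ^ α i`. -/
def psum [Fintype ι] (j : ℕ) : SetAlg ι := ∑ i, ((α i : ℚ) ^ j) • (single i * spow α (α i))

theorem spowU_eq_aux (k : ℕ) (J : Finset ι) :
    spowU α k J = spow α k J + ∑ a ∈ J, (α a : ℚ) * spowU α (k + α a) (J.erase a) := by
  rcases J.eq_empty_or_nonempty with rfl | hJ
  · simp [spowU_apply, spow_apply]
  have h : ∀ a ∈ J, (α a : ℚ) * spowU α (k + α a) (J.erase a) =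
      α a * ((k : ℚ) + ∑ i ∈ J, (α i : ℚ)) ^ (#J - 1) := by
    intro a ha
    rw [spowU_apply, card_erase_add_sum α ha, Finset.card_erase_of_mem ha]
  rw [Finset.sum_congr rfl h, ← Finset.sum_mul, spow_apply, if_neg hJ.ne_empty, ← add_mul,
    spowU_apply, mul_pow_sub_one hJ.card_pos.ne']

/-- The derivation multiplying the coefficient of `J` by `∑ i ∈ J, α i`. -/
def weight (f : SetAlg ι) : SetAlg ι := ⟨fun J => (∑ i ∈ J, (α i : ℚ)) * f J⟩

omit [DecidableEq ι] in
theorem weight_apply (f : SetAlg ι) (J : Finset ι) :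
    weight α f J = (∑ i ∈ J, (α i : ℚ)) * f J := rfl

theorem weight_mul (f g : SetAlg ι) : weight α (f * g) = weight α f * g + f * weight α g := by
  ext J
  rw [weight_apply, add_apply, mul_apply, mul_apply, mul_apply, Finset.mul_sum,
    ← Finset.sum_add_distrib]
  refine Finset.sum_congr rfl fun S hS => ?_
  rw [← Finset.sum_sdiff (Finset.mem_powerset.1 hS), weight_apply, weight_apply]
  ring

theorem weight_spow (k : ℕ) : weight α (spow α k) = (k : ℚ) • (spowU α k - spow α k) := by
  ext J
  rw [weight_apply]
  rcases J.eq_empty_or_nonempty with rfl | hJ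
  · simp [spowU_apply, spow_apply]
  obtain ⟨b, hb⟩ : ∃ b, #J = b + 1 := ⟨#J - 1, (Nat.sub_add_cancel hJ.card_pos).symm⟩
  rw [smul_apply, sub_apply, spow_apply, if_neg hJ.ne_empty, spowU_apply, hb]
  simp only [Nat.add_sub_cancel, pow_succ]
  ring

variable [Fintype ι]

theorem spow_mul_apply (hα : ∀ i, 0 < α i) (J : Finset ι) : ∀ k l : ℕ,
    (spow α k * spow α l) J = spow α (k + l) J ∧
    (spowU α k * spow α l) J = spowU α (k + l) J := by
  induction J using Finset.strongInduction with
  | H J ih =>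
  intro k l
  rcases J.eq_empty_or_nonempty with rfl | hJ
  · simp [mul_apply, spow_apply, spowU_apply]
  -- expansion of the second product in terms of the first
  have key : ∀ k l : ℕ, (spowU α k * spow α l) J = (spow α k * spow α l) J +
      (∑ i ∈ J, (α i : ℚ)) * (((k + l : ℕ) : ℚ) + ∑ i ∈ J, (α i : ℚ)) ^ (#J - 1) := by
    intro k l
    have e : spowU α k = spow α k + ∑ a, (α a : ℚ) • (single a * spowU α (k + α a)) := by
      ext S
      rw [spowU_eq_aux, add_apply, sum_smul_single_mul_apply]
    rw [e, add_mul, add_apply, Finset.sum_mul]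
    simp only [smul_mul_assoc, mul_assoc]
    rw [sum_smul_single_mul_apply, Finset.sum_mul]
    congr 1
    refine Finset.sum_congr rfl fun a ha => ?_
    rw [(ih _ (Finset.erase_ssubset ha) _ _).2, spowU_apply, add_right_comm,
      card_erase_add_sum α ha, Finset.card_erase_of_mem ha]
  have hw := congrArg (fun f : SetAlg ι => f J) (weight_mul α (spow α k) (spow α l))
  rw [weight_apply, add_apply, weight_spow, weight_spow, smul_mul_assoc, mul_smul_comm, sub_mul,
    mul_sub, smul_apply, smul_apply, sub_apply, sub_apply, key k l,
    mul_comm (spow α k) (spowU α l), key l k, mul_comm (spow α l) (spow α k), add_comm l k] at hw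
  have hn : (0 : ℚ) < ∑ i ∈ J, (α i : ℚ) :=
    Finset.sum_pos (fun i _ => by exact_mod_cast hα i) hJ
  have h1 : (spow α k * spow α l) J = spow α (k + l) J := by
    rw [spow_apply, if_neg hJ.ne_empty]
    push_cast at hw ⊢
    apply mul_left_cancel₀ hn.ne'
    linear_combination hw
  refine ⟨h1, ?_⟩
  rw [key, h1, spow_apply, if_neg hJ.ne_empty, spowU_apply, ← add_mul,
    mul_pow_sub_one hJ.card_pos.ne']

variable {α}

theorem spow_add (hα : ∀ i, 0 < α i) (k l : ℕ) : spow α (k + l) = spow α k * spow α l := by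
  ext J; exact ((spow_mul_apply α hα J k l).1).symm

theorem spowU_eq (hα : ∀ i, 0 < α i) (k : ℕ) : spowU α k = spow α k * spowU α 0 := by
  ext J
  have := (spow_mul_apply α hα J 0 k).2
  rw [mul_comm, this, zero_add]

theorem spowU_zero (hα : ∀ i, 0 < α i) : spowU α 0 * (1 - psum α 1) = 1 := by
  have : spowU α 0 = 1 + psum α 1 * spowU α 0 := by
    ext J
    rw [spowU_eq_aux, add_apply, spow_zero, psum, Finset.sum_mul]
    simp only [smul_mul_assoc, mul_assoc, ← spowU_eq hα]
    rw [sum_smul_single_mul_apply]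
    simp
  linear_combination this

end Hurwitz

end SetAlg

/-! ### The tree series -/

section TreeSeries

open PowerSeries

/-- `n ^ n / n!`. -/
noncomputable def treeCoeff (n : ℕ) : ℚ := (n : ℚ) ^ n / (n ! : ℚ)

theorem treeCoeff_zero : treeCoeff 0 = 1 := by simp [treeCoeff]

theorem treeCoeff_pos (n : ℕ) : 0 < treeCoeff n := by
  rcases n.eq_zero_or_pos with rfl | h
  · simp [treeCoeff]
  · unfold treeCoeff; positivity

/-- The series `∑ n ^ n / n! * X ^ n`. -/
noncomputable def treeT : ℚ⟦X⟧ := PowerSeries.mk treeCoeff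

/-- The tree series `∑ n ^ (n - 1) / n! * X ^ n`. -/
noncomputable def treeY : ℚ⟦X⟧ := PowerSeries.mk fun n => treeCoeff n / n

theorem coeff_treeT (n : ℕ) : coeff n treeT = treeCoeff n := PowerSeries.coeff_mk _ _

theorem coeff_treeY (n : ℕ) : coeff n treeY = treeCoeff n / n := PowerSeries.coeff_mk _ _

theorem abel_sum (N : ℕ) : ∑ j ∈ Finset.range (N + 1),
    (N.choose j : ℚ) * ((j : ℚ) ^ j * (1 + (N - j : ℕ) : ℚ) ^ (N - j - 1)) = (N + 1 : ℚ) ^ N := by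
  have h := (SetAlg.spow_mul_apply (fun _ : Fin N => 1) (fun _ => one_pos) Finset.univ 0 1).2
  have h2 : ∀ J : Finset (Fin N), SetAlg.spow (fun _ : Fin N => 1) 1 J =
      (1 + (#J : ℚ)) ^ (#J - 1) := by
    intro J
    rw [SetAlg.spow_apply]
    split_ifs with hJ
    · simp [hJ]
    · simp
  rw [SetAlg.mul_apply, SetAlg.spowU_apply] at h
  have h3 : ∀ S ∈ (Finset.univ : Finset (Fin N)).powerset,
      SetAlg.spowU (fun _ : Fin N => 1) 0 S * SetAlg.spow (fun _ : Fin N => 1) 1 (univ \ S) =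
      (fun j : ℕ => (j : ℚ) ^ j * (1 + (N - j : ℕ) : ℚ) ^ (N - j - 1)) #S := by
    intro S _
    rw [h2, SetAlg.spowU_apply, Finset.card_sdiff_of_subset (Finset.subset_univ _)]
    simp
  rw [Finset.sum_congr rfl h3] at h
  have h4 := Finset.sum_powerset_apply_card
    (fun j : ℕ => (j : ℚ) ^ j * (1 + (N - j : ℕ) : ℚ) ^ (N - j - 1))
    (x := (Finset.univ : Finset (Fin N)))
  beta_reduce at h
  rw [h4] at h
  simpa [add_comm] using h

theorem treeT_mul : treeT * (1 - treeY) = 1 := by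
  have : treeT * treeY = treeT - 1 := by
    ext n
    rw [PowerSeries.coeff_mul, map_sub, coeff_treeT, PowerSeries.coeff_one]
    cases n with
    | zero => simp [coeff_treeT, coeff_treeY, treeCoeff]
    | succ N =>
      rw [if_neg N.succ_ne_zero, sub_zero, Finset.Nat.sum_antidiagonal_eq_sum_range_succ_mk,
        Finset.sum_range_succ]
      simp only [coeff_treeT, coeff_treeY, Nat.sub_self, Nat.cast_zero, div_zero, mul_zero,
        add_zero]
      have e : treeCoeff (N + 1) = (N + 1 : ℚ) ^ N / (N ! : ℚ) := by
        rw [treeCoeff, Nat.factorial_succ]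
        push_cast
        have : (N + 1 : ℚ) ≠ 0 := by positivity
        have : (N ! : ℚ) ≠ 0 := by positivity
        field_simp
        ring
      rw [e, ← abel_sum, Finset.sum_div]
      refine Finset.sum_congr rfl fun j hj => ?_
      have hj : j ≤ N := Nat.lt_succ_iff.1 (Finset.mem_range.1 hj)
      obtain ⟨i, rfl⟩ := Nat.exists_eq_add_of_le hj
      rw [show j + i + 1 - j = i + 1 by omega, show j + i - j = i by omega,
        Nat.cast_choose ℚ hj, show j + i - j = i by omega]
      unfold treeCoeff
      rw [Nat.factorial_succ i]
      have : (j ! : ℚ) ≠ 0 := by positivity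
      have : (i ! : ℚ) ≠ 0 := by positivity
      have : ((j + i)! : ℚ) ≠ 0 := by positivity
      have : (i + 1 : ℚ) ≠ 0 := by positivity
      cases i with
      | zero => simp; field_simp
      | succ i => push_cast at *; field_simp; ring
  linear_combination -this

/-- The derivation `X * d/dX`. -/
noncomputable def theta (R : Type*) [CommRing R] : Derivation R R⟦X⟧ R⟦X⟧ :=
  (PowerSeries.X : R⟦X⟧) • PowerSeries.derivative R

theorem coeff_theta {R : Type*} [CommRing R] (f : R⟦X⟧) (n : ℕ) :
    coeff n (theta R f) = n * coeff n f := by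
  rw [theta, Derivation.smul_apply, smul_eq_mul]
  cases n with
  | zero => simp
  | succ n =>
    rw [mul_comm, PowerSeries.coeff_succ_mul_X, PowerSeries.coeff_derivative, mul_comm]
    push_cast; rfl

theorem theta_treeY : theta ℚ treeY = treeT - 1 := by
  ext n
  rw [coeff_theta, map_sub, coeff_treeT, coeff_treeY, PowerSeries.coeff_one]
  split_ifs with h
  · simp [h, treeCoeff]
  · have : (n : ℚ) ≠ 0 := by exact_mod_cast h
    field_simp; simp

theorem theta_treeT : theta ℚ treeT = treeT ^ 3 - treeT ^ 2 := by
  have h := congrArg (theta ℚ) treeT_mul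
  rw [Derivation.leibniz, map_sub, theta_treeY, Derivation.map_one_eq_zero] at h
  simp only [smul_eq_mul] at h
  linear_combination treeT * h - theta ℚ treeT * treeT_mul

theorem theta_treeT_pow (e : ℕ) :
    theta ℚ (treeT ^ e) = e * (treeT ^ (e + 2) - treeT ^ (e + 1)) := by
  cases e with
  | zero => simp
  | succ e =>
    rw [Derivation.leibniz_pow, theta_treeT]
    simp only [smul_eq_mul, nsmul_eq_mul, Nat.add_sub_cancel]
    ring

/-- The coefficients of the powers of `treeT`. -/
noncomputable def tau (e n : ℕ) : ℚ := coeff n (treeT ^ e)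

theorem tau_one (n : ℕ) : tau 1 n = treeCoeff n := by rw [tau, pow_one, coeff_treeT]

theorem mul_tau (e n : ℕ) : (n : ℚ) * tau e n = e * (tau (e + 2) n - tau (e + 1) n) := by
  have h := congrArg (coeff n) (theta_treeT_pow e)
  rw [coeff_theta, ← nsmul_eq_mul (n := e), map_nsmul, map_sub, nsmul_eq_mul] at h
  exact h

/-- The decompositions of `n` as an ordered sum of two positive integers. -/
def splits (n : ℕ) : Finset (ℕ × ℕ) :=
  (Finset.HasAntidiagonal.antidiagonal n).filter fun p => 0 < p.1 ∧ 0 < p.2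

theorem mem_splits {n : ℕ} {p : ℕ × ℕ} : p ∈ splits n ↔ p.1 + p.2 = n ∧ 0 < p.1 ∧ 0 < p.2 := by
  simp [splits]

theorem coeff_mul_eq_sum_splits {F G : ℚ⟦X⟧} (hF : coeff 0 F = 0) (hG : coeff 0 G = 0) (n : ℕ) :
    coeff n (F * G) = ∑ p ∈ splits n, coeff p.1 F * coeff p.2 G := by
  rw [PowerSeries.coeff_mul, splits, Finset.sum_filter]
  refine Finset.sum_congr rfl fun p _ => ?_
  split_ifs with h
  · rfl
  · rw [not_and_or, Nat.pos_iff_ne_zero, Nat.pos_iff_ne_zero, not_not, not_not] at h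
    rcases h with h | h <;> simp [h, hF, hG]

theorem coeff_treeT_sub_one {n : ℕ} (hn : 0 < n) : coeff n (treeT - 1) = treeCoeff n := by
  rw [map_sub, coeff_treeT, PowerSeries.coeff_one, if_neg hn.ne', sub_zero]

theorem coeff_zero_treeT_sub_one : coeff 0 (treeT - 1) = 0 := by
  rw [map_sub, coeff_treeT, treeCoeff_zero, PowerSeries.coeff_one, if_pos rfl, sub_self]

theorem coeff_zero_treeY : coeff 0 treeY = 0 := by rw [coeff_treeY, Nat.cast_zero, div_zero]

theorem treeT_mul_treeY : treeT * treeY = treeT - 1 := by linear_combination -treeT_mul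

theorem theta_theta_treeT :
    theta ℚ (theta ℚ treeT) = 3 * treeT ^ 5 - 5 * treeT ^ 4 + 2 * treeT ^ 3 := by
  rw [theta_treeT, map_sub, theta_treeT_pow, theta_treeT_pow]
  push_cast; ring

theorem coeff_poly (a b c d e : ℚ) (n : ℕ) :
    coeff n (a • treeT ^ 5 + b • treeT ^ 4 + c • treeT ^ 3 + d • treeT ^ 2 + e • treeT) =
      a * tau 5 n + b * tau 4 n + c * tau 3 n + d * tau 2 n + e * tau 1 n := by
  simp [tau]

theorem sum_splits_zero {n : ℕ} (hn : 0 < n) :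
    ∑ p ∈ splits n, treeCoeff p.1 * treeCoeff p.2 = tau 2 n - 2 * treeCoeff n := by
  have h := coeff_mul_eq_sum_splits coeff_zero_treeT_sub_one coeff_zero_treeT_sub_one n
  have e : (treeT - 1) * (treeT - 1) = treeT ^ 2 - treeT - (treeT - 1) := by ring
  rw [e, map_sub, coeff_treeT_sub_one hn, map_sub, coeff_treeT] at h
  rw [tau, show coeff n (treeT ^ 2) - 2 * treeCoeff n =
    coeff n (treeT ^ 2) - treeCoeff n - treeCoeff n by ring, h]
  refine Finset.sum_congr rfl fun p hp => ?_
  rw [mem_splits] at hp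
  rw [coeff_treeT_sub_one hp.2.1, coeff_treeT_sub_one hp.2.2]

theorem sum_splits_one (n : ℕ) :
    ∑ p ∈ splits n, treeCoeff p.1 * treeCoeff p.2 * p.1 = tau 4 n - 2 * tau 3 n + tau 2 n := by
  have h := coeff_mul_eq_sum_splits (F := theta ℚ treeT) (by simp [coeff_theta])
    coeff_zero_treeT_sub_one n
  have e : theta ℚ treeT * (treeT - 1) = (0 : ℚ) • treeT ^ 5 + (1 : ℚ) • treeT ^ 4 +
      (-2 : ℚ) • treeT ^ 3 + (1 : ℚ) • treeT ^ 2 + (0 : ℚ) • treeT := by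
    rw [theta_treeT]
    simp only [ofNat_smul_eq_nsmul, nsmul_eq_mul, zero_smul, neg_smul, one_smul]
    push_cast
    ring
  rw [e, coeff_poly] at h
  transitivity ∑ p ∈ splits n, coeff p.1 (theta ℚ treeT) * coeff p.2 (treeT - 1)
  · refine Finset.sum_congr rfl fun p hp => ?_
    rw [mem_splits] at hp
    rw [coeff_theta, coeff_treeT, coeff_treeT_sub_one hp.2.2]; ring
  · rw [← h]; ring

theorem sum_splits_mul (n : ℕ) :
    ∑ p ∈ splits n, treeCoeff p.1 * treeCoeff p.2 * (p.1 * p.2) =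
      n * (3 * tau 4 n - 4 * tau 3 n) / 12 := by
  have h := coeff_mul_eq_sum_splits (F := theta ℚ treeT) (G := theta ℚ treeT)
    (by simp [coeff_theta]) (by simp [coeff_theta]) n
  have e : 12 • (theta ℚ treeT * theta ℚ treeT) =
      3 • theta ℚ (treeT ^ 4) - 4 • theta ℚ (treeT ^ 3) := by
    rw [theta_treeT, theta_treeT_pow, theta_treeT_pow]
    simp only [nsmul_eq_mul]
    push_cast; ring
  have e2 := congrArg (coeff n) e
  rw [map_nsmul, map_sub, map_nsmul, map_nsmul, coeff_theta, coeff_theta, h] at e2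
  simp only [nsmul_eq_mul] at e2
  push_cast at e2
  transitivity ∑ p ∈ splits n, coeff p.1 (theta ℚ treeT) * coeff p.2 (theta ℚ treeT)
  · refine Finset.sum_congr rfl fun p hp => ?_
    rw [coeff_theta, coeff_treeT, coeff_theta, coeff_treeT]; ring
  · unfold tau; linear_combination e2 / 12

theorem linear_zero {n : ℕ} (hn : 0 < n) :
    (n + 1) / n * treeCoeff n - ∑ p ∈ splits n, treeCoeff p.1 * treeCoeff p.2 / p.2 =
      2 * treeCoeff n / n := by
  have h := coeff_mul_eq_sum_splits coeff_zero_treeT_sub_one coeff_zero_treeY n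
  have e : (treeT - 1) * treeY = (treeT - 1) - treeY := by
    linear_combination treeT_mul_treeY
  rw [e, map_sub, coeff_treeT_sub_one hn, coeff_treeY] at h
  rw [show ∑ p ∈ splits n, treeCoeff p.1 * treeCoeff p.2 / p.2 =
    treeCoeff n - treeCoeff n / n from ?_]
  · have : (n : ℚ) ≠ 0 := by positivity
    field_simp; ring
  · rw [h]
    refine Finset.sum_congr rfl fun p hp => ?_
    rw [mem_splits] at hp
    rw [coeff_treeT_sub_one hp.2.1, coeff_treeY]; ring

theorem linear_one (n : ℕ) :
    (n + 1) * treeCoeff n - ∑ p ∈ splits n, treeCoeff p.1 * treeCoeff p.2 * p.1 / p.2 =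
      tau 2 n := by
  have h := coeff_mul_eq_sum_splits (F := theta ℚ treeT) (by simp [coeff_theta])
    coeff_zero_treeY n
  have e : theta ℚ treeT * treeY = (0 : ℚ) • treeT ^ 5 + (0 : ℚ) • treeT ^ 4 + (1 : ℚ) • treeT ^ 3 +
      (-2 : ℚ) • treeT ^ 2 + (1 : ℚ) • treeT := by
    rw [theta_treeT]
    simp only [ofNat_smul_eq_nsmul, nsmul_eq_mul, zero_smul, neg_smul, one_smul]
    push_cast
    linear_combination (treeT ^ 2 - treeT) * treeT_mul_treeY
  rw [e, coeff_poly] at h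
  rw [show ∑ p ∈ splits n, treeCoeff p.1 * treeCoeff p.2 * p.1 / p.2 =
    tau 3 n - 2 * tau 2 n + tau 1 n from ?_]
  · have := mul_tau 1 n
    rw [← tau_one]; push_cast at this; linear_combination this
  · rw [show tau 3 n - 2 * tau 2 n + tau 1 n =
      0 * tau 5 n + 0 * tau 4 n + 1 * tau 3 n + -2 * tau 2 n + 1 * tau 1 n by ring, h]
    refine Finset.sum_congr rfl fun p hp => ?_
    rw [coeff_theta, coeff_treeT, coeff_treeY]; ring

theorem linear_two (n : ℕ) :
    (n + 1) * n * treeCoeff n - ∑ p ∈ splits n, treeCoeff p.1 * treeCoeff p.2 * p.1 ^ 2 / p.2 =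
      3 * tau 4 n - 4 * tau 3 n + tau 2 n := by
  have h := coeff_mul_eq_sum_splits (F := theta ℚ (theta ℚ treeT)) (by simp [coeff_theta])
    coeff_zero_treeY n
  have e : theta ℚ (theta ℚ treeT) * treeY = (3 : ℚ) • treeT ^ 5 + (-8 : ℚ) • treeT ^ 4 +
      (7 : ℚ) • treeT ^ 3 + (-2 : ℚ) • treeT ^ 2 + (0 : ℚ) • treeT := by
    rw [theta_theta_treeT]
    simp only [ofNat_smul_eq_nsmul, nsmul_eq_mul, zero_smul, neg_smul]
    push_cast
    linear_combination (3 * treeT ^ 4 - 5 * treeT ^ 3 + 2 * treeT ^ 2) * treeT_mul_treeY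
  rw [e, coeff_poly] at h
  rw [show ∑ p ∈ splits n, treeCoeff p.1 * treeCoeff p.2 * p.1 ^ 2 / p.2 =
    3 * tau 5 n - 8 * tau 4 n + 7 * tau 3 n - 2 * tau 2 n from ?_]
  · have h1 := mul_tau 1 n
    have h2 := mul_tau 2 n
    have h3 := mul_tau 3 n
    rw [← tau_one]; push_cast at h1 h2 h3
    linear_combination (n + 1) * h1 + h3 - h2
  · rw [show 3 * tau 5 n - 8 * tau 4 n + 7 * tau 3 n - 2 * tau 2 n =
      3 * tau 5 n + -8 * tau 4 n + 7 * tau 3 n + -2 * tau 2 n + 0 * tau 1 n by ring, h]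
    refine Finset.sum_congr rfl fun p hp => ?_
    rw [coeff_theta, coeff_theta, coeff_treeT, coeff_treeY]; ring

end TreeSeries

section TwoVariables

open PowerSeries

/-- The homogeneous encoding `∑ g i j * x ^ i * z ^ j` of a double sequence, with
`x = a * X` and `z = X` over the coefficient ring `ℚ[a]`. -/
noncomputable def bi (g : ℕ → ℕ → ℚ) : (Polynomial ℚ)⟦X⟧ :=
  PowerSeries.mk fun n => ∑ p ∈ Finset.HasAntidiagonal.antidiagonal n,
    Polynomial.C (g p.1 p.2) * Polynomial.X ^ p.1

/-- A series in the variable `z`. -/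
noncomputable def ser2 (s : ℚ⟦X⟧) : (Polynomial ℚ)⟦X⟧ := PowerSeries.map Polynomial.C s

/-- A series in the variable `x`. -/
noncomputable def ser1 (s : ℚ⟦X⟧) : (Polynomial ℚ)⟦X⟧ := rescale Polynomial.X (ser2 s)

theorem coeff_bi (g : ℕ → ℕ → ℚ) (n : ℕ) : coeff n (bi g) =
    ∑ p ∈ Finset.HasAntidiagonal.antidiagonal n,
      Polynomial.C (g p.1 p.2) * Polynomial.X ^ p.1 := coeff_mk _ _

theorem coeff_ser2 (s : ℚ⟦X⟧) (n : ℕ) : coeff n (ser2 s) = Polynomial.C (coeff n s) := by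
  rw [ser2, coeff_map]

theorem coeff_ser1 (s : ℚ⟦X⟧) (n : ℕ) :
    coeff n (ser1 s) = Polynomial.C (coeff n s) * Polynomial.X ^ n := by
  rw [ser1, coeff_rescale, coeff_ser2, mul_comm]

theorem bi_coeff_coeff (g : ℕ → ℕ → ℚ) (A B : ℕ) : (coeff (A + B) (bi g)).coeff A = g A B := by
  rw [coeff_bi, Polynomial.finsetSum_coeff, Finset.sum_eq_single (A, B)]
  · simp
  · rintro ⟨i, j⟩ hij hne
    have : i + j = A + B := by simpa using hij
    rw [Polynomial.coeff_C_mul, Polynomial.coeff_X_pow, if_neg, mul_zero]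
    rintro rfl
    exact hne (by rw [show j = B by omega])
  · simp

theorem bi_injective {g h : ℕ → ℕ → ℚ} (H : bi g = bi h) : g = h := by
  funext A B
  rw [← bi_coeff_coeff g, H, bi_coeff_coeff]

theorem bi_add (g h : ℕ → ℕ → ℚ) : bi g + bi h = bi fun i j => g i j + h i j := by
  ext1 n
  rw [map_add]
  simp only [coeff_bi, ← Finset.sum_add_distrib, map_add, add_mul]

theorem ser1_mul_bi (s : ℚ⟦X⟧) (g : ℕ → ℕ → ℚ) : ser1 s * bi g = bi fun A B =>
    ∑ p ∈ Finset.HasAntidiagonal.antidiagonal A, coeff p.1 s * g p.2 B := by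
  ext1 n
  rw [PowerSeries.coeff_mul, coeff_bi]
  simp only [coeff_ser1, coeff_bi, map_sum, Finset.mul_sum, Finset.sum_mul]
  rw [Finset.sum_sigma', Finset.sum_sigma']
  refine Finset.sum_nbij' (fun q => ⟨(q.1.1 + q.2.1, q.2.2), (q.1.1, q.2.1)⟩)
    (fun q => ⟨(q.2.1, q.2.2 + q.1.2), (q.2.2, q.1.2)⟩) ?_ ?_ ?_ ?_ ?_
  · rintro ⟨⟨a, b⟩, ⟨c, d⟩⟩ h; simp at h ⊢; omega
  · rintro ⟨⟨a, b⟩, ⟨c, d⟩⟩ h; simp at h ⊢; omega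
  · rintro ⟨⟨a, b⟩, ⟨c, d⟩⟩ h; simp at h ⊢; omega
  · rintro ⟨⟨a, b⟩, ⟨c, d⟩⟩ h; simp at h ⊢; omega
  · rintro ⟨⟨a, b⟩, ⟨c, d⟩⟩ _; simp only [map_mul, pow_add]; ring

theorem ser2_mul_bi (s : ℚ⟦X⟧) (g : ℕ → ℕ → ℚ) : ser2 s * bi g = bi fun A B =>
    ∑ p ∈ Finset.HasAntidiagonal.antidiagonal B, coeff p.1 s * g A p.2 := by
  ext1 n
  rw [PowerSeries.coeff_mul, coeff_bi]
  simp only [coeff_ser2, coeff_bi, map_sum, Finset.mul_sum, Finset.sum_mul]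
  rw [Finset.sum_sigma', Finset.sum_sigma']
  refine Finset.sum_nbij' (fun q => ⟨(q.2.1, q.1.1 + q.2.2), (q.1.1, q.2.2)⟩)
    (fun q => ⟨(q.2.1, q.2.2 + q.1.1), (q.1.1, q.2.2)⟩) ?_ ?_ ?_ ?_ ?_
  · rintro ⟨⟨a, b⟩, ⟨c, d⟩⟩ h; simp at h ⊢; omega
  · rintro ⟨⟨a, b⟩, ⟨c, d⟩⟩ h; simp at h ⊢; omega
  · rintro ⟨⟨a, b⟩, ⟨c, d⟩⟩ h; simp at h ⊢; omega
  · rintro ⟨⟨a, b⟩, ⟨c, d⟩⟩ h; simp at h ⊢; omega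
  · rintro ⟨⟨a, b⟩, ⟨c, d⟩⟩ _; simp only [map_mul]; ring

theorem ser2_mul (s t : ℚ⟦X⟧) : ser2 (s * t) = ser2 s * ser2 t := map_mul _ _ _
theorem ser2_sub (s t : ℚ⟦X⟧) : ser2 (s - t) = ser2 s - ser2 t := map_sub (PowerSeries.map _) _ _
theorem ser2_one : ser2 1 = 1 := map_one (PowerSeries.map _)
theorem ser1_mul (s t : ℚ⟦X⟧) : ser1 (s * t) = ser1 s * ser1 t := by
  rw [ser1, ser2_mul, map_mul]; rfl
theorem ser1_sub (s t : ℚ⟦X⟧) : ser1 (s - t) = ser1 s - ser1 t := by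
  rw [ser1, ser2_sub, map_sub]; rfl
theorem ser1_one : ser1 1 = 1 := by rw [ser1, ser2_one, map_one]

theorem theta_ser2 (s : ℚ⟦X⟧) : theta _ (ser2 s) = ser2 (theta ℚ s) := by
  ext1 n
  rw [coeff_theta, coeff_ser2, coeff_ser2, coeff_theta, map_mul, map_natCast]

theorem theta_ser1 (s : ℚ⟦X⟧) : theta _ (ser1 s) = ser1 (theta ℚ s) := by
  ext1 n
  rw [coeff_theta, coeff_ser1, coeff_ser1, coeff_theta, map_mul, map_natCast, mul_assoc]

/-- The divided difference `(G x - G z) / (x - z)`. -/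
theorem divided_difference (s : ℚ⟦X⟧) :
    (C Polynomial.X * X - X : (Polynomial ℚ)⟦X⟧) * bi (fun i j => coeff (i + j + 1) s) =
      ser1 s - ser2 s := by
  have hx : (C Polynomial.X * X - X : (Polynomial ℚ)⟦X⟧) = C (Polynomial.X - 1) * X := by
    rw [map_sub, map_one]; ring
  ext1 n
  rw [hx, mul_assoc, coeff_C_mul, map_sub, coeff_ser1, coeff_ser2]
  cases n with
  | zero => simp
  | succ n =>
    rw [mul_comm X, coeff_succ_mul_X, coeff_bi]
    have h : ∀ p ∈ Finset.HasAntidiagonal.antidiagonal n,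
        Polynomial.C (coeff (p.1 + p.2 + 1) s) * Polynomial.X ^ p.1 =
        Polynomial.C (coeff (n + 1) s) * (Polynomial.X ^ p.1 : Polynomial ℚ) := by
      intro p hp
      rw [show p.1 + p.2 = n by simpa using hp]
    rw [Finset.sum_congr rfl h, ← Finset.mul_sum,
      Finset.Nat.sum_antidiagonal_eq_sum_range_succ_mk]
    have := mul_geom_sum (Polynomial.X : Polynomial ℚ) (n + 1)
    simp only
    linear_combination Polynomial.C (coeff (n + 1) s) * this

theorem X_sub_ne_zero : (C Polynomial.X * X - X : (Polynomial ℚ)⟦X⟧) ≠ 0 := by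
  intro h
  have h2 := congrArg (coeff 1) h
  rw [map_sub, coeff_C_mul, coeff_one_X, map_zero, mul_one] at h2
  exact Polynomial.X_sub_C_ne_zero (1 : ℚ) (by simpa using h2)

theorem theta_X {R : Type*} [CommRing R] : theta R X = X := by
  ext n
  rw [coeff_theta, coeff_X]
  split_ifs with h <;> simp [h]

theorem theta_C_mul {R : Type*} [CommRing R] (c : R) (f : R⟦X⟧) :
    theta R (C c * f) = C c * theta R f := by
  ext n
  rw [coeff_theta, coeff_C_mul, coeff_C_mul, coeff_theta]; ring

/-- A solution of `θ W = F * W` with `F` of constant term one is determined by its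
coefficients of degree at most one. -/
theorem eq_zero_of_theta_eq {W F : (Polynomial ℚ)⟦X⟧} (h : theta _ W = F * W)
    (hF : coeff 0 F = 1) (h0 : coeff 0 W = 0) (h1 : coeff 1 W = 0) : W = 0 := by
  ext1 n
  rw [map_zero]
  induction n using Nat.strong_induction_on with
  | _ n ih =>
    rcases Nat.lt_or_ge n 2 with hn | hn
    · interval_cases n <;> assumption
    · have h2 := congrArg (coeff n) h
      rw [coeff_theta, PowerSeries.coeff_mul, Finset.sum_eq_single (0, n), hF, one_mul] at h2
      · have h3 : ((n - 1 : ℕ) : Polynomial ℚ) * coeff n W = 0 := by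
          rw [Nat.cast_sub (by omega), Nat.cast_one]; linear_combination h2
        rcases mul_eq_zero.1 h3 with h4 | h4
        · have : n - 1 = 0 := by exact_mod_cast h4
          omega
        · exact h4
      · rintro ⟨i, j⟩ hij hne
        have hs : i + j = n := by simpa using hij
        have : j < n := by
          by_contra hc
          exact hne (by rw [show i = 0 by omega, show j = n by omega])
        rw [ih j this, mul_zero]
      · simp

end TwoVariables

section TwoVariables

open PowerSeries

theorem theta_bi (g : ℕ → ℕ → ℚ) : theta _ (bi g) = bi fun i j => (i + j : ℚ) * g i j := by
  ext1 n
  rw [coeff_theta, coeff_bi, coeff_bi, Finset.mul_sum]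
  refine Finset.sum_congr rfl fun p hp => ?_
  have hp : p.1 + p.2 = n := by simpa using hp
  rw [← hp]
  simp only [map_mul, map_add, map_natCast, Nat.cast_add]; ring

theorem ser1_mul_ser2 (s t : ℚ⟦X⟧) :
    ser1 s * ser2 t = bi fun i j => coeff i s * coeff j t := by
  ext1 n
  rw [PowerSeries.coeff_mul, coeff_bi]
  refine Finset.sum_congr rfl fun p _ => ?_
  rw [coeff_ser1, coeff_ser2, map_mul]; ring

theorem theta_mul {R : Type*} [CommRing R] (f g : R⟦X⟧) :
    theta R (f * g) = f * theta R g + g * theta R f := Derivation.leibniz _ _ _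

theorem theta_one {R : Type*} [CommRing R] : theta R 1 = 0 := Derivation.map_one_eq_zero _

/-- The series with coefficients `κ i * κ j * j / (i + j)`. -/
noncomputable def treeQ : (Polynomial ℚ)⟦X⟧ :=
  bi fun i j => treeCoeff i * treeCoeff j * j / (i + j)

/-- The series with coefficients `κ i * κ j * i / (i + j)`. -/
noncomputable def treeQ' : (Polynomial ℚ)⟦X⟧ :=
  bi fun i j => treeCoeff i * treeCoeff j * i / (i + j)

theorem theta_treeQ : theta _ treeQ = ser1 treeT * theta _ (ser2 treeT) := by
  rw [treeQ, theta_bi, theta_ser2, ser1_mul_ser2]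
  congr 1; funext i j
  rw [coeff_theta, coeff_treeT, coeff_treeT]
  rcases (i + j).eq_zero_or_pos with h | h
  · obtain ⟨rfl, rfl⟩ : i = 0 ∧ j = 0 := by omega
    simp
  · have : (i + j : ℚ) ≠ 0 := by exact_mod_cast h.ne'
    field_simp

theorem treeQ_add : treeQ + treeQ' = ser1 treeT * ser2 treeT - 1 := by
  rw [ser1_mul_ser2, treeQ, treeQ', bi_add, eq_sub_iff_add_eq]
  have : (1 : (Polynomial ℚ)⟦X⟧) = bi fun i j => if i + j = 0 then 1 else 0 := by
    ext1 n
    rw [coeff_bi, coeff_one]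
    split_ifs with h
    · subst h; simp
    · refine (Finset.sum_eq_zero fun p hp => ?_).symm
      rw [if_neg (by rw [show p.1 + p.2 = n by simpa using hp]; exact h)]; simp
  rw [this, bi_add]
  congr 1; funext i j
  rw [coeff_treeT, coeff_treeT]
  split_ifs with h
  · obtain ⟨rfl, rfl⟩ : i = 0 ∧ j = 0 := by omega
    simp [treeCoeff]
  · have : (i + j : ℚ) ≠ 0 := by exact_mod_cast h
    field_simp; ring

theorem ser1_treeT_mul : ser1 treeT * (1 - ser1 treeY) = 1 := by
  rw [← ser1_one, ← ser1_sub, ← ser1_mul, treeT_mul]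

theorem ser2_treeT_mul : ser2 treeT * (1 - ser2 treeY) = 1 := by
  rw [← ser2_one, ← ser2_sub, ← ser2_mul, treeT_mul]

/-- The divided difference of the tree series. -/
noncomputable def treeP : (Polynomial ℚ)⟦X⟧ := bi fun i j => coeff (i + j + 1) treeY

theorem mul_treeP : (C Polynomial.X * X - X) * treeP = ser1 treeY - ser2 treeY :=
  divided_difference treeY

theorem ser_sub : ser1 treeT - ser2 treeT =
    (ser1 treeY - ser2 treeY) * (ser1 treeT * ser2 treeT) := by
  linear_combination ser2 treeT * ser1_treeT_mul - ser1 treeT * ser2_treeT_mul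

theorem theta_treeP : theta _ treeP = (ser1 treeT * ser2 treeT - 1) * treeP := by
  have h := congrArg (theta _) mul_treeP
  rw [theta_mul, map_sub, map_sub, theta_C_mul, theta_X, theta_ser1, theta_ser2,
    theta_treeY, ser1_sub, ser2_sub, ser1_one, ser2_one] at h
  refine mul_left_cancel₀ X_sub_ne_zero ?_
  linear_combination h + ser_sub - mul_treeP * (ser1 treeT * ser2 treeT)

theorem theta_ser2_treeT : theta _ (ser2 treeT) = ser2 treeT ^ 2 * (ser2 treeT - 1) := by
  rw [theta_ser2, theta_treeT, show treeT ^ 3 - treeT ^ 2 = treeT * treeT * (treeT - 1) by ring,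
    ser2_mul, ser2_mul, ser2_sub, ser2_one]; ring

theorem sub_mul_treeQ : (ser1 treeY - ser2 treeY) * treeQ = X * treeP - (ser2 treeT - 1) := by
  rw [← sub_eq_zero]
  refine eq_zero_of_theta_eq (F := ser1 treeT * ser2 treeT) ?_ ?_ ?_ ?_
  · simp only [map_sub, theta_mul, theta_treeQ, theta_treeP, theta_X, theta_one]
    rw [theta_ser1, theta_ser2 treeY, theta_treeY, theta_ser2_treeT, ser1_sub, ser2_sub, ser1_one,
      ser2_one]
    linear_combination treeQ * ser_sub - ser2 treeT * (ser2 treeT - 1) * ser_sub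
  · rw [ser1_mul_ser2]
    have := bi_coeff_coeff (fun i j => coeff i treeT * coeff j treeT) 0 0
    rw [coeff_bi]
    simp [treeCoeff_zero, coeff_treeT, -coeff_zero_eq_constantCoeff]
  · simp [treeCoeff_zero, coeff_treeT, coeff_treeY, coeff_ser1, coeff_ser2, coeff_mul,
      -coeff_zero_eq_constantCoeff]
  · simp [treeCoeff, coeff_treeT, coeff_treeY, coeff_ser1, coeff_ser2, coeff_mul, treeP, treeQ,
      coeff_bi, Finset.Nat.antidiagonal_succ, coeff_one, coeff_X,
      -coeff_zero_eq_constantCoeff]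

theorem ser_ne_zero : ser1 treeY - ser2 treeY ≠ 0 := by
  rw [← mul_treeP]
  refine mul_ne_zero X_sub_ne_zero fun h => ?_
  have := bi_injective (h.trans (show (0 : (Polynomial ℚ)⟦X⟧) = bi 0 by ext1 n; simp [coeff_bi]))
  have := congrFun (congrFun this 0) 0
  simp [coeff_treeY, treeCoeff] at this

theorem treeQ_identity : (ser1 treeT - 1) * treeQ + (ser2 treeT - 1) * treeQ' =
    X * bi (fun i j => coeff (i + j + 1) treeT) - (ser2 treeT - 1) := by
  refine mul_left_cancel₀ ser_ne_zero ?_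
  have h2 : treeQ' = ser1 treeT * ser2 treeT - 1 - treeQ := by
    rw [← treeQ_add]; ring
  have h3 := divided_difference treeT
  rw [h2]
  linear_combination (ser1 treeT - ser2 treeT) * sub_mul_treeQ - (ser2 treeT - 1) * ser_sub
    + X * bi (fun i j => coeff (i + j + 1) treeT) * mul_treeP - X * treeP * h3

theorem sum_antidiagonal_eq_splits {n : ℕ} (hn : 0 < n) (f : ℕ × ℕ → ℚ) :
    ∑ p ∈ Finset.HasAntidiagonal.antidiagonal n, f p =
      f (0, n) + f (n, 0) + ∑ p ∈ splits n, f p := by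
  have h : Finset.HasAntidiagonal.antidiagonal n = insert (0, n) (insert (n, 0) (splits n)) := by
    ext ⟨i, j⟩
    simp only [Finset.HasAntidiagonal.mem_antidiagonal, Finset.mem_insert, mem_splits,
      Prod.mk.injEq]
    omega
  rw [h, Finset.sum_insert, Finset.sum_insert, add_assoc]
  · simp [mem_splits]
  · simp [mem_splits]; omega

/-- The weighted convolution over the splittings of two coalescing cycles. -/
noncomputable def splitSum (e A B : ℕ) : ℚ :=
  treeCoeff B * ∑ p ∈ splits A, treeCoeff p.1 * treeCoeff p.2 * p.1 ^ e * (B / (p.2 + B)) +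
  treeCoeff A * ∑ p ∈ splits B, treeCoeff p.1 * treeCoeff p.2 * p.1 ^ e * (A / (p.2 + A))

theorem splitSum_zero {A B : ℕ} (hA : 0 < A) (hB : 0 < B) :
    splitSum 0 A B = treeCoeff (A + B) - 2 * treeCoeff A * treeCoeff B := by
  have h := treeQ_identity
  have hX : (X : (Polynomial ℚ)⟦X⟧) = ser2 X := by rw [ser2, PowerSeries.map_X]
  have h2 : ser2 treeT - 1 = ser1 1 * ser2 (treeT - 1) := by
    rw [ser1_one, ser2_sub, ser2_one, one_mul]
  rw [show ser1 treeT - 1 = ser1 (treeT - 1) by rw [ser1_sub, ser1_one],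
    eq_sub_iff_add_eq] at h
  nth_rw 2 [h2] at h
  rw [show ser2 treeT - 1 = ser2 (treeT - 1) by rw [ser2_sub, ser2_one], treeQ, treeQ', hX,
    ser1_mul_bi, ser2_mul_bi, ser2_mul_bi, ser1_mul_ser2, bi_add, bi_add] at h
  have h3 := congrFun (congrFun (bi_injective h) A) B
  have h4 : ∑ p ∈ Finset.HasAntidiagonal.antidiagonal B,
      coeff p.1 (X : ℚ⟦X⟧) * coeff (A + p.2 + 1) treeT = treeCoeff (A + B) := by
    rw [Finset.sum_eq_single (1, B - 1)]
    · rw [coeff_one_X, one_mul, coeff_treeT, show A + (B - 1) + 1 = A + B by omega]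
    · rintro ⟨i, j⟩ hij hne
      rw [coeff_X, if_neg, zero_mul]
      rintro rfl
      have : 1 + j = B := by simpa using hij
      exact hne (by rw [show j = B - 1 by omega])
    · intro h'
      exact absurd (Finset.HasAntidiagonal.mem_antidiagonal.2
        (show 1 + (B - 1) = B by omega)) h'
  rw [h4, sum_antidiagonal_eq_splits hA, sum_antidiagonal_eq_splits hB, coeff_zero_treeT_sub_one,
    coeff_treeT_sub_one hA, coeff_treeT_sub_one hB, coeff_one, if_neg hA.ne', treeCoeff_zero] at h3
  rw [splitSum, Finset.mul_sum, Finset.mul_sum]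
  have hA' : (A : ℚ) ≠ 0 := by positivity
  have hB' : (B : ℚ) ≠ 0 := by positivity
  have e1 : ∑ p ∈ splits A, treeCoeff B * (treeCoeff p.1 * treeCoeff p.2 * (p.1 : ℚ) ^ 0 *
      (B / (p.2 + B))) = ∑ p ∈ splits A, coeff p.1 (treeT - 1) *
      (treeCoeff p.2 * treeCoeff B * B / (p.2 + B)) := by
    refine Finset.sum_congr rfl fun p hp => ?_
    rw [mem_splits] at hp
    rw [coeff_treeT_sub_one hp.2.1]; ring
  have e2 : ∑ p ∈ splits B, treeCoeff A * (treeCoeff p.1 * treeCoeff p.2 * (p.1 : ℚ) ^ 0 *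
      (A / (p.2 + A))) = ∑ p ∈ splits B, coeff p.1 (treeT - 1) *
      (treeCoeff A * treeCoeff p.2 * A / (A + p.2)) := by
    refine Finset.sum_congr rfl fun p hp => ?_
    rw [mem_splits] at hp
    rw [coeff_treeT_sub_one hp.2.1, add_comm (A : ℚ)]; ring
  rw [e1, e2]
  simp only [Nat.cast_zero, zero_add, add_zero, one_mul, mul_one, zero_mul,
    mul_div_cancel_right₀ _ hA', mul_div_cancel_right₀ _ hB'] at h3
  linear_combination h3

theorem splitSum_succ {A B : ℕ} (hA : 0 < A) (hB : 0 < B) (e : ℕ) :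
    splitSum (e + 1) A B = (A + B) * splitSum e A B -
      treeCoeff B * B * (∑ p ∈ splits A, treeCoeff p.1 * treeCoeff p.2 * p.1 ^ e) -
      treeCoeff A * A * (∑ p ∈ splits B, treeCoeff p.1 * treeCoeff p.2 * p.1 ^ e) := by
  have aux : ∀ A B : ℕ, 0 < B →
      ∑ p ∈ splits A, treeCoeff p.1 * treeCoeff p.2 * p.1 ^ (e + 1) * (B / (p.2 + B)) =
      (A + B) * (∑ p ∈ splits A, treeCoeff p.1 * treeCoeff p.2 * p.1 ^ e * (B / (p.2 + B))) -
      B * ∑ p ∈ splits A, treeCoeff p.1 * treeCoeff p.2 * p.1 ^ e := by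
    intro A B hB
    rw [Finset.mul_sum, Finset.mul_sum, ← Finset.sum_sub_distrib]
    refine Finset.sum_congr rfl fun p hp => ?_
    rw [mem_splits] at hp
    have h1 : (A : ℚ) = p.1 + p.2 := by exact_mod_cast hp.1.symm
    have : (p.2 + B : ℚ) ≠ 0 := by positivity
    rw [h1]; field_simp; ring
  unfold splitSum
  rw [aux A B hB, aux B A hA]; ring

theorem splitSum_one {A B : ℕ} (hA : 0 < A) (hB : 0 < B) :
    splitSum 1 A B = treeCoeff (A + B) * (A + B : ℕ) -
      tau 2 A * (tau 3 B - tau 2 B) - tau 2 B * (tau 3 A - tau 2 A) := by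
  rw [splitSum_succ hA hB, splitSum_zero hA hB]
  simp only [pow_zero, mul_one]
  rw [sum_splits_zero hA, sum_splits_zero hB]
  have h1 := mul_tau 1 A
  have h2 := mul_tau 1 B
  rw [tau_one] at h1 h2
  push_cast at *
  linear_combination - tau 2 A * h2 - tau 2 B * h1

theorem splitSum_two {A B : ℕ} (hA : 0 < A) (hB : 0 < B) :
    splitSum 2 A B = treeCoeff (A + B) * (A + B : ℕ) ^ 2 -
      (tau 3 A - tau 2 A) * (3 * tau 4 B - 4 * tau 3 B + tau 2 B) -
      (tau 3 B - tau 2 B) * (3 * tau 4 A - 4 * tau 3 A + tau 2 A) -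
      (A ^ 2 * treeCoeff A) * tau 2 B - (B ^ 2 * treeCoeff B) * tau 2 A := by
  rw [splitSum_succ hA hB, splitSum_one hA hB]
  simp only [pow_one]
  rw [sum_splits_one, sum_splits_one]
  have h1 := mul_tau 1 A
  have h2 := mul_tau 1 B
  have h3 := mul_tau 2 A
  have h4 := mul_tau 2 B
  rw [tau_one] at h1 h2
  push_cast at *
  linear_combination (A * tau 2 B - (tau 4 B - 2 * tau 3 B + tau 2 B)) * h1 +
    (B * tau 2 A - (tau 4 A - 2 * tau 3 A + tau 2 A)) * h2 - (tau 3 B - tau 2 B) * h3 -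
    (tau 3 A - tau 2 A) * h4
end TwoVariables

namespace SetAlg

variable {ι : Type*} [DecidableEq ι] (α : ι → ℕ)

/-- The genus zero numbers with a distinguished cycle of length `l`. -/
noncomputable def rootZero (l : ℕ) : SetAlg ι :=
  ⟨fun J => ((l : ℚ) + ∑ i ∈ J, (α i : ℚ)) ^ ((#J : ℤ) - 2)⟩

variable [Fintype ι]

omit [DecidableEq ι] [Fintype ι] in
theorem rootZero_apply (l : ℕ) (J : Finset ι) :
    rootZero α l J = ((l : ℚ) + ∑ i ∈ J, (α i : ℚ)) ^ ((#J : ℤ) - 2) := rfl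

/-- A marked component. -/
def comp (i : ι) : SetAlg ι := single i * spow α (α i)

/-- The cut and join operator on families indexed by the size of the distinguished cycle. -/
noncomputable def cutJoin (Y : ℕ → SetAlg ι) : SetAlg ι :=
  ∑ i, ((treeCoeff (α i))⁻¹ * ((α i + 1) / α i)) • (single i * Y (α i)) -
  (1 / 2 : ℚ) • ∑ i, ∑ j, ((treeCoeff (α i))⁻¹ * (treeCoeff (α j))⁻¹) •
    (single i * (single j * Y (α i + α j))) -
  ∑ i, (treeCoeff (α i))⁻¹ • (single i * ∑ p ∈ splits (α i),
    (treeCoeff p.2 * p.2) • (rootZero α p.2 * Y p.1))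

variable {α}

theorem rootZero_eq {l : ℕ} (hl : 0 < l) : (l : ℚ) • rootZero α l =
    (1 / l : ℚ) • spow α l - ∑ a, ((α a : ℚ) / (l + α a)) • (single a * spow α (l + α a)) := by
  ext J
  have hl' : (l : ℚ) ≠ 0 := by positivity
  have hs : (0 : ℚ) < (l : ℚ) + ∑ i ∈ J, (α i : ℚ) := by positivity
  rw [sub_apply, sum_smul_single_mul_apply, smul_apply, smul_apply, rootZero_apply]
  rcases J.eq_empty_or_nonempty with rfl | hJ
  · simp [spow_apply]; field_simp
  · obtain ⟨b, hb⟩ : ∃ b, #J = b + 1 := ⟨#J - 1, by have := hJ.card_pos; omega⟩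
    have h : ∀ a ∈ J, (α a : ℚ) / (l + α a) * spow α (l + α a) (J.erase a) =
        α a * ((l : ℚ) + ∑ i ∈ J, (α i : ℚ)) ^ ((b : ℤ) - 1) := by
      intro a ha
      have h0 : (l + α a : ℚ) ≠ 0 := by positivity
      have hc := card_erase_add_sum α ha l
      rw [spow_apply]
      split_ifs with he
      · have hc1 := Finset.card_erase_of_mem ha
        rw [he, Finset.card_empty] at hc1
        obtain rfl : b = 0 := by omega
        rw [he, Finset.sum_empty, add_zero] at hc
        rw [← hc]; push_cast; simp [div_eq_mul_inv]
      · have hc1 := Finset.card_erase_of_mem ha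
        have : (J.erase a).card ≠ 0 := by simpa using he
        obtain ⟨c, rfl⟩ : ∃ c, b = c + 1 := ⟨b - 1, by omega⟩
        rw [hc, hc1, hb, show c + 1 + 1 - 1 - 1 = c by omega,
          show ((c + 1 : ℕ) : ℤ) - 1 = (c : ℤ) by push_cast; ring, zpow_natCast]
        push_cast; field_simp
    rw [Finset.sum_congr rfl h, ← Finset.sum_mul, spow_apply, if_neg hJ.ne_empty, hb,
      Nat.add_sub_cancel, show ((b + 1 : ℕ) : ℤ) - 2 = (b : ℤ) - 1 by push_cast; ring,
      zpow_sub_one₀ hs.ne', zpow_natCast]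
    field_simp
    ring

theorem sum_sum_smul_mul (f g : ι → ℚ) (w : ι → SetAlg ι) :
    ∑ i, ∑ j, (f i * g j) • (w i * w j) = (∑ i, f i • w i) * ∑ j, g j • w j := by
  rw [Finset.sum_mul_sum]
  refine Finset.sum_congr rfl fun i _ => Finset.sum_congr rfl fun j _ => ?_
  rw [smul_mul_smul_comm]

theorem sum_splits_rootZero (hα : ∀ i, 0 < α i) (e n : ℕ) :
    ∑ p ∈ splits n, (treeCoeff p.2 * p.2) •
      (rootZero α p.2 * ((treeCoeff p.1 * p.1 ^ e : ℚ) • spow α p.1)) =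
    (∑ p ∈ splits n, treeCoeff p.1 * treeCoeff p.2 * p.1 ^ e / p.2) • spow α n -
    ∑ a, (∑ p ∈ splits n, treeCoeff p.1 * treeCoeff p.2 * p.1 ^ e * (α a / (p.2 + α a))) •
      (comp α a * spow α n) := by
  simp only [Finset.sum_smul]
  rw [Finset.sum_comm, ← Finset.sum_sub_distrib]
  refine Finset.sum_congr rfl fun p hp => ?_
  rw [mem_splits] at hp
  have h1 : ∀ c : ℚ, (treeCoeff p.2 * p.2) • (rootZero α p.2 * (c • spow α p.1)) =
      (c * treeCoeff p.2) • (((p.2 : ℚ) • rootZero α p.2) * spow α p.1) := by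
    intro c
    rw [mul_smul_comm, smul_mul_assoc, smul_smul, smul_smul]
    congr 1; ring
  rw [h1, rootZero_eq hp.2.2, sub_mul, smul_sub, smul_mul_assoc, ← spow_add hα, smul_smul,
    Finset.sum_mul, Finset.smul_sum, add_comm p.2, hp.1]
  congr 1
  · congr 1; ring
  · refine Finset.sum_congr rfl fun a _ => ?_
    rw [smul_mul_assoc, smul_smul, comp, mul_assoc (single a) (spow α (p.2 + α a)),
      mul_assoc (single a) (spow α (α a)), ← spow_add hα, ← spow_add hα]
    congr 1
    · ring
    · congr 2; omega

theorem cutJoin_spow (hα : ∀ i, 0 < α i) (e : ℕ) :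
    cutJoin α (fun k => (treeCoeff k * k ^ e : ℚ) • spow α k) =
    ∑ i, ((treeCoeff (α i))⁻¹ * ((α i + 1) / α i * (treeCoeff (α i) * α i ^ e) -
      ∑ p ∈ splits (α i), treeCoeff p.1 * treeCoeff p.2 * p.1 ^ e / p.2)) • comp α i +
    (1 / 2 : ℚ) • ∑ i, ∑ j, ((treeCoeff (α i))⁻¹ * (treeCoeff (α j))⁻¹ *
      (splitSum e (α i) (α j) - treeCoeff (α i + α j) * (α i + α j : ℕ) ^ e)) •
      (comp α i * comp α j) := by
  have key : ∑ i, (treeCoeff (α i))⁻¹ • (single i * ∑ a, (∑ p ∈ splits (α i),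
        treeCoeff p.1 * treeCoeff p.2 * p.1 ^ e * (α a / (p.2 + α a))) •
        (comp α a * spow α (α i))) =
      (1 / 2 : ℚ) • ∑ i, ∑ j, ((treeCoeff (α i))⁻¹ * (treeCoeff (α j))⁻¹ *
        splitSum e (α i) (α j)) • (comp α i * comp α j) := by
    set c : ι → ι → ℚ := fun i a => (treeCoeff (α i))⁻¹ * ∑ p ∈ splits (α i),
        treeCoeff p.1 * treeCoeff p.2 * p.1 ^ e * ((α a : ℚ) / (p.2 + α a)) with hc
    have h1 : ∑ i, (treeCoeff (α i))⁻¹ • (single i * ∑ a, (∑ p ∈ splits (α i),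
        treeCoeff p.1 * treeCoeff p.2 * p.1 ^ e * ((α a : ℚ) / (p.2 + α a))) •
        (comp α a * spow α (α i))) = ∑ i, ∑ a, c i a • (comp α i * comp α a) := by
      refine Finset.sum_congr rfl fun i _ => ?_
      rw [Finset.mul_sum, Finset.smul_sum]
      refine Finset.sum_congr rfl fun a _ => ?_
      rw [mul_smul_comm, smul_smul]
      congr 1
      rw [comp, comp]; ring
    have h2 : ∑ i, ∑ a, c i a • (comp α i * comp α a) =
        ∑ i, ∑ a, c a i • (comp α i * comp α a) := by
      rw [Finset.sum_comm]
      refine Finset.sum_congr rfl fun i _ => Finset.sum_congr rfl fun a _ => ?_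
      rw [mul_comm (comp α a)]
    have h3 : ∑ i, ∑ j, ((treeCoeff (α i))⁻¹ * (treeCoeff (α j))⁻¹ *
        splitSum e (α i) (α j)) • (comp α i * comp α j) =
        ∑ i, ∑ a, c i a • (comp α i * comp α a) + ∑ i, ∑ a, c a i • (comp α i * comp α a) := by
      simp only [← Finset.sum_add_distrib, ← add_smul]
      refine Finset.sum_congr rfl fun i _ => Finset.sum_congr rfl fun j _ => ?_
      congr 1
      have hi := (treeCoeff_pos (α i)).ne'
      have hj := (treeCoeff_pos (α j)).ne'
      simp only [hc, splitSum]
      generalize ∑ p ∈ splits (α i), treeCoeff p.1 * treeCoeff p.2 * (p.1 : ℚ) ^ e *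
        ((α j : ℚ) / (p.2 + α j)) = x
      generalize ∑ p ∈ splits (α j), treeCoeff p.1 * treeCoeff p.2 * (p.1 : ℚ) ^ e *
        ((α i : ℚ) / (p.2 + α i)) = y
      field_simp
    rw [h1, h3, ← h2, ← two_smul ℚ, smul_smul]
    norm_num
  have h3 : ∀ i j, single i * (single j * spow α (α i + α j)) = comp α i * comp α j := by
    intro i j
    rw [spow_add hα, comp, comp]; ring
  rw [cutJoin]
  simp only [sum_splits_rootZero hα]
  simp only [mul_sub, smul_sub, Finset.sum_sub_distrib, key]
  simp only [mul_smul_comm, smul_smul, sub_smul, Finset.sum_sub_distrib, h3, smul_sub, mul_assoc]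
  simp only [comp]
  abel

/-- The symmetric series built from the coefficients of the powers of the tree series. -/
noncomputable def tauSum (α : ι → ℕ) (e : ℕ) : SetAlg ι :=
  ∑ i, ((treeCoeff (α i))⁻¹ * tau e (α i)) • comp α i

theorem psum_one : psum α 1 = tauSum α 3 - tauSum α 2 := by
  simp only [psum, tauSum, ← Finset.sum_sub_distrib, ← sub_smul]
  refine Finset.sum_congr rfl fun i _ => ?_
  congr 1
  have h1 := mul_tau 1 (α i)
  have := (treeCoeff_pos (α i)).ne'
  rw [tau_one] at h1
  push_cast at h1
  field_simp
  linear_combination h1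

theorem psum_two : psum α 2 = ∑ i, ((α i : ℚ) ^ 2) • comp α i := rfl

theorem cutJoin_zero (hα : ∀ i, 0 < α i) :
    cutJoin α (fun k => treeCoeff k • spow α k) =
      (2 : ℚ) • ∑ i, (1 / α i : ℚ) • comp α i - psum α 0 * psum α 0 := by
  have h := cutJoin_spow hα 0
  simp only [pow_zero, mul_one] at h
  have h1 : ∀ i, (treeCoeff (α i))⁻¹ * ((α i + 1) / α i * treeCoeff (α i) -
      ∑ p ∈ splits (α i), treeCoeff p.1 * treeCoeff p.2 / p.2) = 2 * (1 / α i : ℚ) := by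
    intro i
    have := (treeCoeff_pos (α i)).ne'
    rw [linear_zero (hα i)]; field_simp
  have h2 : ∀ i j, (treeCoeff (α i))⁻¹ * (treeCoeff (α j))⁻¹ *
      (splitSum 0 (α i) (α j) - treeCoeff (α i + α j)) = (-2 : ℚ) := by
    intro i j
    have := (treeCoeff_pos (α i)).ne'
    have := (treeCoeff_pos (α j)).ne'
    rw [splitSum_zero (hα i) (hα j)]; field_simp; ring
  have h4 : psum α 0 = ∑ i, comp α i := by simp [psum, comp]
  rw [h]
  simp only [h1, h2, mul_smul (2 : ℚ), ← Finset.smul_sum, h4, Finset.sum_mul_sum]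
  module

theorem tauSum_eq (e : ℕ) :
    ∑ i, ((treeCoeff (α i))⁻¹ * tau e (α i)) • comp α i = tauSum α e := rfl

theorem cutJoin_one (hα : ∀ i, 0 < α i) :
    cutJoin α (fun k => (treeCoeff k * k : ℚ) • spow α k) = tauSum α 2 * (1 - psum α 1) := by
  have h := cutJoin_spow hα 1
  simp only [pow_one] at h
  have h1 : ∀ i, (treeCoeff (α i))⁻¹ * ((α i + 1) / α i * (treeCoeff (α i) * α i) -
      ∑ p ∈ splits (α i), treeCoeff p.1 * treeCoeff p.2 * p.1 / p.2) =
      (treeCoeff (α i))⁻¹ * tau 2 (α i) := by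
    intro i
    have : (α i : ℚ) ≠ 0 := by exact_mod_cast (hα i).ne'
    rw [← linear_one]; field_simp
  have h2 : ∀ i j, (treeCoeff (α i))⁻¹ * (treeCoeff (α j))⁻¹ *
      (splitSum 1 (α i) (α j) - treeCoeff (α i + α j) * (α i + α j : ℕ)) =
      -(((treeCoeff (α i))⁻¹ * tau 2 (α i)) * ((treeCoeff (α j))⁻¹ * tau 3 (α j))) -
      ((treeCoeff (α i))⁻¹ * tau 3 (α i)) * ((treeCoeff (α j))⁻¹ * tau 2 (α j)) +
      (2 : ℚ) * (((treeCoeff (α i))⁻¹ * tau 2 (α i)) * ((treeCoeff (α j))⁻¹ * tau 2 (α j))) := by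
    intro i j
    rw [splitSum_one (hα i) (hα j)]; ring
  rw [h]
  simp only [h1, h2, add_smul, sub_smul, neg_smul, mul_smul (2 : ℚ), Finset.sum_add_distrib,
    Finset.sum_sub_distrib, Finset.sum_neg_distrib, ← Finset.smul_sum, sum_sum_smul_mul
      (fun i => (treeCoeff (α i))⁻¹ * tau _ (α i)) (fun i => (treeCoeff (α i))⁻¹ * tau _ (α i)),
    tauSum_eq]
  rw [psum_one, mul_comm (tauSum α 3), mul_sub, mul_sub, mul_one]
  module

theorem cutJoin_two (hα : ∀ i, 0 < α i) :
    cutJoin α (fun k => (treeCoeff k * k ^ 2 : ℚ) • spow α k) =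
      ((3 : ℚ) • tauSum α 4 - (4 : ℚ) • tauSum α 3 + tauSum α 2) * (1 - psum α 1) -
        psum α 2 * tauSum α 2 := by
  have h := cutJoin_spow hα 2
  have h1 : ∀ i, (treeCoeff (α i))⁻¹ * ((α i + 1) / α i * (treeCoeff (α i) * α i ^ 2) -
      ∑ p ∈ splits (α i), treeCoeff p.1 * treeCoeff p.2 * p.1 ^ 2 / p.2) =
      3 * ((treeCoeff (α i))⁻¹ * tau 4 (α i)) - 4 * ((treeCoeff (α i))⁻¹ * tau 3 (α i)) +
      (treeCoeff (α i))⁻¹ * tau 2 (α i) := by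
    intro i
    have : (α i : ℚ) ≠ 0 := by exact_mod_cast (hα i).ne'
    have h3 := linear_two (α i)
    have h4 : ((α i : ℚ) + 1) / α i * (treeCoeff (α i) * α i ^ 2) =
      (α i + 1) * α i * treeCoeff (α i) := by field_simp
    rw [h4, h3]; ring
  have h2 : ∀ i j, (treeCoeff (α i))⁻¹ * (treeCoeff (α j))⁻¹ *
      (splitSum 2 (α i) (α j) - treeCoeff (α i + α j) * (α i + α j : ℕ) ^ 2) =
      (-3 : ℚ) * (((treeCoeff (α i))⁻¹ * tau 3 (α i)) * ((treeCoeff (α j))⁻¹ * tau 4 (α j))) +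
      (8 : ℚ) * (((treeCoeff (α i))⁻¹ * tau 3 (α i)) * ((treeCoeff (α j))⁻¹ * tau 3 (α j))) +
      (-5 : ℚ) * (((treeCoeff (α i))⁻¹ * tau 3 (α i)) * ((treeCoeff (α j))⁻¹ * tau 2 (α j))) +
      (3 : ℚ) * (((treeCoeff (α i))⁻¹ * tau 2 (α i)) * ((treeCoeff (α j))⁻¹ * tau 4 (α j))) +
      (-5 : ℚ) * (((treeCoeff (α i))⁻¹ * tau 2 (α i)) * ((treeCoeff (α j))⁻¹ * tau 3 (α j))) +
      (2 : ℚ) * (((treeCoeff (α i))⁻¹ * tau 2 (α i)) * ((treeCoeff (α j))⁻¹ * tau 2 (α j))) +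
      (-3 : ℚ) * (((treeCoeff (α i))⁻¹ * tau 4 (α i)) * ((treeCoeff (α j))⁻¹ * tau 3 (α j))) +
      (3 : ℚ) * (((treeCoeff (α i))⁻¹ * tau 4 (α i)) * ((treeCoeff (α j))⁻¹ * tau 2 (α j))) +
      (-1 : ℚ) * ((α i : ℚ) ^ 2 * ((treeCoeff (α j))⁻¹ * tau 2 (α j))) +
      (-1 : ℚ) * (((treeCoeff (α i))⁻¹ * tau 2 (α i)) * (α j : ℚ) ^ 2) := by
    intro i j
    have := (treeCoeff_pos (α i)).ne'
    have := (treeCoeff_pos (α j)).ne'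
    rw [splitSum_two (hα i) (hα j)]; field_simp; ring
  rw [h]
  simp only [h1, h2, add_smul, sub_smul, mul_smul (2 : ℚ), mul_smul (3 : ℚ), mul_smul (8 : ℚ),
    mul_smul (-3 : ℚ), mul_smul (-5 : ℚ), mul_smul (-1 : ℚ), mul_smul (4 : ℚ),
    Finset.sum_add_distrib, Finset.sum_sub_distrib, ← Finset.smul_sum, sum_sum_smul_mul
      (fun i => (treeCoeff (α i))⁻¹ * tau _ (α i)) (fun i => (treeCoeff (α i))⁻¹ * tau _ (α i)),
    sum_sum_smul_mul (fun i => (α i : ℚ) ^ 2) (fun i => (treeCoeff (α i))⁻¹ * tau _ (α i)),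
    sum_sum_smul_mul (fun i => (treeCoeff (α i))⁻¹ * tau _ (α i)) (fun i => (α i : ℚ) ^ 2),
    tauSum_eq, ← psum_two]
  rw [psum_one, mul_comm (tauSum α 3) (tauSum α 2), mul_comm (tauSum α 4) (tauSum α 2),
    mul_comm (tauSum α 4) (tauSum α 3), mul_comm (tauSum α 2) (psum α 2)]
  simp only [mul_sub, mul_one, add_mul, sub_mul, smul_mul_assoc]
  rw [mul_comm (tauSum α 3) (tauSum α 2), mul_comm (tauSum α 4) (tauSum α 2),
    mul_comm (tauSum α 4) (tauSum α 3)]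
  module

end SetAlg

theorem Multiset.esymm_cons_succ (a : ℚ) (M : Multiset ℚ) (i : ℕ) :
    (a ::ₘ M).esymm (i + 1) = M.esymm (i + 1) + a * M.esymm i := by
  simp only [Multiset.esymm, Multiset.powersetCard_cons, Multiset.map_add, Multiset.sum_add,
    Multiset.map_map, Function.comp_def, Multiset.prod_cons, Multiset.sum_map_mul_left]

theorem Multiset.esymm_zero (M : Multiset ℚ) : M.esymm 0 = 1 := by
  simp [Multiset.esymm]

theorem Multiset.esymm_eq_zero {M : Multiset ℚ} {i : ℕ} (h : M.card < i) : M.esymm i = 0 := by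
  simp [Multiset.esymm, Multiset.powersetCard_eq_empty _ h]

/-- The normalised genus one numbers. -/
noncomputable def genusOne (M : Multiset ℕ) : ℚ :=
  (1 / 24) * ((M.sum : ℚ) ^ M.card - (M.sum : ℚ) ^ (M.card - 1) -
    ∑ i ∈ Finset.Icc 2 M.card, ((i - 2)! : ℚ) * (M.map fun j : ℕ => (j : ℚ)).esymm i *
      (M.sum : ℚ) ^ (M.card - i))

namespace SetAlg

variable {ι : Type*} [DecidableEq ι] (α : ι → ℕ)

/-- Elementary symmetric functions of the values of `α` on a finite set. -/
noncomputable def elem (J : Finset ι) (i : ℕ) : ℚ := (J.val.map fun a => (α a : ℚ)).esymm i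

variable {α}

omit [DecidableEq ι] in
theorem elem_zero (J : Finset ι) : elem α J 0 = 1 := Multiset.esymm_zero _

omit [DecidableEq ι] in
theorem elem_eq_zero {J : Finset ι} {i : ℕ} (h : #J < i) : elem α J i = 0 :=
  Multiset.esymm_eq_zero (by simpa using h)

theorem elem_insert {J : Finset ι} {a : ι} (ha : a ∉ J) (i : ℕ) :
    elem α (insert a J) (i + 1) = elem α J (i + 1) + α a * elem α J i := by
  rw [elem, Finset.insert_val_of_notMem ha, Multiset.map_cons, Multiset.esymm_cons_succ]
  rfl

theorem elem_erase {J : Finset ι} {a : ι} (ha : a ∈ J) (i : ℕ) :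
    elem α J (i + 1) = elem α (J.erase a) (i + 1) + α a * elem α (J.erase a) i := by
  conv_lhs => rw [← Finset.insert_erase ha]
  exact elem_insert (Finset.notMem_erase a J) i

theorem sum_mul_elem_erase (J : Finset ι) (i : ℕ) :
    ∑ a ∈ J, (α a : ℚ) * elem α (J.erase a) i = (i + 1) * elem α J (i + 1) := by
  induction J using Finset.induction_on generalizing i with
  | empty => rw [elem_eq_zero (by simp)]; simp
  | insert c J hc ih =>
    rw [Finset.sum_insert hc, Finset.erase_insert hc, elem_insert hc]
    have h : ∀ a ∈ J, (insert c J).erase a = insert c (J.erase a) := by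
      intro a ha
      rw [Finset.erase_insert_of_ne]
      rintro rfl; exact hc ha
    rw [Finset.sum_congr rfl fun a ha => by rw [h a ha]]
    cases i with
    | zero =>
      have := ih 0
      simp only [elem_zero] at this ⊢
      rw [this]; push_cast; ring
    | succ i =>
      rw [Finset.sum_congr rfl fun a ha => by
        rw [elem_insert (fun h' => hc (Finset.mem_of_mem_erase h')), mul_add, mul_left_comm]]
      rw [Finset.sum_add_distrib, ← Finset.mul_sum, ih, ih]
      push_cast; ring

omit [DecidableEq ι] in
theorem elem_one (J : Finset ι) : elem α J 1 = ∑ a ∈ J, (α a : ℚ) := by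
  classical
  have := sum_mul_elem_erase (α := α) J 0
  simpa [elem_zero] using this.symm

variable [Fintype ι]

variable (α) in
/-- The product of `psum α 2` with the square of the inverse of `1 - psum α 1` and a power. -/
def squarePart (k : ℕ) : SetAlg ι := psum α 2 * spowU α 0 * spowU α k

theorem squarePart_eq (hα : ∀ i, 0 < α i) (k : ℕ) (J : Finset ι) :
    squarePart α k J = ∑ a ∈ J, (α a : ℚ) ^ 2 * spowU α (k + α a) (J.erase a) +
      ∑ a ∈ J, (α a : ℚ) * squarePart α (k + α a) (J.erase a) := by
  have h1 : squarePart α k = psum α 2 * spowU α k + psum α 1 * squarePart α k := by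
    have := spowU_zero hα
    rw [squarePart]
    linear_combination psum α 2 * spowU α k * this
  have h2 : ∀ a, spowU α (k + α a) = spow α (α a) * spowU α k := fun a => by
    rw [spowU_eq hα k, spowU_eq hα, spow_add hα]; ring
  have h3 : psum α 2 * spowU α k = ∑ a, ((α a : ℚ) ^ 2) • (single a * spowU α (k + α a)) := by
    rw [psum, Finset.sum_mul]
    refine Finset.sum_congr rfl fun a _ => ?_
    rw [smul_mul_assoc, mul_assoc, h2]
  have h4 : psum α 1 * squarePart α k =
      ∑ a, (α a : ℚ) • (single a * squarePart α (k + α a)) := by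
    rw [psum, Finset.sum_mul]
    refine Finset.sum_congr rfl fun a _ => ?_
    rw [smul_mul_assoc, squarePart, squarePart, h2, pow_one]
    congr 1; ring
  conv_lhs => rw [h1, h3, h4, add_apply, sum_smul_single_mul_apply, sum_smul_single_mul_apply]

theorem squarePart_apply (hα : ∀ i, 0 < α i) (b : ℕ) : ∀ (k : ℕ) (J : Finset ι), #J = b →
    squarePart α k J = (∑ a ∈ J, (α a : ℚ)) * (k + ∑ a ∈ J, (α a : ℚ)) ^ b -
      ∑ j ∈ Finset.range b, (j ! : ℚ) * (elem α J (j + 2) + k * elem α J (j + 1)) *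
        (k + ∑ a ∈ J, (α a : ℚ)) ^ (b - 1 - j) := by
  induction b with
  | zero =>
    intro k J hJ
    rw [Finset.card_eq_zero] at hJ
    subst hJ
    rw [squarePart_eq hα]; simp
  | succ b ih =>
    intro k J hJ
    rw [squarePart_eq hα]
    set n : ℚ := k + ∑ a ∈ J, (α a : ℚ) with hn
    have hc : ∀ a ∈ J, #(J.erase a) = b := fun a ha => by
      rw [Finset.card_erase_of_mem ha, hJ]; rfl
    have h1 : ∀ a ∈ J, (α a : ℚ) ^ 2 * spowU α (k + α a) (J.erase a) = (α a : ℚ) ^ 2 * n ^ b := by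
      intro a ha
      rw [spowU_apply, card_erase_add_sum α ha, hc a ha]
    have h2 : ∀ a ∈ J, (α a : ℚ) * squarePart α (k + α a) (J.erase a) =
        (α a * (∑ a ∈ J, (α a : ℚ)) * n ^ b - (α a : ℚ) ^ 2 * n ^ b) -
        ∑ j ∈ Finset.range b, (j ! : ℚ) * n ^ (b - 1 - j) * (α a * elem α J (j + 2) +
          k * (α a * elem α (J.erase a) (j + 1))) := by
      intro a ha
      have hs : ∑ i ∈ J.erase a, (α i : ℚ) = ∑ a ∈ J, (α a : ℚ) - α a := by
        rw [← Finset.add_sum_erase _ _ ha]; ring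
      rw [ih _ _ (hc a ha), card_erase_add_sum α ha, hs, ← hn, mul_sub, Finset.mul_sum]
      congr 1
      · ring
      · refine Finset.sum_congr rfl fun j _ => ?_
        rw [elem_erase ha (j + 1)]; push_cast; ring
    rw [Finset.sum_congr rfl h1, Finset.sum_congr rfl h2, Finset.sum_sub_distrib,
      Finset.sum_sub_distrib, Finset.sum_comm]
    have h3 : ∀ j ∈ Finset.range b, ∑ a ∈ J, (j ! : ℚ) * n ^ (b - 1 - j) *
        (α a * elem α J (j + 2) + k * (α a * elem α (J.erase a) (j + 1))) =
        (j ! : ℚ) * n ^ (b - j) * elem α J (j + 2) +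
        (((j + 1)! : ℕ) : ℚ) * n ^ (b - 1 - j) * (k * elem α J (j + 2)) := by
      intro j hj
      rw [Finset.mem_range] at hj
      rw [← Finset.mul_sum, Finset.sum_add_distrib, ← Finset.mul_sum, ← Finset.sum_mul,
        sum_mul_elem_erase, show b - j = (b - 1 - j) + 1 by omega, Nat.factorial_succ,
        show ∑ i ∈ J, (α i : ℚ) = n - k by rw [hn]; ring]
      push_cast; ring
    rw [Finset.sum_congr rfl h3, Finset.sum_add_distrib]
    have h4 : ∑ j ∈ Finset.range (b + 1), (j ! : ℚ) * (elem α J (j + 2) + k * elem α J (j + 1)) *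
        n ^ (b + 1 - 1 - j) = ∑ j ∈ Finset.range b, (j ! : ℚ) * n ^ (b - j) * elem α J (j + 2) +
        (∑ j ∈ Finset.range b, (((j + 1)! : ℕ) : ℚ) * n ^ (b - 1 - j) * (k * elem α J (j + 2)) +
        k * (n - k) * n ^ b) := by
      have h5 : ∑ j ∈ Finset.range (b + 1), (j ! : ℚ) *
          (elem α J (j + 2) + k * elem α J (j + 1)) * n ^ (b + 1 - 1 - j) =
          ∑ j ∈ Finset.range (b + 1), (j ! : ℚ) * n ^ (b - j) * elem α J (j + 2) +
          ∑ j ∈ Finset.range (b + 1), (j ! : ℚ) * n ^ (b - j) * (k * elem α J (j + 1)) := by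
        rw [← Finset.sum_add_distrib]
        refine Finset.sum_congr rfl fun j _ => ?_
        rw [Nat.add_sub_cancel]; ring
      rw [h5, Finset.sum_range_succ, elem_eq_zero (show #J < b + 2 by omega), mul_zero, add_zero,
        Finset.sum_range_succ']
      congr 1
      congr 1
      · refine Finset.sum_congr rfl fun j _ => ?_
        rw [Nat.sub_sub, add_comm 1 j]
      · rw [elem_one, hn]; simp; ring
    rw [h4]
    simp only [← Finset.sum_mul]
    rw [show ∑ i ∈ J, (α i : ℚ) = n - k by rw [hn]; ring]
    ring

variable (α) in
/-- The genus one numbers with a distinguished cycle of length `k`. -/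
noncomputable def rootOne (k : ℕ) : SetAlg ι :=
  (1 / 24 : ℚ) • ((k : ℚ) • spowU α k + squarePart α k - spowU α k)

theorem rootOne_apply (hα : ∀ i, 0 < α i) (k : ℕ) (J : Finset ι) :
    rootOne α k J = genusOne (k ::ₘ J.val.map α) := by
  have hs : (((k ::ₘ J.val.map α).sum : ℕ) : ℚ) = k + ∑ a ∈ J, (α a : ℚ) := by
    rw [Multiset.sum_cons]; push_cast; simp [Multiset.map_map]
  have hc : (k ::ₘ J.val.map α).card = #J + 1 := by simp
  rw [genusOne, hs, hc, rootOne, smul_apply, sub_apply, add_apply, smul_apply,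
    squarePart_apply hα #J k J rfl, spowU_apply]
  congr 1
  have : ∑ i ∈ Finset.Icc 2 (#J + 1), ((i - 2)! : ℚ) *
      ((k ::ₘ J.val.map α).map fun j : ℕ => (j : ℚ)).esymm i *
      ((k : ℚ) + ∑ a ∈ J, (α a : ℚ)) ^ (#J + 1 - i) = ∑ j ∈ Finset.range #J, (j ! : ℚ) *
      (elem α J (j + 2) + k * elem α J (j + 1)) * (k + ∑ a ∈ J, (α a : ℚ)) ^ (#J - 1 - j) := by
    rw [← Finset.Ico_succ_right_eq_Icc, Finset.sum_Ico_eq_sum_range]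
    refine Finset.sum_congr (by simp) fun j _ => ?_
    rw [Multiset.map_cons, Multiset.map_map, show 2 + j - 2 = j by omega,
      show 2 + j = j + 1 + 1 by omega, Multiset.esymm_cons_succ,
      show #J + 1 - (j + 1 + 1) = #J - 1 - j by omega]
    rfl
  rw [this, Nat.add_sub_cancel]
  ring

end SetAlg

/-- The connected genus zero numbers, up to a standard factor. -/
noncomputable def numZero (M : Multiset ℕ) : ℚ :=
  (M.map treeCoeff).prod * (M.sum : ℚ) ^ ((M.card : ℤ) - 3)

/-- The connected genus one numbers, up to a standard factor. -/
noncomputable def numOne (M : Multiset ℕ) : ℚ := (M.map treeCoeff).prod * genusOne M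

namespace SetAlg

variable {ι : Type*} [DecidableEq ι] (α : ι → ℕ)

/-- The contribution of joining two cycles. -/
noncomputable def joinSum (f : Multiset ℕ → ℚ) (O : Finset ι) : ℚ :=
  (1 / 2) * ∑ i ∈ O, ∑ j ∈ O.erase i,
    (α i + α j) * f ((α i + α j) ::ₘ ((O.erase i).erase j).val.map α)

/-- The contribution of cutting a cycle without disconnecting. -/
noncomputable def cutSum (f : Multiset ℕ → ℚ) (O : Finset ι) : ℚ :=
  (1 / 2) * ∑ i ∈ O, ∑ p ∈ splits (α i), p.1 * p.2 * f (p.1 ::ₘ p.2 ::ₘ (O.erase i).val.map α)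

/-- The contribution of cutting a cycle and disconnecting. -/
noncomputable def splitOff (f g : Multiset ℕ → ℚ) (O : Finset ι) : ℚ :=
  (1 / 2) * ∑ i ∈ O, ∑ p ∈ splits (α i), ∑ J ∈ (O.erase i).powerset,
    p.1 * p.2 * (f (p.1 ::ₘ J.val.map α) * g (p.2 ::ₘ (O.erase i \ J).val.map α))

theorem splitOff_comm (f g : Multiset ℕ → ℚ) (O : Finset ι) :
    splitOff α f g O = splitOff α g f O := by
  rw [splitOff, splitOff]
  congr 1
  refine Finset.sum_congr rfl fun i _ => ?_
  refine Finset.sum_nbij' Prod.swap Prod.swap ?_ ?_ (fun _ _ => rfl) (fun _ _ => rfl) ?_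
  · intro p hp
    rw [mem_splits] at hp ⊢
    exact ⟨by simpa [add_comm] using hp.1, hp.2.2, hp.2.1⟩
  · intro p hp
    rw [mem_splits] at hp ⊢
    exact ⟨by simpa [add_comm] using hp.1, hp.2.2, hp.2.1⟩
  · intro p _
    refine Finset.sum_nbij' (fun J => O.erase i \ J) (fun J => O.erase i \ J) ?_ ?_ ?_ ?_ ?_
    · intro S _; simp
    · intro S _; simp
    · intro S hS; exact Finset.sdiff_sdiff_eq_self (Finset.mem_powerset.1 hS)
    · intro S hS; exact Finset.sdiff_sdiff_eq_self (Finset.mem_powerset.1 hS)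
    · intro S hS
      rw [Finset.sdiff_sdiff_eq_self (Finset.mem_powerset.1 hS)]
      simp only [Prod.fst_swap, Prod.snd_swap]
      ring

variable {α}

omit [DecidableEq ι] in
theorem prod_treeCoeff_cons (k : ℕ) (J : Finset ι) :
    ((k ::ₘ J.val.map α).map treeCoeff).prod = treeCoeff k * ∏ i ∈ J, treeCoeff (α i) := by
  rw [Multiset.map_cons, Multiset.prod_cons, Multiset.map_map]; rfl

theorem val_map_eq_cons {O : Finset ι} {i : ι} (hi : i ∈ O) :
    O.val.map α = α i ::ₘ (O.erase i).val.map α := by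
  conv_lhs => rw [← Finset.insert_erase hi,
    Finset.insert_val_of_notMem (Finset.notMem_erase i O), Multiset.map_cons]

omit [DecidableEq ι] in
theorem sum_val_map_cons (k : ℕ) (J : Finset ι) :
    (((k ::ₘ J.val.map α).sum : ℕ) : ℚ) = k + ∑ i ∈ J, (α i : ℚ) := by
  rw [Multiset.sum_cons]; push_cast; simp [Multiset.map_map]

omit [DecidableEq ι] in
theorem numZero_cons (k : ℕ) (J : Finset ι) : numZero (k ::ₘ J.val.map α) =
    treeCoeff k * (∏ i ∈ J, treeCoeff (α i)) * rootZero α k J := by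
  rw [numZero, prod_treeCoeff_cons, sum_val_map_cons, rootZero_apply, Multiset.card_cons,
    Multiset.card_map]
  congr 2
  push_cast; simp; ring

theorem spow_eq_zpow {k : ℕ} (hk : 0 < k) (J : Finset ι) :
    spow α k J = k * ((k : ℚ) + ∑ i ∈ J, (α i : ℚ)) ^ ((#J : ℤ) - 1) := by
  rw [spow_apply]
  split_ifs with h
  · have : (k : ℚ) ≠ 0 := by positivity
    subst h; simp [this]
  · replace h := Finset.nonempty_iff_ne_empty.2 h
    obtain ⟨b, hb⟩ : ∃ b, #J = b + 1 := ⟨#J - 1, by have := h.card_pos; omega⟩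
    rw [hb, show ((b + 1 : ℕ) : ℤ) - 1 = (b : ℤ) by push_cast; ring, zpow_natCast,
      Nat.add_sub_cancel]

theorem spow_eq_rootZero {k : ℕ} (hk : 0 < k) (J : Finset ι) :
    spow α k J = k * (((k : ℚ) + ∑ i ∈ J, (α i : ℚ)) * rootZero α k J) := by
  have : (k : ℚ) + ∑ i ∈ J, (α i : ℚ) ≠ 0 := by positivity
  rw [spow_eq_zpow hk, rootZero_apply, ← zpow_one_add₀ this]
  congr 2; ring

variable [Fintype ι]

theorem numOne_cons (hα : ∀ i, 0 < α i) (k : ℕ) (J : Finset ι) : numOne (k ::ₘ J.val.map α) =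
    treeCoeff k * (∏ i ∈ J, treeCoeff (α i)) * rootOne α k J := by
  rw [numOne, prod_treeCoeff_cons, rootOne_apply hα]

theorem cutJoin_apply (Y : ℕ → SetAlg ι) (O : Finset ι) : cutJoin α Y O =
    ∑ i ∈ O, (treeCoeff (α i))⁻¹ * ((α i + 1) / α i) * Y (α i) (O.erase i) -
    (1 / 2) * ∑ i ∈ O, ∑ j ∈ O.erase i, (treeCoeff (α i))⁻¹ * (treeCoeff (α j))⁻¹ *
      Y (α i + α j) ((O.erase i).erase j) -
    ∑ i ∈ O, (treeCoeff (α i))⁻¹ * ∑ p ∈ splits (α i), treeCoeff p.2 * p.2 *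
      ∑ J ∈ (O.erase i).powerset, Y p.1 J * rootZero α p.2 (O.erase i \ J) := by
  rw [cutJoin, sub_apply, sub_apply, sum_smul_single_mul_apply, sum_smul_single_mul_apply,
    smul_apply]
  congr 1
  · congr 2
    simp only [← mul_smul_comm (_ : ℚ) (single _), ← Finset.mul_sum]
    rw [sum_single_mul_apply]
    refine Finset.sum_congr rfl fun i _ => ?_
    simp only [mul_smul_comm]
    rw [sum_smul_single_mul_apply]
  · refine Finset.sum_congr rfl fun i _ => ?_
    rw [sum_apply]
    congr 1
    refine Finset.sum_congr rfl fun p _ => ?_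
    rw [smul_apply, mul_comm (rootZero α p.2), mul_apply]

theorem prod_mul_cutJoin (hα : ∀ i, 0 < α i) (f : Multiset ℕ → ℚ) (W : ℕ → SetAlg ι)
    (hf : ∀ k J, 0 < k → f (k ::ₘ J.val.map α) =
      treeCoeff k * (∏ i ∈ J, treeCoeff (α i)) * W k J) (O : Finset ι) :
    (∏ i ∈ O, treeCoeff (α i)) * cutJoin α (fun k => (treeCoeff k * k : ℚ) • W k) O =
    ((∑ i ∈ O, (α i : ℚ)) + #O) * f (O.val.map α) - joinSum α f O -
      2 * splitOff α f numZero O := by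
  have hκ : ∀ i, treeCoeff (α i) ≠ 0 := fun i => (treeCoeff_pos (α i)).ne'
  rw [cutJoin_apply, mul_sub, mul_sub]
  congr 1
  · congr 1
    · rw [Finset.cast_card, ← Finset.sum_add_distrib, Finset.sum_mul, Finset.mul_sum]
      refine Finset.sum_congr rfl fun i hi => ?_
      have := hκ i
      have h2 : (α i : ℚ) ≠ 0 := by exact_mod_cast (hα i).ne'
      rw [val_map_eq_cons hi, hf _ _ (hα i), ← Finset.mul_prod_erase O _ hi, smul_apply]
      field_simp
    · rw [joinSum, mul_left_comm, Finset.mul_sum]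
      congr 1
      refine Finset.sum_congr rfl fun i hi => ?_
      rw [Finset.mul_sum]
      refine Finset.sum_congr rfl fun j hj => ?_
      have := hκ i
      have := hκ j
      rw [hf _ _ (Nat.add_pos_left (hα i) _), ← Finset.mul_prod_erase O _ hi,
        ← Finset.mul_prod_erase _ _ hj, smul_apply]
      push_cast
      field_simp
  · rw [splitOff, ← mul_assoc, Finset.mul_sum]
    norm_num only
    rw [one_mul]
    refine Finset.sum_congr rfl fun i hi => ?_
    rw [← Finset.mul_prod_erase O _ hi, Finset.mul_sum, Finset.mul_sum]
    refine Finset.sum_congr rfl fun p hp => ?_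
    rw [mem_splits] at hp
    rw [Finset.mul_sum, Finset.mul_sum, Finset.mul_sum]
    refine Finset.sum_congr rfl fun J hJ => ?_
    rw [hf _ _ hp.2.1, numZero_cons, smul_apply,
      ← Finset.prod_sdiff (Finset.mem_powerset.1 hJ)]
    have := hκ i
    field_simp

theorem cutJoin_add (Y Z : ℕ → SetAlg ι) :
    cutJoin α (fun k => Y k + Z k) = cutJoin α Y + cutJoin α Z := by
  simp only [cutJoin, mul_add, smul_add, Finset.sum_add_distrib]
  abel

theorem cutJoin_mul (c : SetAlg ι) (Y : ℕ → SetAlg ι) :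
    cutJoin α (fun k => c * Y k) = c * cutJoin α Y := by
  simp only [cutJoin, mul_sub, mul_smul_comm, Finset.mul_sum, Finset.smul_sum, mul_left_comm c]

theorem cutJoin_rootOne (hα : ∀ i, 0 < α i) :
    cutJoin α (fun k => (treeCoeff k * k : ℚ) • rootOne α k) =
    ∑ i, ((treeCoeff (α i))⁻¹ * ((1 / 2) * ∑ p ∈ splits (α i),
      treeCoeff p.1 * treeCoeff p.2 * (p.1 * p.2) / α i)) • comp α i := by
  have hu := spowU_zero hα
  set u := spowU α 0
  have h1 : (fun k => (treeCoeff k * k : ℚ) • rootOne α k) = fun k =>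
      ((1 / 24 : ℚ) • u) * ((treeCoeff k * k ^ 2 : ℚ) • spow α k) +
      ((1 / 24 : ℚ) • (psum α 2 * u ^ 2 - u)) * ((treeCoeff k * k : ℚ) • spow α k) := by
    funext k
    rw [rootOne, squarePart, spowU_eq hα k,
      show psum α 2 * u * (spow α k * u) = psum α 2 * u ^ 2 * spow α k by ring,
      mul_comm (spow α k)]
    simp only [sub_mul, smul_mul_assoc, mul_smul_comm]
    module
  have h2 : ∀ i, (treeCoeff (α i))⁻¹ * ((1 / 2) * ∑ p ∈ splits (α i),
      treeCoeff p.1 * treeCoeff p.2 * (p.1 * p.2) / α i) =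
      (1 / 8) * ((treeCoeff (α i))⁻¹ * tau 4 (α i)) -
      (1 / 6) * ((treeCoeff (α i))⁻¹ * tau 3 (α i)) := by
    intro i
    have : (α i : ℚ) ≠ 0 := by exact_mod_cast (hα i).ne'
    rw [← Finset.sum_div, sum_splits_mul]; field_simp; ring
  rw [h1, cutJoin_add, cutJoin_mul, cutJoin_mul, cutJoin_one hα, cutJoin_two hα]
  simp only [h2, sub_smul, mul_smul (1 / 8 : ℚ), mul_smul (1 / 6 : ℚ), Finset.sum_sub_distrib,
    ← Finset.smul_sum, tauSum_eq]
  have h3 : u * (((3 : ℚ) • tauSum α 4 - (4 : ℚ) • tauSum α 3 + tauSum α 2) * (1 - psum α 1) -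
        psum α 2 * tauSum α 2) + (psum α 2 * u ^ 2 - u) * (tauSum α 2 * (1 - psum α 1)) =
      (3 : ℚ) • tauSum α 4 - (4 : ℚ) • tauSum α 3 := by
    linear_combination ((3 : ℚ) • tauSum α 4 - (4 : ℚ) • tauSum α 3 +
      psum α 2 * u * tauSum α 2) * hu
  rw [smul_mul_assoc, smul_mul_assoc, ← smul_add, h3]
  module

omit [Fintype ι] in
theorem erase_spow (hα : ∀ i, 0 < α i) {O : Finset ι} {i : ι} (hi : i ∈ O) :
    spow α (α i) (O.erase i) = α i * (∑ a ∈ O, (α a : ℚ)) ^ ((#O : ℤ) - 2) := by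
  rw [spow_eq_zpow (hα i), Finset.add_sum_erase _ (fun a => (α a : ℚ)) hi,
    Finset.card_erase_of_mem hi,
    Nat.cast_sub (Finset.card_pos.2 ⟨i, hi⟩)]
  congr 2; push_cast; ring

omit [DecidableEq ι] [Fintype ι] in
theorem numZero_val_map (O : Finset ι) : numZero (O.val.map α) =
    (∏ i ∈ O, treeCoeff (α i)) * (∑ i ∈ O, (α i : ℚ)) ^ ((#O : ℤ) - 3) := by
  rw [numZero, Multiset.map_map, Multiset.card_map]
  push_cast; simp [Multiset.map_map]

theorem numZero_recurrence (hα : ∀ i, 0 < α i) {O : Finset ι} (hO : O.Nonempty) :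
    ((∑ i ∈ O, (α i : ℚ)) + #O - 2) * numZero (O.val.map α) =
      joinSum α numZero O + splitOff α numZero numZero O := by
  set n := ∑ i ∈ O, (α i : ℚ) with hn
  have hn0 : n ≠ 0 := by
    have : 0 < n := Finset.sum_pos (fun i _ => by exact_mod_cast hα i) hO
    exact this.ne'
  have h0 := prod_mul_cutJoin hα (fun M => (M.sum : ℚ) * numZero M)
    (fun k => (1 / k : ℚ) • spow α k) (by
      intro k J hk
      have : (k : ℚ) ≠ 0 := by positivity
      simp only [sum_val_map_cons, numZero_cons, smul_apply]
      rw [spow_eq_rootZero hk]; field_simp) O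
  have h1 : cutJoin α (fun k => (treeCoeff k * k : ℚ) • (1 / k : ℚ) • spow α k) =
      cutJoin α (fun k => treeCoeff k • spow α k) := by
    rw [cutJoin, cutJoin]
    have h : ∀ k : ℕ, 0 < k → (treeCoeff k * k : ℚ) • (1 / k : ℚ) • spow α k =
      treeCoeff k • spow α k := by
      intro k hk
      have : (k : ℚ) ≠ 0 := by positivity
      rw [smul_smul]; congr 1; field_simp
    congr 1
    · congr 1
      · exact Finset.sum_congr rfl fun i _ => by rw [h _ (hα i)]
      · congr 1
        exact Finset.sum_congr rfl fun i _ => Finset.sum_congr rfl fun j _ => by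
          rw [h _ (Nat.add_pos_left (hα i) _)]
    · refine Finset.sum_congr rfl fun i _ => ?_
      congr 2
      refine Finset.sum_congr rfl fun p hp => ?_
      rw [h _ (mem_splits.1 hp).2.1]
  have h2 : (psum α 0 * psum α 0) O = 2 * (#O - 1) * n ^ ((#O : ℤ) - 2) := by
    have h3 : psum α 0 * psum α 0 = ∑ i, single i * ∑ j, (single j * spow α (α i + α j)) := by
      simp only [psum, pow_zero, one_smul]
      rw [Finset.sum_mul_sum]
      refine Finset.sum_congr rfl fun i _ => ?_
      rw [Finset.mul_sum]
      refine Finset.sum_congr rfl fun j _ => ?_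
      rw [spow_add hα]; ring
    rw [h3, sum_single_mul_apply]
    have h4 : ∀ i ∈ O, (∑ j, (single j * spow α (α i + α j))) (O.erase i) =
        ∑ j ∈ O.erase i, ((α i : ℚ) + α j) * n ^ ((#O : ℤ) - 3) := by
      intro i hi
      rw [sum_single_mul_apply]
      refine Finset.sum_congr rfl fun j hj => ?_
      rw [spow_eq_zpow (Nat.add_pos_left (hα i) _), card_erase_add_sum α hj,
        Finset.add_sum_erase _ (fun a => (α a : ℚ)) hi, ← hn]
      have c1 := Finset.card_erase_add_one hj
      have c2 := Finset.card_erase_add_one hi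
      push_cast
      congr 2
      omega
    rw [Finset.sum_congr rfl h4]
    simp only [← Finset.sum_mul]
    have h5 : ∑ i ∈ O, ∑ j ∈ O.erase i, ((α i : ℚ) + α j) = 2 * (#O - 1) * n := by
      have h6 : ∀ i ∈ O, ∑ j ∈ O.erase i, ((α i : ℚ) + α j) = (#O - 2) * α i + n := by
        intro i hi
        have := Finset.add_sum_erase O (fun a => (α a : ℚ)) hi
        have c2 : ((#(O.erase i) : ℕ) : ℚ) + 1 = #O := by
          exact_mod_cast Finset.card_erase_add_one hi
        rw [Finset.sum_add_distrib, Finset.sum_const, nsmul_eq_mul]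
        rw [hn, ← this, ← c2]; ring
      rw [Finset.sum_congr rfl h6, Finset.sum_add_distrib, ← Finset.mul_sum, ← hn,
        Finset.sum_const, nsmul_eq_mul]; ring
    rw [h5, mul_assoc, ← zpow_one_add₀ hn0]
    congr 2; ring
  have h3 : (∑ i, (1 / α i : ℚ) • comp α i) O = #O * n ^ ((#O : ℤ) - 2) := by
    simp only [comp]
    rw [sum_smul_single_mul_apply, Finset.cast_card, Finset.sum_mul]
    refine Finset.sum_congr rfl fun i hi => ?_
    have : (α i : ℚ) ≠ 0 := by exact_mod_cast (hα i).ne'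
    rw [erase_spow hα hi, one_mul]
    field_simp
    rfl
  have h4 : joinSum α (fun M => (M.sum : ℚ) * numZero M) O = n * joinSum α numZero O := by
    rw [joinSum, joinSum, mul_left_comm]
    congr 1
    rw [Finset.mul_sum]
    refine Finset.sum_congr rfl fun i hi => ?_
    rw [Finset.mul_sum]
    refine Finset.sum_congr rfl fun j hj => ?_
    rw [sum_val_map_cons, card_erase_add_sum α hj, Finset.add_sum_erase _ (fun a => (α a : ℚ)) hi]
    ring
  have h5 : splitOff α (fun M => (M.sum : ℚ) * numZero M) numZero O +
      splitOff α numZero (fun M => (M.sum : ℚ) * numZero M) O =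
        n * splitOff α numZero numZero O := by
    simp only [splitOff]
    rw [← mul_add, mul_left_comm, Finset.mul_sum, ← Finset.sum_add_distrib]
    congr 1
    refine Finset.sum_congr rfl fun i hi => ?_
    rw [Finset.mul_sum, ← Finset.sum_add_distrib]
    refine Finset.sum_congr rfl fun p hp => ?_
    rw [Finset.mul_sum, ← Finset.sum_add_distrib]
    refine Finset.sum_congr rfl fun J hJ => ?_
    rw [sum_val_map_cons, sum_val_map_cons, hn, ← Finset.add_sum_erase O (fun a => (α a : ℚ)) hi,
      ← Finset.sum_sdiff (f := fun a => (α a : ℚ)) (Finset.mem_powerset.1 hJ),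
      ← (mem_splits.1 hp).1]
    push_cast; ring
  rw [splitOff_comm α numZero fun M => (M.sum : ℚ) * numZero M] at h5
  have h6 : (((O.val.map α).sum : ℕ) : ℚ) = n := by push_cast; simp [Multiset.map_map, hn]
  rw [h1, cutJoin_zero hα, sub_apply, smul_apply, h2, h3, h4, h6] at h0
  have h7 : (∏ i ∈ O, treeCoeff (α i)) * n ^ ((#O : ℤ) - 2) = n * numZero (O.val.map α) := by
    rw [numZero_val_map, ← hn, mul_left_comm, ← zpow_one_add₀ hn0]
    congr 2; ring
  apply mul_left_cancel₀ hn0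
  linear_combination -h0 + h5 + 2 * h7

theorem numOne_recurrence (hα : ∀ i, 0 < α i) (O : Finset ι) :
    ((∑ i ∈ O, (α i : ℚ)) + #O) * numOne (O.val.map α) =
      joinSum α numOne O + cutSum α numZero O + (splitOff α numOne numZero O +
        splitOff α numZero numOne O) := by
  have h := prod_mul_cutJoin hα numOne (rootOne α) (fun k J _ => numOne_cons hα k J) O
  rw [splitOff_comm α numZero]
  have h2 : (∏ i ∈ O, treeCoeff (α i)) *
      cutJoin α (fun k => (treeCoeff k * k : ℚ) • rootOne α k) O = cutSum α numZero O := by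
    rw [cutJoin_rootOne hα]
    simp only [comp]
    rw [sum_smul_single_mul_apply, cutSum, Finset.mul_sum, Finset.mul_sum]
    refine Finset.sum_congr rfl fun i hi => ?_
    rw [erase_spow hα hi, Finset.mul_sum, Finset.mul_sum, Finset.mul_sum, Finset.sum_mul,
      Finset.mul_sum]
    refine Finset.sum_congr rfl fun p hp => ?_
    have hp1 := (mem_splits.1 hp).1
    have := (treeCoeff_pos (α i)).ne'
    have h2 : (α i : ℚ) ≠ 0 := by exact_mod_cast (hα i).ne'
    have h3 : numZero (p.1 ::ₘ p.2 ::ₘ (O.erase i).val.map α) = treeCoeff p.1 * (treeCoeff p.2 *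
        (∏ i ∈ O.erase i, treeCoeff (α i))) * (∑ i ∈ O, (α i : ℚ)) ^ ((#O : ℤ) - 2) := by
      rw [numZero, Multiset.map_cons, Multiset.prod_cons, prod_treeCoeff_cons,
        Multiset.sum_cons, Multiset.card_cons, Multiset.card_cons, Multiset.card_map,
        Nat.cast_add, sum_val_map_cons, ← Finset.add_sum_erase O _ hi, ← hp1]
      have c2 := Finset.card_erase_add_one hi
      congr 2
      · push_cast; ring
      · simp only [Finset.card_val]; push_cast; omega
    rw [h3, ← Finset.mul_prod_erase O _ hi]
    field_simp
  linear_combination -h + h2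

end SetAlg

section Words

variable {P : Type*}

/-- The sum of a function over all words of length `r` with letters in `L`. -/
def lsum (L : Finset P) : ℕ → (List P → ℚ) → ℚ
  | 0, F => F []
  | r + 1, F => ∑ p ∈ L, lsum L r fun l => F (p :: l)

theorem lsum_zero (L : Finset P) (F : List P → ℚ) : lsum L 0 F = F [] := rfl

theorem lsum_succ (L : Finset P) (r : ℕ) (F : List P → ℚ) :
    lsum L (r + 1) F = ∑ p ∈ L, lsum L r fun l => F (p :: l) := rfl

theorem lsum_congr {L : Finset P} {r : ℕ} {F G : List P → ℚ}
    (h : ∀ l : List P, (∀ p ∈ l, p ∈ L) → F l = G l) : lsum L r F = lsum L r G := by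
  induction r generalizing F G with
  | zero => exact h [] (by simp)
  | succ r ih =>
    refine Finset.sum_congr rfl fun p hp => ih fun l hl => h _ ?_
    intro q hq
    rcases List.mem_cons.1 hq with rfl | hq
    exacts [hp, hl q hq]

theorem lsum_const_zero (L : Finset P) (r : ℕ) : lsum L r (fun _ => 0) = 0 := by
  induction r with
  | zero => rfl
  | succ r ih => exact Finset.sum_eq_zero fun p _ => ih

theorem lsum_add (L : Finset P) (r : ℕ) (F G : List P → ℚ) :
    lsum L r (fun l => F l + G l) = lsum L r F + lsum L r G := by
  induction r generalizing F G with
  | zero => rfl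
  | succ r ih => simp only [lsum_succ, ih, Finset.sum_add_distrib]

theorem lsum_sum {κ : Type*} (s : Finset κ) (L : Finset P) (r : ℕ) (F : κ → List P → ℚ) :
    lsum L r (fun l => ∑ k ∈ s, F k l) = ∑ k ∈ s, lsum L r (F k) := by
  induction r generalizing F with
  | zero => rfl
  | succ r ih => simp only [lsum_succ, ih, Finset.sum_comm (s := L)]

theorem lsum_eq_zero {L : Finset P} {r : ℕ} {F : List P → ℚ}
    (h : ∀ l : List P, (∀ p ∈ l, p ∈ L) → F l = 0) : lsum L r F = 0 := by
  rw [lsum_congr h, lsum_const_zero]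

theorem lsum_restrict {L L' : Finset P} (hL : L' ⊆ L) {r : ℕ} {F : List P → ℚ}
    (h : ∀ l : List P, (¬ ∀ p ∈ l, p ∈ L') → F l = 0) : lsum L r F = lsum L' r F := by
  induction r generalizing F with
  | zero => rfl
  | succ r ih =>
    rw [lsum_succ, lsum_succ]
    have h1 : ∀ p ∈ L, p ∉ L' → lsum L r (fun l => F (p :: l)) = 0 := fun p _ hp =>
      lsum_eq_zero fun l _ => h _ fun h' => hp (h' p (by simp))
    rw [← Finset.sum_subset hL h1]
    refine Finset.sum_congr rfl fun p _ => ih fun l hl => h _ fun h' => hl fun q hq =>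
      h' q (List.mem_cons_of_mem _ hq)

theorem lsum_shuffle [DecidableEq P] {L₁ L₂ : Finset P} (hd : Disjoint L₁ L₂) (r : ℕ)
    (F G : List P → ℚ) :
    lsum (L₁ ∪ L₂) r (fun l => F (l.filter (· ∈ L₁)) * G (l.filter (· ∈ L₂))) =
      ∑ p ∈ Finset.HasAntidiagonal.antidiagonal r,
        (r.choose p.1 : ℚ) * (lsum L₁ p.1 F * lsum L₂ p.2 G) := by
  induction r generalizing F G with
  | zero => simp [lsum_zero]
  | succ r ih =>
    rw [Finset.sum_antidiagonal_choose_succ_mul (fun i j => lsum L₁ i F * lsum L₂ j G),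
      lsum_succ, Finset.sum_union hd, add_comm]
    congr 1
    · have h1 : ∀ p ∈ L₂, lsum (L₁ ∪ L₂) r (fun l => F ((p :: l).filter (· ∈ L₁)) *
          G ((p :: l).filter (· ∈ L₂))) = ∑ q ∈ Finset.HasAntidiagonal.antidiagonal r,
          (r.choose q.1 : ℚ) * (lsum L₁ q.1 F * lsum L₂ q.2 (fun l => G (p :: l))) := by
        intro p hp
        have hp' : p ∉ L₁ := fun h => Finset.disjoint_left.1 hd h hp
        rw [← ih]
        simp [hp, hp']
      rw [Finset.sum_congr rfl h1, Finset.sum_comm]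
      refine Finset.sum_congr rfl fun q _ => ?_
      rw [← Finset.mul_sum, ← Finset.mul_sum]
      rfl
    · have h1 : ∀ p ∈ L₁, lsum (L₁ ∪ L₂) r (fun l => F ((p :: l).filter (· ∈ L₁)) *
          G ((p :: l).filter (· ∈ L₂))) = ∑ q ∈ Finset.HasAntidiagonal.antidiagonal r,
          (r.choose q.1 : ℚ) * (lsum L₁ q.1 (fun l => F (p :: l)) * lsum L₂ q.2 G) := by
        intro p hp
        have hp' : p ∉ L₂ := fun h => Finset.disjoint_left.1 hd hp h
        rw [← ih]
        simp [hp, hp']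
      rw [Finset.sum_congr rfl h1, Finset.sum_comm]
      refine Finset.sum_congr rfl fun q hq => ?_
      rw [← Finset.mul_sum, ← Finset.sum_mul, ← lsum_succ,
        Nat.choose_symm_of_eq_add (Finset.HasAntidiagonal.mem_antidiagonal.1 hq).symm]

end Words

section Connected

variable {V : Type*}

/-- A set is compatible with a word of pairs if no pair of the word is separated by it. -/
def Respects (A : Finset V) (l : List (V × V)) : Prop := ∀ p ∈ l, p.1 ∈ A ↔ p.2 ∈ A

/-- The word of pairs, seen as a list of edges, connects the set `S`. -/
def Connects (S : Finset V) (l : List (V × V)) : Prop :=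
  ∀ A ⊆ S, Respects A l → A = ∅ ∨ A = S

variable [DecidableEq V]

omit [DecidableEq V] in
theorem respects_cons {A : Finset V} {p : V × V} {l : List (V × V)} :
    Respects A (p :: l) ↔ (p.1 ∈ A ↔ p.2 ∈ A) ∧ Respects A l := by
  simp [Respects]

theorem Respects.sdiff {A B : Finset V} {l : List (V × V)} (hA : Respects A l)
    (hB : Respects B l) : Respects (A \ B) l := fun p hp => by
  rw [Finset.mem_sdiff, Finset.mem_sdiff, hA p hp, hB p hp]

theorem Respects.inter {A B : Finset V} {l : List (V × V)} (hA : Respects A l)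
    (hB : Respects B l) : Respects (A ∩ B) l := fun p hp => by
  rw [Finset.mem_inter, Finset.mem_inter, hA p hp, hB p hp]

theorem Respects.union {A B : Finset V} {l : List (V × V)} (hA : Respects A l)
    (hB : Respects B l) : Respects (A ∪ B) l := fun p hp => by
  rw [Finset.mem_union, Finset.mem_union, hA p hp, hB p hp]

omit [DecidableEq V] in
theorem respects_of_subset {S : Finset V} {l : List (V × V)} (h : ∀ p ∈ l, p ∈ S.offDiag) :
    Respects S l := fun p hp => by
  have := Finset.mem_offDiag.1 (h p hp)
  simp [this.1, this.2.1]

/-- The conditions on the component of `a` after removing an edge from `a` to `b`. -/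
def IsHalf (S : Finset V) (a b : V) (l : List (V × V)) (A : Finset V) : Prop :=
  a ∈ A ∧ b ∉ A ∧ Respects A l ∧ Connects A l ∧ Connects (S \ A) l

omit [DecidableEq V] in
theorem Connects.cons {S : Finset V} {l : List (V × V)} (h : Connects S l) (p : V × V) :
    Connects S (p :: l) := fun A hA hr => h A hA (respects_cons.1 hr).2

theorem Connects.not_isHalf {S : Finset V} {l : List (V × V)} (h : Connects S l) {a b : V}
    (hb : b ∈ S) {A : Finset V} (hA : A ⊆ S) : ¬ IsHalf S a b l A := by
  rintro ⟨h1, h2, h3, -, -⟩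
  rcases h A hA h3 with rfl | rfl
  · simp at h1
  · exact h2 hb

theorem IsHalf.connects {S : Finset V} {l : List (V × V)} (hl : ∀ p ∈ l, p ∈ S.offDiag) {a b : V}
    (hb : b ∈ S) {A : Finset V} (hA : A ⊆ S) (h : IsHalf S a b l A) :
    Connects S ((a, b) :: l) := by
  obtain ⟨h1, h2, h3, h4, h5⟩ := h
  intro B hB hr
  obtain ⟨hab, hr⟩ := respects_cons.1 hr
  simp only at hab
  have hb' : b ∈ S \ A := Finset.mem_sdiff.2 ⟨hb, h2⟩
  have hBe : B = B ∩ A ∪ B ∩ (S \ A) := by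
    ext x
    have := @hB x
    simp only [Finset.mem_union, Finset.mem_inter, Finset.mem_sdiff]
    tauto
  have hS : Respects (S \ A) l := (respects_of_subset hl).sdiff h3
  rcases h4 (B ∩ A) Finset.inter_subset_right (hr.inter h3) with h6 | h6 <;>
    rcases h5 (B ∩ (S \ A)) Finset.inter_subset_right (hr.inter hS) with h7 | h7
  · left; rw [hBe, h6, h7]; simp
  · exfalso
    have h8 : b ∈ B := by rw [← h7] at hb'; exact (Finset.mem_inter.1 hb').1
    have h9 : a ∈ B ∩ A := Finset.mem_inter.2 ⟨hab.2 h8, h1⟩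
    rw [h6] at h9; simp at h9
  · exfalso
    have h8 : a ∈ B := by rw [← h6] at h1; exact (Finset.mem_inter.1 h1).1
    have h9 : b ∈ B ∩ (S \ A) := Finset.mem_inter.2 ⟨hab.1 h8, hb'⟩
    rw [h7] at h9; simp at h9
  · right; rw [hBe, h6, h7, Finset.union_sdiff_of_subset hA]

theorem existsUnique_isHalf {S : Finset V} {l : List (V × V)} (hl : ∀ p ∈ l, p ∈ S.offDiag)
    {a b : V} (ha : a ∈ S) (h : Connects S ((a, b) :: l)) (hn : ¬ Connects S l) :
    ∃ A ⊆ S, IsHalf S a b l A ∧ ∀ B ⊆ S, IsHalf S a b l B → B = A := by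
  classical
  have hS := respects_of_subset hl
  set C := S.filter fun x => ∀ A ⊆ S, Respects A l → a ∈ A → x ∈ A with hC
  have hCS : C ⊆ S := Finset.filter_subset _ _
  have hCmin : ∀ A, Respects A l → a ∈ A → C ⊆ A := by
    intro A hA haA x hx
    have := (Finset.mem_filter.1 hx).2 (A ∩ S) Finset.inter_subset_right (hA.inter hS)
      (Finset.mem_inter.2 ⟨haA, ha⟩)
    exact (Finset.mem_inter.1 this).1
  have haC : a ∈ C := Finset.mem_filter.2 ⟨ha, fun A _ _ h => h⟩
  have hCr : Respects C l := by
    intro p hp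
    have := hS p hp
    simp only [hC, Finset.mem_filter, this]
    refine and_congr Iff.rfl (forall_congr' fun A => forall_congr' fun _ =>
      forall_congr' fun hA => ?_)
    rw [hA p hp]
  have hbC : b ∉ C := by
    intro hb
    obtain ⟨A, hA, hAr, h1, h2⟩ : ∃ A ⊆ S, Respects A l ∧ A ≠ ∅ ∧ A ≠ S := by
      simpa [Connects] using hn
    by_cases haA : a ∈ A
    · rcases h A hA (respects_cons.2 ⟨by simp [haA, hCmin A hAr haA hb], hAr⟩) with h3 | h3
      exacts [h1 h3, h2 h3]
    · have h4 : b ∉ A := fun hbA => by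
        have := hCmin (S \ A) (hS.sdiff hAr) (Finset.mem_sdiff.2 ⟨ha, haA⟩) hb
        exact (Finset.mem_sdiff.1 this).2 hbA
      rcases h A hA (respects_cons.2 ⟨by simp [haA, h4], hAr⟩) with h3 | h3
      exacts [h1 h3, h2 h3]
  refine ⟨C, hCS, ⟨haC, hbC, hCr, ?_, ?_⟩, ?_⟩
  · intro A hA hr
    by_cases haA : a ∈ A
    · right; exact hA.antisymm (hCmin A hr haA)
    · left
      have := hCmin (C \ A) (hCr.sdiff hr) (Finset.mem_sdiff.2 ⟨haC, haA⟩)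
      rw [Finset.eq_empty_iff_forall_notMem]
      intro x hx
      exact (Finset.mem_sdiff.1 (this (hA hx))).2 hx
  · intro A hA hr
    have haA : a ∉ A := fun h' => (Finset.mem_sdiff.1 (hA h')).2 haC
    by_cases hbA : b ∈ A
    · right
      rcases h (A ∪ C) (Finset.union_subset (hA.trans Finset.sdiff_subset) hCS)
        (respects_cons.2 ⟨by simp [haC, hbA], hr.union hCr⟩) with h3 | h3
      · rw [Finset.union_eq_empty] at h3; simp [h3.1] at hbA
      · refine hA.antisymm fun x hx => ?_
        rw [← h3, Finset.mem_sdiff, Finset.mem_union] at hx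
        tauto
    · rcases h A (hA.trans Finset.sdiff_subset) (respects_cons.2 ⟨by simp [haA, hbA], hr⟩)
        with h3 | h3
      · exact Or.inl h3
      · exact absurd (h3 ▸ ha) haA
  · rintro B hB ⟨h1, h2, h3, h4, -⟩
    rcases h4 C (hCmin B h3 h1) hCr with h5 | h5
    · simp [h5] at haC
    · exact h5.symm

open Classical in
theorem connects_cons_indicator {S : Finset V} {l : List (V × V)}
    (hl : ∀ p ∈ l, p ∈ S.offDiag) {a b : V} (ha : a ∈ S) (hb : b ∈ S) :
    (if Connects S ((a, b) :: l) then (1 : ℚ) else 0) = (if Connects S l then 1 else 0) +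
      ∑ A ∈ S.powerset, if IsHalf S a b l A then 1 else 0 := by
  by_cases h : Connects S l
  · rw [if_pos (h.cons _), if_pos h, Finset.sum_eq_zero, add_zero]
    intro A hA
    rw [if_neg (h.not_isHalf hb (Finset.mem_powerset.1 hA))]
  · rw [if_neg h, zero_add]
    by_cases h' : Connects S ((a, b) :: l)
    · obtain ⟨A, hA, h1, h2⟩ := existsUnique_isHalf hl ha h' h
      rw [if_pos h', Finset.sum_eq_single A, if_pos h1]
      · intro B hB hBA
        rw [if_neg fun h3 => hBA (h2 B (Finset.mem_powerset.1 hB) h3)]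
      · intro h3; exact absurd (Finset.mem_powerset.2 hA) h3
    · rw [if_neg h', Finset.sum_eq_zero]
      intro A hA
      rw [if_neg fun h3 => h' (h3.connects hl hb (Finset.mem_powerset.1 hA))]

end Connected

section WordCount

variable {V : Type*} [DecidableEq V]

/-- The product of the transpositions given by a word of pairs. -/
def word (l : List (V × V)) : Equiv.Perm V := (l.map fun p => Equiv.swap p.1 p.2).prod

theorem word_nil : word ([] : List (V × V)) = 1 := rfl

theorem word_cons (p : V × V) (l : List (V × V)) :
    word (p :: l) = Equiv.swap p.1 p.2 * word l := by simp [word]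

/-- The permutation fixes every point outside of the set. -/
def SuppIn (S : Finset V) (π : Equiv.Perm V) : Prop := ∀ x ∉ S, π x = x

theorem suppIn_swap {S : Finset V} {a b : V} (ha : a ∈ S) (hb : b ∈ S) :
    SuppIn S (Equiv.swap a b) := fun _ hx =>
  Equiv.swap_apply_of_ne_of_ne (fun h => hx (h ▸ ha)) (fun h => hx (h ▸ hb))

omit [DecidableEq V] in
theorem SuppIn.mul {S : Finset V} {π ρ : Equiv.Perm V} (h : SuppIn S π) (h' : SuppIn S ρ) :
    SuppIn S (π * ρ) := fun x hx => by
  rw [Equiv.Perm.mul_apply, h' x hx, h x hx]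

theorem suppIn_word {S : Finset V} {l : List (V × V)} (hl : ∀ p ∈ l, p ∈ S.offDiag) :
    SuppIn S (word l) := by
  induction l with
  | nil => exact fun x _ => rfl
  | cons p l ih =>
    rw [word_cons]
    have := Finset.mem_offDiag.1 (hl p (by simp))
    exact (suppIn_swap this.1 this.2.1).mul (ih fun q hq => hl q (List.mem_cons_of_mem _ hq))

omit [DecidableEq V] in
theorem SuppIn.commute {A B : Finset V} (hd : Disjoint A B) {π ρ : Equiv.Perm V}
    (h : SuppIn A π) (h' : SuppIn B ρ) : π * ρ = ρ * π := by
  refine Equiv.Perm.Disjoint.commute fun x => ?_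
  by_cases hx : x ∈ A
  · exact Or.inr (h' x fun hxB => Finset.disjoint_left.1 hd hx hxB)
  · exact Or.inl (h x hx)

omit [DecidableEq V] in
theorem SuppIn.mul_eq_mul_iff {A B : Finset V} (hd : Disjoint A B) {π ρ π' ρ' : Equiv.Perm V}
    (h : SuppIn A π) (h1 : SuppIn B ρ) (h' : SuppIn A π') (h1' : SuppIn B ρ') :
    π * ρ = π' * ρ' ↔ π = π' ∧ ρ = ρ' := by
  refine ⟨fun he => ?_, by rintro ⟨rfl, rfl⟩; rfl⟩
  have hπ : π = π' := by
    ext x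
    by_cases hx : x ∈ A
    · have hxB : x ∉ B := fun hxB => Finset.disjoint_left.1 hd hx hxB
      have := congrArg (fun σ : Equiv.Perm V => σ x) he
      simpa [h1 x hxB, h1' x hxB] using this
    · rw [h x hx, h' x hx]
  subst hπ
  exact ⟨rfl, mul_left_cancel he⟩

theorem Respects.word_mem_iff {A : Finset V} {l : List (V × V)} (h : Respects A l) (x : V) :
    word l x ∈ A ↔ x ∈ A := by
  induction l with
  | nil => rfl
  | cons p l ih =>
    obtain ⟨h1, h2⟩ := respects_cons.1 h
    rw [word_cons, Equiv.Perm.mul_apply, ← ih h2]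
    by_cases h3 : word l x = p.1
    · rw [h3, Equiv.swap_apply_left, h1]
    · by_cases h4 : word l x = p.2
      · rw [h4, Equiv.swap_apply_right, h1]
      · rw [Equiv.swap_apply_of_ne_of_ne h3 h4]

omit [DecidableEq V] in
theorem disjoint_offDiag {A B : Finset V} (hd : Disjoint A B) : Disjoint A.offDiag B.offDiag := by
  rw [Finset.disjoint_left]
  intro p hp hp'
  exact Finset.disjoint_left.1 hd (Finset.mem_offDiag.1 hp).1 (Finset.mem_offDiag.1 hp').1

theorem word_eq_filter_mul {A B : Finset V} (hd : Disjoint A B) {l : List (V × V)}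
    (hl : ∀ p ∈ l, p ∈ A.offDiag ∪ B.offDiag) :
    word l = word (l.filter (· ∈ A.offDiag)) * word (l.filter (· ∈ B.offDiag)) := by
  induction l with
  | nil => simp [word_nil]
  | cons p l ih =>
    have hA : SuppIn A (word (l.filter (· ∈ A.offDiag))) := suppIn_word fun p hp => by
      simpa using (List.mem_filter.1 hp).2
    have h' := disjoint_offDiag hd
    rw [word_cons, ih fun q hq => hl q (List.mem_cons_of_mem _ hq)]
    rcases Finset.mem_union.1 (hl p (by simp)) with hp | hp
    · have hp' : p ∉ B.offDiag := fun h => Finset.disjoint_left.1 h' hp h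
      rw [List.filter_cons_of_pos (by simpa using hp), List.filter_cons_of_neg (by simpa using hp'),
        word_cons, mul_assoc]
    · have hp' : p ∉ A.offDiag := fun h => Finset.disjoint_left.1 h' h hp
      have := Finset.mem_offDiag.1 hp
      rw [List.filter_cons_of_neg (by simpa using hp'), List.filter_cons_of_pos (by simpa using hp),
        word_cons, ← mul_assoc, ← mul_assoc, hA.commute hd (suppIn_swap this.1 this.2.1)]

theorem connects_filter_iff {A B : Finset V} (hd : Disjoint A B) {l : List (V × V)}
    (hl : ∀ p ∈ l, p ∈ A.offDiag ∪ B.offDiag) :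
    Connects A (l.filter (· ∈ A.offDiag)) ↔ Connects A l := by
  refine forall_congr' fun C => forall_congr' fun hC => ?_
  have : Respects C (l.filter (· ∈ A.offDiag)) ↔ Respects C l := by
    refine ⟨fun h p hp => ?_, fun h p hp => h p (List.mem_of_mem_filter hp)⟩
    rcases Finset.mem_union.1 (hl p hp) with h' | h'
    · exact h p (List.mem_filter.2 ⟨hp, by simpa using h'⟩)
    · have h2 := Finset.mem_offDiag.1 h'
      have h3 : p.1 ∉ C := fun h => Finset.disjoint_left.1 hd (hC h) h2.1
      have h4 : p.2 ∉ C := fun h => Finset.disjoint_left.1 hd (hC h) h2.2.1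
      simp [h3, h4]
  rw [this]

theorem respects_iff_mem_union {S A : Finset V} {l : List (V × V)}
    (hl : ∀ p ∈ l, p ∈ S.offDiag) :
    Respects A l ↔ ∀ p ∈ l, p ∈ A.offDiag ∪ (S \ A).offDiag := by
  refine forall_congr' fun p => forall_congr' fun hp => ?_
  have := Finset.mem_offDiag.1 (hl p hp)
  simp only [Finset.mem_union, Finset.mem_offDiag, Finset.mem_sdiff]
  tauto

open Classical in
/-- The number of words of `r` pairs in `S` which connect `S` and have product `π`. -/
noncomputable def wordCount (S : Finset V) (r : ℕ) (π : Equiv.Perm V) : ℚ :=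
  lsum S.offDiag r fun l => if word l = π ∧ Connects S l then 1 else 0

open Classical in
/-- The number of words of `r` pairs in `S` with product `ρ` for which `A` is the half of `a`. -/
noncomputable def halfCount (S : Finset V) (r : ℕ) (ρ : Equiv.Perm V) (a b : V) (A : Finset V) :
    ℚ :=
  lsum S.offDiag r fun l => if word l = ρ ∧ IsHalf S a b l A then 1 else 0

theorem wordCount_succ (S : Finset V) (r : ℕ) (π : Equiv.Perm V) :
    wordCount S (r + 1) π = ∑ p ∈ S.offDiag, (wordCount S r (Equiv.swap p.1 p.2 * π) +
      ∑ A ∈ S.powerset, halfCount S r (Equiv.swap p.1 p.2 * π) p.1 p.2 A) := by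
  classical
  rw [wordCount, lsum_succ]
  refine Finset.sum_congr rfl fun p hp => ?_
  have hp' := Finset.mem_offDiag.1 hp
  rw [wordCount]
  simp only [halfCount]
  rw [← lsum_sum, ← lsum_add]
  refine lsum_congr fun l hl => ?_
  have hw : word (p :: l) = π ↔ word l = Equiv.swap p.1 p.2 * π := by
    rw [word_cons]
    constructor
    · rintro rfl; rw [Equiv.swap_mul_self_mul]
    · rintro h; rw [h, Equiv.swap_mul_self_mul]
  have hc := connects_cons_indicator hl hp'.1 hp'.2.1
  by_cases h : word l = Equiv.swap p.1 p.2 * π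
  · simpa [hw, h] using hc
  · simp [hw, h]

theorem halfCount_eq_zero {S A : Finset V} {r : ℕ} {ρ : Equiv.Perm V} {a b : V}
    (h : ¬ (a ∈ A ∧ b ∉ A ∧ ∀ x, ρ x ∈ A ↔ x ∈ A)) : halfCount S r ρ a b A = 0 := by
  classical
  refine lsum_eq_zero fun l _ => if_neg ?_
  rintro ⟨rfl, h1, h2, h3, -, -⟩
  exact h ⟨h1, h2, h3.word_mem_iff⟩

theorem halfCount_mul {S A : Finset V} (hA : A ⊆ S) {r : ℕ} {ρ₁ ρ₂ : Equiv.Perm V} {a b : V}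
    (ha : a ∈ A) (hb : b ∉ A) (h1 : SuppIn A ρ₁) (h2 : SuppIn (S \ A) ρ₂) :
    halfCount S r (ρ₁ * ρ₂) a b A = ∑ p ∈ Finset.HasAntidiagonal.antidiagonal r,
      (r.choose p.1 : ℚ) * (wordCount A p.1 ρ₁ * wordCount (S \ A) p.2 ρ₂) := by
  classical
  have hd : Disjoint A (S \ A) := Finset.disjoint_sdiff
  have hsub : A.offDiag ∪ (S \ A).offDiag ⊆ S.offDiag :=
    Finset.union_subset (Finset.offDiag_mono hA) (Finset.offDiag_mono Finset.sdiff_subset)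
  simp only [halfCount, wordCount]
  rw [← lsum_shuffle (disjoint_offDiag hd) r
    (fun l => if word l = ρ₁ ∧ Connects A l then 1 else 0)
    (fun l => if word l = ρ₂ ∧ Connects (S \ A) l then 1 else 0)]
  have key : ∀ l : List (V × V), (∀ p ∈ l, p ∈ S.offDiag) →
      (if word l = ρ₁ * ρ₂ ∧ IsHalf S a b l A then (1 : ℚ) else 0) =
      if ∀ p ∈ l, p ∈ A.offDiag ∪ (S \ A).offDiag then
        (if word l = ρ₁ * ρ₂ ∧ Connects A l ∧ Connects (S \ A) l then 1 else 0) else 0 := by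
    intro l hl
    have h3 := respects_iff_mem_union (A := A) hl
    by_cases h : Respects A l
    · rw [if_pos (h3.1 h)]
      simp [IsHalf, ha, hb, h]
    · rw [if_neg fun h' => h (h3.2 h'), if_neg fun h' => h h'.2.2.2.1]
  rw [lsum_congr key, lsum_restrict hsub]
  · refine lsum_congr fun l hl => ?_
    have hl' : ∀ p ∈ l, p ∈ (S \ A).offDiag ∪ A.offDiag := by rwa [Finset.union_comm]
    have e1 : word l = ρ₁ * ρ₂ ↔ word (l.filter (· ∈ A.offDiag)) = ρ₁ ∧
        word (l.filter (· ∈ (S \ A).offDiag)) = ρ₂ := by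
      rw [word_eq_filter_mul hd hl]
      exact SuppIn.mul_eq_mul_iff hd
        (suppIn_word fun p hp => by simpa using (List.mem_filter.1 hp).2)
        (suppIn_word fun p hp => by simpa using (List.mem_filter.1 hp).2) h1 h2
    have e2 := connects_filter_iff hd hl
    have e3 := connects_filter_iff hd.symm hl'
    rw [if_pos hl, ite_zero_mul_ite_zero, one_mul]
    refine if_congr ?_ rfl rfl
    rw [e1, e2, e3]
    tauto
  · intro l hl
    rw [if_neg hl]

theorem exists_suppIn_mul {S A : Finset V} {ρ : Equiv.Perm V}
    (hρ : SuppIn S ρ) (h : ∀ x, ρ x ∈ A ↔ x ∈ A) :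
    ∃ ρ₁ ρ₂ : Equiv.Perm V, ρ = ρ₁ * ρ₂ ∧ SuppIn A ρ₁ ∧ SuppIn (S \ A) ρ₂ ∧
      (∀ x ∈ A, ρ₁ x = ρ x) ∧ ∀ x ∈ S \ A, ρ₂ x = ρ x := by
  set ρ₁ : Equiv.Perm V := Equiv.Perm.ofSubtype (ρ.subtypePerm (p := (· ∈ A)) h) with hρ₁
  have e1 : ∀ x ∈ A, ρ₁ x = ρ x := fun x hx => by
    rw [hρ₁, Equiv.Perm.ofSubtype_apply_of_mem _ hx]; rfl
  have e2 : SuppIn A ρ₁ := fun x hx => Equiv.Perm.ofSubtype_apply_of_not_mem _ hx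
  refine ⟨ρ₁, ρ₁⁻¹ * ρ, by group, e2, fun x hx => ?_, e1, fun x hx => ?_⟩
  · rw [Equiv.Perm.mul_apply, Equiv.Perm.inv_eq_iff_eq]
    by_cases hxA : x ∈ A
    · exact (e1 x hxA).symm
    · rw [e2 x hxA]
      exact hρ x fun hxS => hx (Finset.mem_sdiff.2 ⟨hxS, hxA⟩)
  · rw [Equiv.Perm.mul_apply, Equiv.Perm.inv_eq_iff_eq]
    exact (e2 _ fun h' => (Finset.mem_sdiff.1 hx).2 ((h x).1 h')).symm

end WordCount

section Cycles

variable {V : Type*} [DecidableEq V] [Fintype V]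

/-- The orbit of a point under a permutation. -/
def cyc (π : Equiv.Perm V) (x : V) : Finset V := Finset.univ.filter (π.SameCycle x)

theorem mem_cyc {π : Equiv.Perm V} {x y : V} : y ∈ cyc π x ↔ π.SameCycle x y := by simp [cyc]

theorem self_mem_cyc (π : Equiv.Perm V) (x : V) : x ∈ cyc π x := mem_cyc.2 (.refl _ _)

theorem cyc_eq_of_mem {π : Equiv.Perm V} {x y : V} (h : y ∈ cyc π x) : cyc π y = cyc π x := by
  ext z
  rw [mem_cyc] at h
  rw [mem_cyc, mem_cyc]
  exact ⟨h.trans, h.symm.trans⟩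

theorem cyc_eq_iff {π : Equiv.Perm V} {x y : V} : cyc π y = cyc π x ↔ y ∈ cyc π x :=
  ⟨fun h => h ▸ self_mem_cyc π y, cyc_eq_of_mem⟩

theorem apply_mem_cyc {π : Equiv.Perm V} {x y : V} : π y ∈ cyc π x ↔ y ∈ cyc π x := by
  rw [mem_cyc, mem_cyc, Equiv.Perm.sameCycle_apply_right]

theorem cyc_subset {π : Equiv.Perm V} {x : V} {A : Finset V} (hx : x ∈ A)
    (hA : ∀ y ∈ A, π y ∈ A) : cyc π x ⊆ A := by
  intro y hy
  obtain ⟨i, rfl⟩ := (mem_cyc.1 hy).exists_nat_pow_eq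
  clear hy
  induction i with
  | zero => exact hx
  | succ i ih => rw [_root_.pow_succ', Equiv.Perm.mul_apply]; exact hA _ ih

theorem cyc_eq_image {π : Equiv.Perm V} {c : ℕ → V} {k : ℕ} (hk : 0 < k) (h0 : c k = c 0)
    (hc : ∀ i < k, π (c i) = c (i + 1)) : cyc π (c 0) = (Finset.range k).image c := by
  apply Finset.Subset.antisymm
  · refine cyc_subset (Finset.mem_image.2 ⟨0, Finset.mem_range.2 hk, rfl⟩) fun y hy => ?_
    obtain ⟨i, hi, rfl⟩ := Finset.mem_image.1 hy
    have hi := Finset.mem_range.1 hi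
    rw [hc i hi]
    rcases Nat.lt_or_ge (i + 1) k with h | h
    · exact Finset.mem_image.2 ⟨i + 1, Finset.mem_range.2 h, rfl⟩
    · rw [show i + 1 = k by omega, h0]
      exact Finset.mem_image.2 ⟨0, Finset.mem_range.2 hk, rfl⟩
  · intro y hy
    obtain ⟨i, hi, rfl⟩ := Finset.mem_image.1 hy
    have hi := Finset.mem_range.1 hi
    clear hy
    induction i with
    | zero => exact self_mem_cyc _ _
    | succ i ih =>
      rw [← hc i (by omega), apply_mem_cyc]
      exact ih (Finset.mem_range.2 (by omega)) (by omega)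

/-- The length of the orbit of a point. -/
noncomputable def cycLen (π : Equiv.Perm V) (x : V) : ℕ := Function.minimalPeriod π x

omit [DecidableEq V] in
theorem cycLen_pos (π : Equiv.Perm V) (x : V) : 0 < cycLen π x :=
  Function.minimalPeriod_pos_of_mem_periodicPts (π.injective.mem_periodicPts x)

omit [DecidableEq V] [Fintype V] in
theorem pow_cycLen (π : Equiv.Perm V) (x : V) : (π ^ cycLen π x) x = x := by
  rw [← Equiv.Perm.iterate_eq_pow]; exact Function.iterate_minimalPeriod

omit [DecidableEq V] [Fintype V] in
theorem pow_injOn (π : Equiv.Perm V) (x : V) :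
    Set.InjOn (fun i => (π ^ i) x) (Set.Iio (cycLen π x)) := by
  have := Function.iterate_injOn_Iio_minimalPeriod (f := π) (x := x)
  simp only [Equiv.Perm.iterate_eq_pow] at this
  exact this

theorem cyc_eq (π : Equiv.Perm V) (x : V) :
    cyc π x = (Finset.range (cycLen π x)).image fun i => (π ^ i) x := by
  have := cyc_eq_image (π := π) (c := fun i => (π ^ i) x) (cycLen_pos π x) (pow_cycLen π x)
    (fun i _ => by rw [_root_.pow_succ', Equiv.Perm.mul_apply])
  simpa using this

theorem card_cyc (π : Equiv.Perm V) (x : V) : #(cyc π x) = cycLen π x := by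
  rw [cyc_eq, Finset.card_image_of_injOn, Finset.card_range]
  simpa using pow_injOn π x

theorem sum_cyc_erase (π : Equiv.Perm V) (a : V) (G : ℕ × ℕ → ℚ) (F : V → ℚ)
    (h : ∀ p ∈ splits #(cyc π a), F ((π ^ p.1) a) = G p) :
    ∑ b ∈ (cyc π a).erase a, F b = ∑ p ∈ splits #(cyc π a), G p := by
  symm
  rw [card_cyc] at h ⊢
  refine Finset.sum_bij (fun p _ => (π ^ p.1) a) ?_ ?_ ?_ fun p hp => (h p hp).symm
  · intro p hp
    rw [mem_splits] at hp
    refine Finset.mem_erase.2 ⟨fun h' => ?_, mem_cyc.2 ⟨p.1, rfl⟩⟩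
    have := (pow_injOn π a) (x₁ := p.1) (x₂ := 0) (by simp; omega) (by simp; omega)
      (by simpa using h')
    omega
  · intro p hp q hq h'
    rw [mem_splits] at hp hq
    have := (pow_injOn π a) (x₁ := p.1) (x₂ := q.1) (by simp; omega) (by simp; omega) h'
    ext <;> omega
  · intro b hb
    obtain ⟨h1, h2⟩ := Finset.mem_erase.1 hb
    rw [cyc_eq] at h2
    obtain ⟨i, hi, rfl⟩ := Finset.mem_image.1 h2
    rw [Finset.mem_range] at hi
    refine ⟨(i, cycLen π a - i), mem_splits.2 ⟨?_, ?_, ?_⟩, rfl⟩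
    · simp only; omega
    · rcases Nat.eq_zero_or_pos i with rfl | h3
      · simp at h1
      · exact h3
    · simp only; omega

theorem cyc_swap_mul_left {π : Equiv.Perm V} {a : V} {k : ℕ} (hk : 0 < k) (hk' : k < cycLen π a) :
    cyc (Equiv.swap a ((π ^ k) a) * π) a = (Finset.range k).image fun i => (π ^ i) a := by
  have inj := pow_injOn π a
  have := cyc_eq_image (π := Equiv.swap a ((π ^ k) a) * π)
    (c := fun i => if i = k then a else (π ^ i) a) hk (by simp [hk.ne]) (fun i hi => ?_)
  · simp only [hk.ne, if_false, pow_zero, Equiv.Perm.one_apply] at this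
    rw [this]
    refine Finset.image_congr fun i hi => ?_
    have : i ≠ k := by have := Finset.mem_range.1 hi; omega
    simp [this]
  · have e : π ((π ^ i) a) = (π ^ (i + 1)) a := by rw [_root_.pow_succ', Equiv.Perm.mul_apply]
    simp only [hi.ne, if_false, Equiv.Perm.mul_apply, e]
    split_ifs with h
    · rw [h, Equiv.swap_apply_right]
    · refine Equiv.swap_apply_of_ne_of_ne (fun h' => ?_) fun h' => ?_
      · have := inj (x₁ := i + 1) (x₂ := 0) (by simp; omega) (by simp; omega) (by simpa using h')
        omega
      · have := inj (x₁ := i + 1) (x₂ := k) (by simp; omega) (by simp; omega) h'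
        omega

theorem cyc_swap_mul_right {π : Equiv.Perm V} {a : V} {k : ℕ} (hk : 0 < k) (hk' : k < cycLen π a) :
    cyc (Equiv.swap a ((π ^ k) a) * π) ((π ^ k) a) =
      (Finset.range (cycLen π a - k)).image fun i => (π ^ (k + i)) a := by
  have inj := pow_injOn π a
  have hN := pow_cycLen π a
  set N := cycLen π a
  have hNk : N - k ≠ 0 := by omega
  have := cyc_eq_image (π := Equiv.swap a ((π ^ k) a) * π) (k := N - k)
    (c := fun i => if i = N - k then (π ^ k) a else (π ^ (k + i)) a) (by omega)
    (by simp [hNk.symm]) (fun i hi => ?_)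
  · simp only [hNk.symm, if_false, add_zero] at this
    rw [this]
    refine Finset.image_congr fun i hi => ?_
    have : i ≠ N - k := by have := Finset.mem_range.1 hi; omega
    simp [this]
  · have e : π ((π ^ (k + i)) a) = (π ^ (k + (i + 1))) a := by
      rw [← add_assoc, _root_.pow_succ' π (k + i), Equiv.Perm.mul_apply]
    simp only [hi.ne, if_false, Equiv.Perm.mul_apply, e]
    split_ifs with h
    · rw [h, show k + (N - k) = N by omega, hN, Equiv.swap_apply_left]
    · refine Equiv.swap_apply_of_ne_of_ne (fun h' => ?_) fun h' => ?_
      · have := inj (x₁ := k + (i + 1)) (x₂ := 0) (by simp; omega) (by simp; omega)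
          (by simpa using h')
        omega
      · have := inj (x₁ := k + (i + 1)) (x₂ := k) (by simp; omega) (by simp; omega) h'
        omega

theorem cyc_congr {π ρ : Equiv.Perm V} {x : V} (h : ∀ y ∈ cyc π x, ρ y = π y) :
    cyc ρ x = cyc π x := by
  have key : ∀ i : ℕ, (ρ ^ i) x = (π ^ i) x := by
    intro i
    induction i with
    | zero => rfl
    | succ i ih =>
      rw [_root_.pow_succ', Equiv.Perm.mul_apply, ih, h _ (mem_cyc.2 ⟨i, by rw [zpow_natCast]⟩),
        _root_.pow_succ' π, Equiv.Perm.mul_apply]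
  ext y
  rw [mem_cyc, mem_cyc]
  constructor <;> intro h'
  · obtain ⟨i, rfl⟩ := h'.exists_nat_pow_eq
    exact ⟨i, by rw [zpow_natCast, key]⟩
  · obtain ⟨i, rfl⟩ := h'.exists_nat_pow_eq
    exact ⟨i, by rw [zpow_natCast, key]⟩

/-- Multiplying by a transposition of two points of an orbit cuts that orbit in two. -/
theorem cyc_cut {π : Equiv.Perm V} {a b : V} {k : ℕ} (hk : 0 < k) (hk' : k < #(cyc π a))
    (hb : b = (π ^ k) a) :
    #(cyc (Equiv.swap a b * π) a) = k ∧ #(cyc (Equiv.swap a b * π) b) = #(cyc π a) - k ∧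
    Disjoint (cyc (Equiv.swap a b * π) a) (cyc (Equiv.swap a b * π) b) ∧
    cyc (Equiv.swap a b * π) a ∪ cyc (Equiv.swap a b * π) b = cyc π a ∧
    ∀ x ∉ cyc π a, cyc (Equiv.swap a b * π) x = cyc π x := by
  subst hb
  have hN := card_cyc π a
  rw [hN] at hk' ⊢
  have inj := pow_injOn π a
  rw [cyc_swap_mul_left hk hk', cyc_swap_mul_right hk hk']
  refine ⟨?_, ?_, ?_, ?_, ?_⟩
  · rw [Finset.card_image_of_injOn, Finset.card_range]
    refine inj.mono fun i hi => ?_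
    simp at hi ⊢; omega
  · rw [Finset.card_image_of_injOn, Finset.card_range]
    intro i hi j hj h
    simp only [Finset.coe_range, Set.mem_Iio] at hi hj
    have := inj (x₁ := k + i) (x₂ := k + j) (by simp; omega) (by simp; omega) h
    omega
  · rw [Finset.disjoint_left]
    intro x hx hx'
    obtain ⟨i, hi, rfl⟩ := Finset.mem_image.1 hx
    obtain ⟨j, hj, h⟩ := Finset.mem_image.1 hx'
    rw [Finset.mem_range] at hi hj
    have := inj (x₁ := k + j) (x₂ := i) (by simp; omega) (by simp; omega) h
    omega
  · rw [cyc_eq]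
    ext x
    simp only [Finset.mem_union, Finset.mem_image, Finset.mem_range]
    constructor
    · rintro (⟨i, hi, rfl⟩ | ⟨i, hi, rfl⟩)
      exacts [⟨i, by omega, rfl⟩, ⟨k + i, by omega, rfl⟩]
    · rintro ⟨i, hi, rfl⟩
      rcases Nat.lt_or_ge i k with h | h
      · exact Or.inl ⟨i, h, rfl⟩
      · exact Or.inr ⟨i - k, by omega, by rw [Nat.add_sub_cancel' h]⟩
  · intro x hx
    refine cyc_congr fun y hy => ?_
    rw [Equiv.Perm.mul_apply]
    have h1 : π y ∉ cyc π a := fun h => by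
      rw [apply_mem_cyc] at h
      exact hx (by rw [← cyc_eq_iff, ← cyc_eq_of_mem hy, cyc_eq_of_mem h])
    refine Equiv.swap_apply_of_ne_of_ne (fun h => h1 ?_) fun h => h1 ?_
    · rw [h]; exact self_mem_cyc _ _
    · rw [h]; exact mem_cyc.2 ⟨k, rfl⟩

theorem exists_pow_eq_of_mem_cyc {π : Equiv.Perm V} {a b : V} (hab : a ≠ b) (hb : b ∈ cyc π a) :
    ∃ k, 0 < k ∧ k < #(cyc π a) ∧ b = (π ^ k) a := by
  rw [card_cyc]
  rw [cyc_eq] at hb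
  obtain ⟨i, hi, rfl⟩ := Finset.mem_image.1 hb
  refine ⟨i, Nat.pos_of_ne_zero fun h => hab ?_, Finset.mem_range.1 hi, rfl⟩
  simp [h]

theorem mem_cyc_swap_mul {π : Equiv.Perm V} {a b : V} (hb : b ∉ cyc π a) :
    b ∈ cyc (Equiv.swap a b * π) a := by
  have inj := pow_injOn π a
  have key : ∀ i < cycLen π a, ((Equiv.swap a b * π) ^ i) a = (π ^ i) a := by
    intro i hi
    induction i with
    | zero => rfl
    | succ i ih =>
      rw [_root_.pow_succ', Equiv.Perm.mul_apply, ih (by omega), Equiv.Perm.mul_apply,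
        ← Equiv.Perm.mul_apply π, ← _root_.pow_succ']
      refine Equiv.swap_apply_of_ne_of_ne (fun h => ?_) fun h => hb ?_
      · have := inj (x₁ := i + 1) (x₂ := 0) (by simpa using hi) (by simp; omega) (by simpa using h)
        omega
      · rw [← h]; exact mem_cyc.2 ⟨(i + 1 : ℕ), rfl⟩
  obtain ⟨N, hN⟩ := Nat.exists_eq_add_one_of_ne_zero (cycLen_pos π a).ne'
  refine mem_cyc.2 ⟨(N + 1 : ℕ), ?_⟩
  rw [zpow_natCast, _root_.pow_succ', Equiv.Perm.mul_apply, key N (by omega), Equiv.Perm.mul_apply,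
    ← Equiv.Perm.mul_apply π, ← _root_.pow_succ', ← hN, pow_cycLen, Equiv.swap_apply_left]

end Cycles

section CycleSets

variable {V : Type*} [DecidableEq V] [Fintype V]

/-- The set of orbits of a permutation on a set. -/
def cycles (S : Finset V) (π : Equiv.Perm V) : Finset (Finset V) := S.image (cyc π)

/-- The multiset of sizes of the orbits of a permutation on a set. -/
def orbitType (S : Finset V) (π : Equiv.Perm V) : Multiset ℕ := (cycles S π).val.map Finset.card

theorem cyc_mem_cycles {S : Finset V} (π : Equiv.Perm V) {x : V} (hx : x ∈ S) :
    cyc π x ∈ cycles S π := Finset.mem_image_of_mem _ hx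

theorem cycles_congr {S : Finset V} {π ρ : Equiv.Perm V} (h : ∀ x ∈ S, cyc ρ x = cyc π x) :
    cycles S ρ = cycles S π := Finset.image_congr fun x hx => h x hx

theorem cycles_cyc (π : Equiv.Perm V) (x : V) : cycles (cyc π x) π = {cyc π x} := by
  ext A
  simp only [cycles, Finset.mem_image, Finset.mem_singleton]
  constructor
  · rintro ⟨y, hy, rfl⟩; exact cyc_eq_of_mem hy
  · rintro rfl; exact ⟨x, self_mem_cyc _ _, rfl⟩

theorem cycles_union (S T : Finset V) (π : Equiv.Perm V) :
    cycles (S ∪ T) π = cycles S π ∪ cycles T π := Finset.image_union _ _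

theorem SuppIn.cyc_subset {S : Finset V} {π : Equiv.Perm V} (h : SuppIn S π) {x : V}
    (hx : x ∈ S) : cyc π x ⊆ S := by
  refine _root_.cyc_subset hx fun y hy => ?_
  by_contra h'
  exact h' ((π.injective (h _ h')).symm ▸ hy)

theorem cyc_subset_of_apply_mem {A : Finset V} {π : Equiv.Perm V} (h : ∀ x, π x ∈ A ↔ x ∈ A)
    {x : V} (hx : x ∈ A) : cyc π x ⊆ A := cyc_subset hx fun y hy => (h y).2 hy

theorem cycles_sdiff {S A : Finset V} {π : Equiv.Perm V} (h : ∀ x ∈ A, cyc π x ⊆ A) :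
    cycles (S \ A) π = cycles S π \ cycles A π := by
  ext C
  simp only [cycles, Finset.mem_image, Finset.mem_sdiff]
  constructor
  · rintro ⟨x, ⟨hx, hxA⟩, rfl⟩
    refine ⟨⟨x, hx, rfl⟩, ?_⟩
    rintro ⟨y, hy, hyx⟩
    exact hxA (h y hy (hyx ▸ self_mem_cyc π x))
  · rintro ⟨⟨x, hx, rfl⟩, h'⟩
    exact ⟨x, ⟨hx, fun hxA => h' ⟨x, hxA, rfl⟩⟩, rfl⟩

theorem cycles_sdiff_cyc (S : Finset V) (π : Equiv.Perm V) (a : V) :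
    cycles (S \ cyc π a) π = (cycles S π).erase (cyc π a) := by
  rw [cycles_sdiff (fun x hx => (cyc_eq_of_mem hx).le), cycles_cyc,
    Finset.sdiff_singleton_eq_erase]

theorem cycles_biUnion {S : Finset V} {π : Equiv.Perm V} {K : Finset (Finset V)}
    (hK : K ⊆ cycles S π) : cycles (K.biUnion id) π = K := by
  ext C
  simp only [cycles, Finset.mem_image, Finset.mem_biUnion, id]
  constructor
  · rintro ⟨x, ⟨D, hD, hx⟩, rfl⟩
    obtain ⟨y, -, rfl⟩ := Finset.mem_image.1 (hK hD)
    rwa [cyc_eq_of_mem hx]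
  · intro hC
    obtain ⟨y, -, rfl⟩ := Finset.mem_image.1 (hK hC)
    exact ⟨y, ⟨_, hC, self_mem_cyc _ _⟩, rfl⟩

theorem biUnion_cycles {A : Finset V} {π : Equiv.Perm V} (h : ∀ x ∈ A, cyc π x ⊆ A) :
    (cycles A π).biUnion id = A := by
  ext x
  simp only [Finset.mem_biUnion, id]
  constructor
  · rintro ⟨C, hC, hx⟩
    obtain ⟨y, hy, rfl⟩ := Finset.mem_image.1 hC
    exact h y hy hx
  · intro hx
    exact ⟨_, cyc_mem_cycles π hx, self_mem_cyc _ _⟩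

theorem card_pos_of_mem_cycles {S : Finset V} {π : Equiv.Perm V} {C : Finset V}
    (hC : C ∈ cycles S π) : 0 < #C := by
  obtain ⟨y, -, rfl⟩ := Finset.mem_image.1 hC
  exact Finset.card_pos.2 ⟨y, self_mem_cyc _ _⟩

theorem sum_cycles {S : Finset V} {π : Equiv.Perm V} (h : ∀ x ∈ S, cyc π x ⊆ S)
    (F : Finset V → ℚ) : ∑ x ∈ S, F (cyc π x) = ∑ C ∈ cycles S π, (#C : ℚ) * F C := by
  rw [Finset.sum_comp]
  refine Finset.sum_congr rfl fun C hC => ?_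
  obtain ⟨y, hy, rfl⟩ := Finset.mem_image.1 hC
  have : S.filter (fun x => cyc π x = cyc π y) = cyc π y := by
    ext x
    rw [Finset.mem_filter, cyc_eq_iff]
    exact ⟨fun h' => h'.2, fun h' => ⟨h y hy h', h'⟩⟩
  rw [this, nsmul_eq_mul]

theorem sum_cycles_card {S : Finset V} {π : Equiv.Perm V} (h : ∀ x ∈ S, cyc π x ⊆ S) :
    ∑ C ∈ cycles S π, #C = #S := by
  have := sum_cycles h fun _ => 1
  simp only [Finset.sum_const, nsmul_eq_mul, mul_one] at this
  exact_mod_cast this.symm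

theorem orbitType_sum {S : Finset V} {π : Equiv.Perm V} (h : SuppIn S π) :
    (orbitType S π).sum = #S := sum_cycles_card fun _ hx => h.cyc_subset hx

theorem orbitType_card (S : Finset V) (π : Equiv.Perm V) :
    (orbitType S π).card = #(cycles S π) := Multiset.card_map _ _

theorem cycles_cut {S : Finset V} {π : Equiv.Perm V} (hS : SuppIn S π) {a b : V} (ha : a ∈ S)
    (hab : a ≠ b) (hb : b ∈ cyc π a) {R : Finset (Finset V)}
    (hR : R = (cycles S π).erase (cyc π a)) :
    cyc (Equiv.swap a b * π) a ∉ R ∧ cyc (Equiv.swap a b * π) b ∉ R ∧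
    cyc (Equiv.swap a b * π) a ≠ cyc (Equiv.swap a b * π) b ∧
    cycles S (Equiv.swap a b * π) =
      insert (cyc (Equiv.swap a b * π) a) (insert (cyc (Equiv.swap a b * π) b) R) := by
  obtain ⟨k, hk, hk', hbk⟩ := exists_pow_eq_of_mem_cyc hab hb
  obtain ⟨-, -, h3, h4, h5⟩ := cyc_cut hk hk' hbk
  set σ := Equiv.swap a b * π
  rw [← cycles_sdiff_cyc S π a] at hR
  have hnot : ∀ x ∈ cyc π a, cyc σ x ∉ R := by
    intro x hx h'
    rw [hR] at h'
    obtain ⟨y, hy, hyx⟩ := Finset.mem_image.1 h'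
    have := cyc_eq_of_mem (hyx ▸ self_mem_cyc σ x : x ∈ cyc π y)
    rw [cyc_eq_of_mem hx] at this
    exact (Finset.mem_sdiff.1 hy).2 (this ▸ self_mem_cyc π y)
  refine ⟨hnot a (self_mem_cyc _ _), hnot b hb, fun h => ?_, ?_⟩
  · rw [h, disjoint_self] at h3
    have := self_mem_cyc σ b
    simp [h3] at this
  · have e1 : S = cyc σ a ∪ (cyc σ b ∪ (S \ cyc π a)) := by
      rw [← Finset.union_assoc, h4, Finset.union_sdiff_of_subset (hS.cyc_subset ha)]
    have e2 : cycles (S \ cyc π a) σ = R := by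
      rw [hR]
      exact cycles_congr fun x hx => h5 x (Finset.mem_sdiff.1 hx).2
    conv_lhs => rw [e1]
    rw [cycles_union, cycles_union, cycles_cyc, cycles_cyc, e2, ← Finset.insert_eq,
      ← Finset.insert_eq]

/-- The contribution of a pair of halves, in terms of orbit types. -/
theorem sum_halfCount {S : Finset V} {r : ℕ} {ρ : Equiv.Perm V} (hS : SuppIn S ρ) {a b : V}
    (hb : b ∈ S) {R : Finset (Finset V)} (haR : cyc ρ a ∉ R)
    (hbR : cyc ρ b ∉ R) (hab : cyc ρ a ≠ cyc ρ b)
    (hc : cycles S ρ = insert (cyc ρ a) (insert (cyc ρ b) R)) (g : Multiset ℕ → Multiset ℕ → ℚ)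
    (hg : ∀ (A B : Finset V) (ρ₁ ρ₂ : Equiv.Perm V), A.Nonempty → B.Nonempty → #A + #B = #S →
      #(cycles A ρ₁) + #(cycles B ρ₂) = #(cycles S ρ) → SuppIn A ρ₁ → SuppIn B ρ₂ →
      ∑ p ∈ Finset.HasAntidiagonal.antidiagonal r,
        (r.choose p.1 : ℚ) * (wordCount A p.1 ρ₁ * wordCount B p.2 ρ₂) =
          g (orbitType A ρ₁) (orbitType B ρ₂)) :
    ∑ A ∈ S.powerset, halfCount S r ρ a b A = ∑ J ∈ R.powerset,
      g (#(cyc ρ a) ::ₘ J.val.map Finset.card) (#(cyc ρ b) ::ₘ (R \ J).val.map Finset.card) := by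
  classical
  rw [← Finset.sum_filter_of_ne (p := fun A => a ∈ A ∧ b ∉ A ∧ ∀ x, ρ x ∈ A ↔ x ∈ A)
    (fun A _ h => by by_contra h'; exact h (halfCount_eq_zero h'))]
  symm
  have hsub : ∀ J ∈ R.powerset, insert (cyc ρ a) J ⊆ cycles S ρ := by
    intro J hJ
    rw [hc]
    exact Finset.insert_subset_insert _ ((Finset.mem_powerset.1 hJ).trans
      (Finset.subset_insert _ _))
  have hmem : ∀ J ∈ R.powerset, (insert (cyc ρ a) J).biUnion id ⊆ S ∧
      a ∈ (insert (cyc ρ a) J).biUnion id ∧ b ∉ (insert (cyc ρ a) J).biUnion id ∧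
      ∀ x, ρ x ∈ (insert (cyc ρ a) J).biUnion id ↔ x ∈ (insert (cyc ρ a) J).biUnion id := by
    intro J hJ
    refine ⟨?_, ?_, ?_, ?_⟩
    · conv_rhs => rw [← biUnion_cycles fun x hx => hS.cyc_subset hx]
      exact Finset.biUnion_subset_biUnion_of_subset_left _ (hsub J hJ)
    · exact Finset.mem_biUnion.2 ⟨_, Finset.mem_insert_self _ _, self_mem_cyc _ _⟩
    · intro h
      obtain ⟨C, hC, hbC⟩ := Finset.mem_biUnion.1 h
      obtain ⟨y, -, rfl⟩ := Finset.mem_image.1 (hsub J hJ hC)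
      rw [← cyc_eq_of_mem hbC] at hC
      rcases Finset.mem_insert.1 hC with h | h
      exacts [hab h.symm, hbR (Finset.mem_powerset.1 hJ h)]
    · intro x
      simp only [Finset.mem_biUnion, id]
      refine exists_congr fun C => and_congr_right fun hC => ?_
      obtain ⟨y, -, rfl⟩ := Finset.mem_image.1 (hsub J hJ hC)
      exact apply_mem_cyc
  refine Finset.sum_bij (fun J _ => (insert (cyc ρ a) J).biUnion id) ?_ ?_ ?_ ?_
  · intro J hJ
    exact Finset.mem_filter.2 ⟨Finset.mem_powerset.2 (hmem J hJ).1, (hmem J hJ).2⟩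
  · intro J hJ J' hJ' h
    have := congrArg (fun A => (cycles A ρ).erase (cyc ρ a)) h
    simp only [cycles_biUnion (hsub J hJ), cycles_biUnion (hsub J' hJ')] at this
    rwa [Finset.erase_insert fun h => haR (Finset.mem_powerset.1 hJ h),
      Finset.erase_insert fun h => haR (Finset.mem_powerset.1 hJ' h)] at this
  · intro A hA
    obtain ⟨hAS, haA, hbA, hinv⟩ := Finset.mem_filter.1 hA
    have hAS := Finset.mem_powerset.1 hAS
    refine ⟨(cycles A ρ).erase (cyc ρ a), Finset.mem_powerset.2 fun C hC => ?_, ?_⟩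
    · obtain ⟨h1, h2⟩ := Finset.mem_erase.1 hC
      have h3 : C ∈ cycles S ρ := Finset.image_subset_image hAS h2
      rw [hc, Finset.mem_insert, Finset.mem_insert] at h3
      rcases h3 with h3 | h3 | h3
      · exact absurd h3 h1
      · obtain ⟨y, hy, rfl⟩ := Finset.mem_image.1 h2
        exact absurd (cyc_subset_of_apply_mem hinv hy (h3 ▸ self_mem_cyc ρ b)) hbA
      · exact h3
    · rw [Finset.insert_erase (cyc_mem_cycles ρ haA),
        biUnion_cycles fun x hx => cyc_subset_of_apply_mem hinv hx]
  · intro J hJ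
    have hJR := Finset.mem_powerset.1 hJ
    obtain ⟨hAS, haA, hbA, hinv⟩ := hmem J hJ
    have hcA : cycles _ ρ = insert (cyc ρ a) J := cycles_biUnion (hsub J hJ)
    set A := (insert (cyc ρ a) J).biUnion id
    have hcB : cycles (S \ A) ρ = insert (cyc ρ b) (R \ J) := by
      rw [cycles_sdiff (fun x hx => cyc_subset_of_apply_mem hinv hx), hcA, hc]
      have h1 : cyc ρ b ∉ J := fun h => hbR (hJR h)
      ext C
      simp only [Finset.mem_sdiff, Finset.mem_insert]
      constructor
      · tauto
      · rintro (rfl | ⟨h2, h3⟩)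
        · exact ⟨Or.inr (Or.inl rfl), by rintro (h | h); exacts [hab h.symm, h1 h]⟩
        · exact ⟨Or.inr (Or.inr h2), by rintro (rfl | h); exacts [haR h2, h3 h]⟩
    obtain ⟨ρ₁, ρ₂, hρ, h1, h2, h3, h4⟩ := exists_suppIn_mul hS hinv
    have e1 : cycles A ρ₁ = insert (cyc ρ a) J := by
      rw [← hcA]
      exact cycles_congr fun x hx => cyc_congr fun y hy =>
        h3 y (cyc_subset_of_apply_mem hinv hx hy)
    have e2 : cycles (S \ A) ρ₂ = insert (cyc ρ b) (R \ J) := by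
      rw [← hcB]
      refine cycles_congr fun x hx => cyc_congr fun y hy => h4 y ?_
      obtain ⟨hx1, hx2⟩ := Finset.mem_sdiff.1 hx
      refine Finset.mem_sdiff.2 ⟨hS.cyc_subset hx1 hy, fun hyA => hx2 ?_⟩
      exact cyc_subset_of_apply_mem hinv hyA (cyc_eq_of_mem hy ▸ self_mem_cyc ρ x)
    have haJ : cyc ρ a ∉ J := fun h => haR (hJR h)
    have hbJ : cyc ρ b ∉ R \ J := fun h => hbR (Finset.mem_sdiff.1 h).1
    have t1 : orbitType A ρ₁ = #(cyc ρ a) ::ₘ J.val.map Finset.card := by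
      rw [orbitType, e1, Finset.insert_val_of_notMem haJ, Multiset.map_cons]
    have t2 : orbitType (S \ A) ρ₂ = #(cyc ρ b) ::ₘ (R \ J).val.map Finset.card := by
      rw [orbitType, e2, Finset.insert_val_of_notMem hbJ, Multiset.map_cons]
    rw [← t1, ← t2, hρ, halfCount_mul hAS haA hbA h1 h2]
    refine (hg A (S \ A) ρ₁ ρ₂ ⟨a, haA⟩ ⟨b, Finset.mem_sdiff.2 ⟨hb, hbA⟩⟩ ?_ ?_ h1 h2).symm
    · rw [add_comm, Finset.card_sdiff_add_card_eq_card hAS]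
    · rw [e1, e2, hc, Finset.card_insert_of_notMem haJ, Finset.card_insert_of_notMem hbJ,
        Finset.card_insert_of_notMem, Finset.card_insert_of_notMem hbR,
        ← Finset.card_sdiff_add_card_eq_card hJR]
      · ring
      · simp [hab, haR]

end CycleSets

section Recursion

variable {V : Type*} [DecidableEq V] [Fintype V]

theorem orbitType_swap_of_notMem {S : Finset V} {π : Equiv.Perm V} (hS : SuppIn S π) {a b : V}
    (ha : a ∈ S) (hb : b ∈ S) (hab : b ∉ cyc π a) :
    orbitType S (Equiv.swap a b * π) = (#(cyc π a) + #(cyc π b)) ::ₘ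
      (((cycles S π).erase (cyc π a)).erase (cyc π b)).val.map Finset.card := by
  have hne : a ≠ b := fun h => hab (h ▸ self_mem_cyc π a)
  set ρ := Equiv.swap a b * π with hρ
  have hρS : SuppIn S ρ := (suppIn_swap ha hb).mul hS
  have hbρ : b ∈ cyc ρ a := mem_cyc_swap_mul hab
  have hπ : Equiv.swap a b * ρ = π := Equiv.swap_mul_self_mul _ _ _
  obtain ⟨k, hk, hk', hbk⟩ := exists_pow_eq_of_mem_cyc hne hbρ
  obtain ⟨c1, c2, -, -, -⟩ := cyc_cut hk hk' hbk
  obtain ⟨h1, h2, h3, h4⟩ := cycles_cut hρS ha hne hbρ rfl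
  rw [hπ] at c1 c2 h1 h2 h3 h4
  set R := (cycles S ρ).erase (cyc ρ a) with hR
  have h5 : cycles S ρ = insert (cyc ρ a) R := (Finset.insert_erase (cyc_mem_cycles ρ ha)).symm
  have h6 : cyc π a ∉ insert (cyc π b) R := by simp [h1, h3]
  rw [h4, Finset.erase_insert h6, Finset.erase_insert h2, orbitType, h5,
    Finset.insert_val_of_notMem (Finset.notMem_erase _ _), Multiset.map_cons, c1, c2,
    Nat.add_sub_cancel' hk'.le]

theorem sum_halfCount_of_notMem {S : Finset V} {r : ℕ} {π : Equiv.Perm V} {a b : V}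
    (hab : b ∉ cyc π a) :
    ∑ A ∈ S.powerset, halfCount S r (Equiv.swap a b * π) a b A = 0 := by
  refine Finset.sum_eq_zero fun A _ => halfCount_eq_zero ?_
  rintro ⟨h1, h2, h3⟩
  exact h2 (cyc_subset_of_apply_mem h3 h1 (mem_cyc_swap_mul hab))

omit [Fintype V] in
theorem sum_offDiag_eq (S : Finset V) (F : V → V → ℚ) :
    ∑ p ∈ S.offDiag, F p.1 p.2 = ∑ a ∈ S, ∑ b ∈ S.erase a, F a b := by
  rw [Finset.sum_sigma']
  refine Finset.sum_bij' (fun p _ => ⟨p.1, p.2⟩) (fun p _ => (p.1, p.2)) ?_ ?_ ?_ ?_ ?_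
  · intro p hp
    have := Finset.mem_offDiag.1 hp
    simp [this.1, this.2.1, this.2.2.symm]
  · intro p hp
    have := Finset.mem_sigma.1 hp
    have h2 := Finset.mem_erase.1 this.2
    simp [this.1, h2.1.symm, h2.2]
  all_goals intros; rfl

/-- The cut and join recursion for the number of connecting words. -/
theorem wordCount_succ_eq {S : Finset V} {r : ℕ} {π : Equiv.Perm V} (hS : SuppIn S π)
    (f : Multiset ℕ → ℚ) (g : Multiset ℕ → Multiset ℕ → ℚ)
    (hf : ∀ ρ, SuppIn S ρ → #(cycles S π) ≤ #(cycles S ρ) + 1 →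
      wordCount S r ρ = f (orbitType S ρ))
    (hg : ∀ (A B : Finset V) (ρ₁ ρ₂ : Equiv.Perm V), A.Nonempty → B.Nonempty → #A + #B = #S →
      #(cycles A ρ₁) + #(cycles B ρ₂) = #(cycles S π) + 1 → SuppIn A ρ₁ → SuppIn B ρ₂ →
      ∑ p ∈ Finset.HasAntidiagonal.antidiagonal r,
        (r.choose p.1 : ℚ) * (wordCount A p.1 ρ₁ * wordCount B p.2 ρ₂) =
          g (orbitType A ρ₁) (orbitType B ρ₂)) :
    wordCount S (r + 1) π =
      ∑ A ∈ cycles S π, (#A : ℚ) * (∑ p ∈ splits #A,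
        (f (p.1 ::ₘ p.2 ::ₘ ((cycles S π).erase A).val.map Finset.card) +
          ∑ J ∈ ((cycles S π).erase A).powerset, g (p.1 ::ₘ J.val.map Finset.card)
            (p.2 ::ₘ (((cycles S π).erase A) \ J).val.map Finset.card)) +
        ∑ B ∈ (cycles S π).erase A, (#B : ℚ) * f ((#A + #B) ::ₘ
          (((cycles S π).erase A).erase B).val.map Finset.card)) := by
  rw [wordCount_succ, sum_offDiag_eq S fun a b => wordCount S r (Equiv.swap a b * π) +
    ∑ A ∈ S.powerset, halfCount S r (Equiv.swap a b * π) a b A,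
    ← sum_cycles fun x hx => hS.cyc_subset hx]
  refine Finset.sum_congr rfl fun a ha => ?_
  have hCS := hS.cyc_subset ha
  have hun : S.erase a = (cyc π a).erase a ∪ (S \ cyc π a) := by
    ext x
    have h1 := @hCS x
    have h2 : x = a → x ∈ cyc π a := fun h => h ▸ self_mem_cyc π a
    simp only [Finset.mem_erase, Finset.mem_union, Finset.mem_sdiff]
    tauto
  rw [hun, Finset.sum_union (Finset.disjoint_sdiff.mono_left (Finset.erase_subset _ _))]
  congr 1
  · refine sum_cyc_erase π a _ _ fun p hp => ?_
    obtain ⟨hp1, hp2, hp3⟩ := mem_splits.1 hp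
    set b := (π ^ p.1) a with hb
    have hbC : b ∈ cyc π a := mem_cyc.2 ⟨p.1, rfl⟩
    have hbS := hCS hbC
    obtain ⟨c1, c2, c3, -, -⟩ := cyc_cut (b := b) hp2 (by omega) hb
    have hab : a ≠ b := by
      intro h
      refine Finset.disjoint_left.1 c3 (self_mem_cyc _ a) ?_
      rw [← h]
      exact self_mem_cyc _ a
    obtain ⟨h1, h2, h3, h4⟩ := cycles_cut hS ha hab hbC rfl
    have hρS : SuppIn S (Equiv.swap a b * π) := (suppIn_swap ha hbS).mul hS
    have hO := Finset.card_erase_add_one (cyc_mem_cycles π ha)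
    set R := (cycles S π).erase (cyc π a)
    set ρ := Equiv.swap a b * π
    have h5 : cyc ρ a ∉ insert (cyc ρ b) R := by simp [h1, h3]
    have c2' : #(cyc ρ b) = p.2 := by omega
    have hcard : #(cycles S ρ) = #(cycles S π) + 1 := by
      rw [h4, Finset.card_insert_of_notMem h5, Finset.card_insert_of_notMem h2, hO]
    have ht : orbitType S ρ = p.1 ::ₘ p.2 ::ₘ R.val.map Finset.card := by
      rw [orbitType, h4, Finset.insert_val_of_notMem h5, Finset.insert_val_of_notMem h2,
        Multiset.map_cons, Multiset.map_cons, c1, c2']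
    rw [hf ρ hρS (by omega), ht, sum_halfCount hρS hbS h1 h2 h3 h4 g (hcard ▸ hg), c1, c2']
  · rw [← cycles_sdiff_cyc, ← sum_cycles (F := fun B => f ((#(cyc π a) + #B) ::ₘ
      ((cycles (S \ cyc π a) π).erase B).val.map Finset.card))]
    · refine Finset.sum_congr rfl fun b hb => ?_
      obtain ⟨hbS, hbC⟩ := Finset.mem_sdiff.1 hb
      have ht := orbitType_swap_of_notMem hS ha hbS hbC
      rw [sum_halfCount_of_notMem hbC, add_zero, hf _ ((suppIn_swap ha hbS).mul hS), ht,
        cycles_sdiff_cyc]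
      rw [← orbitType_card S (Equiv.swap a b * π), ht, Multiset.card_cons,
        Multiset.card_map, Finset.card_val]
      have h1 := Finset.card_erase_add_one (cyc_mem_cycles π ha)
      have h2 := Finset.pred_card_le_card_erase (s := (cycles S π).erase (cyc π a)) (a := cyc π b)
      omega
    · intro x hx
      obtain ⟨hxS, hxC⟩ := Finset.mem_sdiff.1 hx
      refine fun y hy => Finset.mem_sdiff.2 ⟨hS.cyc_subset hxS hy, fun h => hxC ?_⟩
      rw [← cyc_eq_of_mem h, cyc_eq_of_mem hy]
      exact self_mem_cyc _ _

end Recursion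

/-- The normalised number of connected factorizations with `r` factors in genus zero and one. -/
noncomputable def numGenus (r : ℕ) (M : Multiset ℕ) : ℚ :=
  if r + 2 = M.sum + M.card then numZero M else if r = M.sum + M.card then numOne M else 0

/-- The convolution of `numGenus` over all ways to distribute `r` factors. -/
noncomputable def pairGenus (r : ℕ) (M N : Multiset ℕ) : ℚ :=
  if r + 4 = M.sum + M.card + (N.sum + N.card) then numZero M * numZero N
  else if r + 2 = M.sum + M.card + (N.sum + N.card) then
    numOne M * numZero N + numZero M * numOne N
  else 0

theorem sum_antidiagonal_ite (r a b : ℕ) (x y : ℚ) :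
    ∑ p ∈ Finset.HasAntidiagonal.antidiagonal r,
      (if p.1 = a then x else 0) * (if p.2 = b then y else 0) =
        if a + b = r then x * y else 0 := by
  split_ifs with h
  · rw [Finset.sum_eq_single (a, b)]
    · simp
    · rintro ⟨i, j⟩ - hp
      by_cases h1 : i = a
      · have h2 : j ≠ b := fun h2 => hp (by rw [h1, h2])
        simp [h2]
      · simp [h1]
    · intro h'
      exact absurd (Finset.HasAntidiagonal.mem_antidiagonal.2 h) h'
  · refine Finset.sum_eq_zero ?_
    rintro ⟨i, j⟩ hp
    rw [Finset.HasAntidiagonal.mem_antidiagonal] at hp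
    by_cases h1 : i = a
    · have h2 : j ≠ b := fun h2 => h (by simp only at hp; omega)
      simp [h2]
    · simp [h1]

theorem numGenus_eq_add {M : Multiset ℕ} (hM : 2 ≤ M.sum + M.card) (r : ℕ) :
    numGenus r M = (if r = M.sum + M.card - 2 then numZero M else 0) +
      (if r = M.sum + M.card then numOne M else 0) := by
  rw [numGenus]
  by_cases h1 : r + 2 = M.sum + M.card
  · rw [if_pos h1, if_pos (by omega), if_neg (by omega), add_zero]
  · rw [if_neg h1, if_neg (by omega : ¬ r = M.sum + M.card - 2), zero_add]

theorem sum_numGenus_mul {M N : Multiset ℕ} (hM : 2 ≤ M.sum + M.card) (hN : 2 ≤ N.sum + N.card)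
    {r : ℕ} (hr : r + 2 ≤ M.sum + M.card + (N.sum + N.card)) :
    ∑ p ∈ Finset.HasAntidiagonal.antidiagonal r, numGenus p.1 M * numGenus p.2 N =
      pairGenus r M N := by
  simp only [numGenus_eq_add hM, numGenus_eq_add hN, add_mul, mul_add, Finset.sum_add_distrib,
    sum_antidiagonal_ite]
  rw [pairGenus]
  set K := M.sum + M.card
  set L := N.sum + N.card
  by_cases h1 : r + 4 = K + L
  · rw [if_pos h1, if_pos (by omega), if_neg (by omega), if_neg (by omega), if_neg (by omega)]
    ring
  · rw [if_neg h1, if_neg (by omega : ¬ K - 2 + (L - 2) = r), if_neg (by omega : ¬ K + L = r)]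
    by_cases h2 : r + 2 = K + L
    · rw [if_pos h2, if_pos (by omega), if_pos (by omega)]
      ring
    · rw [if_neg h2, if_neg (by omega), if_neg (by omega)]
      ring

/-- The number of connected factorizations in terms of `numGenus`. -/
noncomputable def factorCount (r : ℕ) (M : Multiset ℕ) : ℚ :=
  2 ^ r * (r ! : ℚ) * (M.prod : ℚ) * numGenus r M

theorem sum_choose_mul_factorCount {M N : Multiset ℕ} (hM : 2 ≤ M.sum + M.card)
    (hN : 2 ≤ N.sum + N.card) {r : ℕ} (hr : r + 2 ≤ M.sum + M.card + (N.sum + N.card))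
    {t u : ℕ → ℚ} (ht : ∀ i ≤ r, i ≤ M.sum + M.card → t i = factorCount i M)
    (hu : ∀ i ≤ r, i ≤ N.sum + N.card → u i = factorCount i N) :
    ∑ p ∈ Finset.HasAntidiagonal.antidiagonal r, (r.choose p.1 : ℚ) * (t p.1 * u p.2) =
      2 ^ r * (r ! : ℚ) * (M.prod : ℚ) * (N.prod : ℚ) * pairGenus r M N := by
  rw [← sum_numGenus_mul hM hN hr, Finset.mul_sum]
  refine Finset.sum_congr rfl ?_
  rintro ⟨i, j⟩ hp
  rw [Finset.HasAntidiagonal.mem_antidiagonal] at hp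
  simp only at hp ⊢
  by_cases hi : i ≤ M.sum + M.card
  · by_cases hj : j ≤ N.sum + N.card
    · rw [ht i (by omega) hi, hu j (by omega) hj, factorCount, factorCount, ← hp]
      have : ((i + j).choose i : ℚ) * (i ! : ℚ) * (j ! : ℚ) = ((i + j)! : ℚ) := by
        rw [Nat.choose_symm_add]
        exact_mod_cast Nat.add_choose_mul_factorial_mul_factorial i j
      rw [pow_add, ← this]
      ring
    · have h0 : numGenus i M = 0 := by
        rw [numGenus, if_neg (by omega), if_neg (by omega)]
      rw [ht i (by omega) hi, factorCount, h0]
      ring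
  · have h0 : numGenus j N = 0 := by
      rw [numGenus, if_neg (by omega), if_neg (by omega)]
    rw [hu j (by omega) (by omega), factorCount, h0]
    ring

namespace SetAlg

variable {ι : Type*} [DecidableEq ι]

omit [DecidableEq ι] in
theorem map_val_congr {α β : ι → ℕ} {O J : Finset ι} (h : ∀ i ∈ O, α i = β i) (hJ : J ⊆ O) :
    J.val.map α = J.val.map β :=
  Multiset.map_congr rfl fun i hi => h i (hJ hi)

theorem joinSum_congr {α β : ι → ℕ} {f f' : Multiset ℕ → ℚ} {O : Finset ι}
    (h : ∀ i ∈ O, α i = β i)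
    (hf : ∀ i ∈ O, ∀ j ∈ O.erase i, f ((α i + α j) ::ₘ ((O.erase i).erase j).val.map α) =
      f' ((α i + α j) ::ₘ ((O.erase i).erase j).val.map α)) :
    joinSum α f O = joinSum β f' O := by
  rw [joinSum, joinSum]
  congr 1
  refine Finset.sum_congr rfl fun i hi => Finset.sum_congr rfl fun j hj => ?_
  rw [hf i hi j hj, h i hi, h j (Finset.mem_of_mem_erase hj),
    map_val_congr h ((Finset.erase_subset _ _).trans (Finset.erase_subset _ _))]

theorem cutSum_congr {α β : ι → ℕ} {f f' : Multiset ℕ → ℚ} {O : Finset ι}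
    (h : ∀ i ∈ O, α i = β i)
    (hf : ∀ i ∈ O, ∀ p ∈ splits (α i), f (p.1 ::ₘ p.2 ::ₘ (O.erase i).val.map α) =
      f' (p.1 ::ₘ p.2 ::ₘ (O.erase i).val.map α)) :
    cutSum α f O = cutSum β f' O := by
  rw [cutSum, cutSum]
  congr 1
  refine Finset.sum_congr rfl fun i hi => ?_
  rw [← h i hi]
  refine Finset.sum_congr rfl fun p hp => ?_
  rw [hf i hi p hp, map_val_congr h (Finset.erase_subset _ _)]

/-- The quadratic cut operation for a function of two multisets. -/
noncomputable def pairSum (α : ι → ℕ) (g : Multiset ℕ → Multiset ℕ → ℚ) (O : Finset ι) : ℚ :=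
  (1 / 2) * ∑ i ∈ O, ∑ p ∈ splits (α i), ∑ J ∈ (O.erase i).powerset,
    p.1 * p.2 * g (p.1 ::ₘ J.val.map α) (p.2 ::ₘ (O.erase i \ J).val.map α)

theorem pairSum_congr {α β : ι → ℕ} {g g' : Multiset ℕ → Multiset ℕ → ℚ} {O : Finset ι}
    (h : ∀ i ∈ O, α i = β i)
    (hg : ∀ i ∈ O, ∀ p ∈ splits (α i), ∀ J ∈ (O.erase i).powerset,
      g (p.1 ::ₘ J.val.map α) (p.2 ::ₘ (O.erase i \ J).val.map α) =
      g' (p.1 ::ₘ J.val.map α) (p.2 ::ₘ (O.erase i \ J).val.map α)) :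
    pairSum α g O = pairSum β g' O := by
  rw [pairSum, pairSum]
  congr 1
  refine Finset.sum_congr rfl fun i hi => ?_
  rw [← h i hi]
  refine Finset.sum_congr rfl fun p hp => Finset.sum_congr rfl fun J hJ => ?_
  rw [hg i hi p hp J hJ, map_val_congr h ((Finset.mem_powerset.1 hJ).trans
    (Finset.erase_subset _ _)), map_val_congr h (Finset.sdiff_subset.trans
    (Finset.erase_subset _ _))]

theorem pairSum_mul (α : ι → ℕ) (f g : Multiset ℕ → ℚ) (O : Finset ι) :
    pairSum α (fun M N => f M * g N) O = splitOff α f g O := rfl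

theorem pairSum_add (α : ι → ℕ) (g g' : Multiset ℕ → Multiset ℕ → ℚ) (O : Finset ι) :
    pairSum α (fun M N => g M N + g' M N) O = pairSum α g O + pairSum α g' O := by
  simp only [pairSum, mul_add, Finset.sum_add_distrib]

theorem joinSum_zero (α : ι → ℕ) (O : Finset ι) : joinSum α (fun _ => 0) O = 0 := by
  simp [joinSum]

theorem cutSum_zero (α : ι → ℕ) (O : Finset ι) : cutSum α (fun _ => 0) O = 0 := by
  simp [cutSum]

theorem pairSum_zero (α : ι → ℕ) (O : Finset ι) : pairSum α (fun _ _ => 0) O = 0 := by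
  simp [pairSum]

theorem numGenus_recurrence_aux [Fintype ι] {α : ι → ℕ} (hα : ∀ i, 0 < α i) {O : Finset ι}
    (hO : O.Nonempty) {r : ℕ} (hr : r + 1 ≤ (∑ i ∈ O, α i) + #O) :
    ((r : ℚ) + 1) * numGenus (r + 1) (O.val.map α) =
      joinSum α (numGenus r) O + cutSum α (numGenus r) O + pairSum α (pairGenus r) O := by
  have hO' := hO.card_pos
  have hs : (O.val.map α).sum = ∑ i ∈ O, α i := rfl
  have hc : (O.val.map α).card = #O := Multiset.card_map _ _
  set n := ∑ i ∈ O, α i with hn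
  have hnQ : (∑ i ∈ O, (α i : ℚ)) = n := by rw [hn]; push_cast; rfl
  have hjoin : joinSum α (numGenus r) O = joinSum α (fun M =>
      if r + 3 = n + #O then numZero M else if r + 1 = n + #O then numOne M else 0) O := by
    refine joinSum_congr (fun _ _ => rfl) fun i hi j hj => ?_
    have h1 : ((α i + α j) ::ₘ ((O.erase i).erase j).val.map α).sum = n := by
      rw [Multiset.sum_cons, hn, ← Finset.add_sum_erase O α hi, ← Finset.add_sum_erase _ α hj,
        add_assoc]
      rfl
    have h2 : ((α i + α j) ::ₘ ((O.erase i).erase j).val.map α).card + 1 = #O := by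
      rw [Multiset.card_cons, Multiset.card_map, Finset.card_val,
        Finset.card_erase_add_one hj, Finset.card_erase_add_one hi]
    rw [numGenus, h1]
    refine if_congr (by omega) rfl (if_congr (by omega) rfl rfl)
  have hcut : cutSum α (numGenus r) O = cutSum α (fun M =>
      if r + 1 = n + #O then numZero M else 0) O := by
    refine cutSum_congr (fun _ _ => rfl) fun i hi p hp => ?_
    have hp' := (mem_splits.1 hp).1
    have h1 : (p.1 ::ₘ p.2 ::ₘ (O.erase i).val.map α).sum = n := by
      rw [Multiset.sum_cons, Multiset.sum_cons, hn, ← Finset.add_sum_erase O α hi, ← add_assoc, hp']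
      rfl
    have h2 : (p.1 ::ₘ p.2 ::ₘ (O.erase i).val.map α).card = #O + 1 := by
      rw [Multiset.card_cons, Multiset.card_cons, Multiset.card_map, Finset.card_val,
        Finset.card_erase_add_one hi]
    rw [numGenus, h1, h2, if_neg (by omega : ¬ r = n + (#O + 1))]
    exact if_congr (by omega) rfl rfl
  have hpair : pairSum α (pairGenus r) O = pairSum α (fun M N =>
      if r + 3 = n + #O then numZero M * numZero N else if r + 1 = n + #O then
        numOne M * numZero N + numZero M * numOne N else 0) O := by
    refine pairSum_congr (fun _ _ => rfl) fun i hi p hp J hJ => ?_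
    have hp' := (mem_splits.1 hp).1
    have hJ' := Finset.mem_powerset.1 hJ
    have h1 : (p.1 ::ₘ J.val.map α).sum + (p.2 ::ₘ (O.erase i \ J).val.map α).sum = n := by
      rw [Multiset.sum_cons, Multiset.sum_cons, hn, ← Finset.add_sum_erase O α hi, ← hp',
        ← Finset.sum_sdiff (f := α) hJ']
      change p.1 + (∑ j ∈ J, α j) + (p.2 + ∑ j ∈ O.erase i \ J, α j) = _
      ring
    have h2 : (p.1 ::ₘ J.val.map α).card + (p.2 ::ₘ (O.erase i \ J).val.map α).card = #O + 1 := by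
      rw [Multiset.card_cons, Multiset.card_cons, Multiset.card_map, Multiset.card_map,
        Finset.card_val, Finset.card_val, ← Finset.card_erase_add_one hi,
        ← Finset.card_sdiff_add_card_eq_card hJ']
      ring
    rw [pairGenus]
    refine if_congr (by omega) rfl (if_congr (by omega) rfl rfl)
  rw [hjoin, hcut, hpair, numGenus, hs, hc]
  by_cases h0 : r + 3 = n + #O
  · have h1 : ¬ r + 1 = n + #O := by omega
    have h2 : (r : ℚ) + 3 = n + #O := by exact_mod_cast h0
    have h3 := numZero_recurrence hα hO
    rw [hnQ] at h3
    simp only [if_pos h0, if_neg h1, cutSum_zero, pairSum_mul]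
    rw [add_zero]
    refine Eq.trans ?_ h3
    linear_combination numZero (O.val.map α) * h2
  · by_cases h1 : r + 1 = n + #O
    · have h2 : (r : ℚ) + 1 = n + #O := by exact_mod_cast h1
      have h3 := numOne_recurrence hα O
      rw [hnQ] at h3
      simp only [if_neg h0, if_pos h1, pairSum_add, pairSum_mul]
      rw [h2]
      exact h3
    · simp only [if_neg h0, if_neg h1, joinSum_zero, cutSum_zero, pairSum_zero]
      ring

theorem numGenus_recurrence [Fintype ι] {β : ι → ℕ} {O : Finset ι} (hβ : ∀ i ∈ O, 0 < β i)
    (hO : O.Nonempty) {r : ℕ} (hr : r + 1 ≤ (∑ i ∈ O, β i) + #O) :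
    ((r : ℚ) + 1) * numGenus (r + 1) (O.val.map β) =
      joinSum β (numGenus r) O + cutSum β (numGenus r) O + pairSum β (pairGenus r) O := by
  have h : ∀ i ∈ O, max 1 (β i) = β i := fun i hi => max_eq_right (hβ i hi)
  rw [← Finset.sum_congr rfl h] at hr
  have := numGenus_recurrence_aux (fun i => Nat.lt_of_lt_of_le one_pos (le_max_left 1 (β i))) hO hr
  rwa [map_val_congr h subset_rfl, joinSum_congr h fun _ _ _ _ => rfl,
    cutSum_congr h fun _ _ _ _ => rfl, pairSum_congr h fun _ _ _ _ _ _ => rfl] at this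

theorem factorCount_recurrence [Fintype ι] {β : ι → ℕ} {O : Finset ι} (hβ : ∀ i ∈ O, 0 < β i)
    (hO : O.Nonempty) {r : ℕ} (hr : r + 1 ≤ (∑ i ∈ O, β i) + #O) :
    factorCount (r + 1) (O.val.map β) =
      ∑ i ∈ O, (β i : ℚ) * (∑ p ∈ splits (β i),
        (factorCount r (p.1 ::ₘ p.2 ::ₘ (O.erase i).val.map β) +
          ∑ J ∈ (O.erase i).powerset, 2 ^ r * (r ! : ℚ) *
            ((p.1 ::ₘ J.val.map β).prod : ℚ) * ((p.2 ::ₘ (O.erase i \ J).val.map β).prod : ℚ) *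
            pairGenus r (p.1 ::ₘ J.val.map β) (p.2 ::ₘ (O.erase i \ J).val.map β)) +
        ∑ j ∈ O.erase i, (β j : ℚ) *
          factorCount r ((β i + β j) ::ₘ ((O.erase i).erase j).val.map β)) := by
  have h1 := numGenus_recurrence hβ hO hr
  have hprod : ∀ J : Finset ι, ((J.val.map β).prod : ℚ) = ∏ i ∈ J, (β i : ℚ) := by
    intro J
    change ((∏ i ∈ J, β i : ℕ) : ℚ) = _
    push_cast
    rfl
  have h2 : factorCount (r + 1) (O.val.map β) = 2 ^ r * (r ! : ℚ) * (∏ i ∈ O, (β i : ℚ)) *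
      (2 * (((r : ℚ) + 1) * numGenus (r + 1) (O.val.map β))) := by
    rw [factorCount, hprod, Nat.factorial_succ]
    push_cast
    ring
  rw [h2, h1, joinSum, cutSum, pairSum, ← mul_add, ← mul_add, ← mul_assoc (2 : ℚ),
    mul_one_div_cancel two_ne_zero, one_mul, ← Finset.sum_add_distrib, ← Finset.sum_add_distrib,
    Finset.mul_sum]
  refine Finset.sum_congr rfl fun i hi => ?_
  rw [add_assoc, add_comm, ← Finset.sum_add_distrib, mul_add, mul_add, Finset.mul_sum,
    Finset.mul_sum, Finset.mul_sum, Finset.mul_sum]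
  congr 1
  · refine Finset.sum_congr rfl fun p _ => ?_
    rw [mul_add, mul_add, Finset.mul_sum, Finset.mul_sum]
    congr 1
    · rw [factorCount, Multiset.prod_cons, Multiset.prod_cons]
      simp only [Nat.cast_mul]
      rw [hprod, ← Finset.mul_prod_erase O (fun i => (β i : ℚ)) hi]
      ring
    · refine Finset.sum_congr rfl fun J hJ => ?_
      rw [Multiset.prod_cons, Multiset.prod_cons]
      simp only [Nat.cast_mul]
      rw [hprod, hprod, ← Finset.mul_prod_erase O (fun i => (β i : ℚ)) hi,
        ← Finset.prod_sdiff (f := fun i => (β i : ℚ)) (Finset.mem_powerset.1 hJ)]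
      ring
  · refine Finset.sum_congr rfl fun j hj => ?_
    rw [factorCount, Multiset.prod_cons]
    simp only [Nat.cast_mul, Nat.cast_add]
    rw [hprod, ← Finset.mul_prod_erase O (fun i => (β i : ℚ)) hi,
      ← Finset.mul_prod_erase _ (fun i => (β i : ℚ)) hj]
    ring

end SetAlg

section Induction

variable {V : Type*} [DecidableEq V] [Fintype V]

theorem orbitType_eq_of_card_le_one {S : Finset V} {π : Equiv.Perm V} (hS : SuppIn S π)
    (hne : S.Nonempty) (h : #S ≤ 1) : π = 1 ∧ orbitType S π = {1} := by
  obtain ⟨x, rfl⟩ := Finset.card_eq_one.1 (le_antisymm h hne.card_pos)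
  have hc : cyc π x = {x} := Finset.Subset.antisymm (hS.cyc_subset (Finset.mem_singleton_self x))
    (Finset.singleton_subset_iff.2 (self_mem_cyc π x))
  constructor
  · ext y
    by_cases hy : y ∈ ({x} : Finset V)
    · rw [Finset.mem_singleton] at hy
      have h1 : π x ∈ cyc π x := apply_mem_cyc.2 (self_mem_cyc π x)
      rw [hc, Finset.mem_singleton] at h1
      rw [hy, h1, Equiv.Perm.one_apply]
    · exact hS y hy
  · rw [orbitType, cycles, Finset.image_singleton, hc]
    rfl

theorem wordCount_zero {S : Finset V} {π : Equiv.Perm V} (hS : SuppIn S π) (hne : S.Nonempty) :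
    wordCount S 0 π = factorCount 0 (orbitType S π) := by
  rw [wordCount, lsum_zero]
  rcases Nat.lt_or_ge 1 #S with h | h
  · have h1 : ¬ Connects S [] := by
      intro h1
      obtain ⟨x, hx⟩ := hne
      rcases h1 {x} (Finset.singleton_subset_iff.2 hx) (by simp [Respects]) with h2 | h2
      · simp at h2
      · rw [← h2, Finset.card_singleton] at h
        exact lt_irrefl _ h
    obtain ⟨x, hx⟩ := hne
    have h2 : 0 < (orbitType S π).card := by
      rw [orbitType_card]
      exact Finset.card_pos.2 ⟨_, cyc_mem_cycles π hx⟩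
    have h3 := orbitType_sum hS
    rw [if_neg fun h2 => h1 h2.2, factorCount, numGenus, if_neg (by omega), if_neg (by omega),
      mul_zero]
  · obtain ⟨rfl, h1⟩ := orbitType_eq_of_card_le_one hS hne h
    have h2 : Connects S [] := by
      intro A hA _
      rcases A.eq_empty_or_nonempty with h2 | h2
      · exact Or.inl h2
      · exact Or.inr (Finset.eq_of_subset_of_card_le hA (h.trans h2.card_pos))
    rw [if_pos ⟨word_nil, h2⟩, h1]
    simp [factorCount, numGenus, numZero, treeCoeff]

theorem two_le_orbitType {S : Finset V} {π : Equiv.Perm V} (hS : SuppIn S π) (hne : S.Nonempty) :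
    2 ≤ (orbitType S π).sum + (orbitType S π).card := by
  obtain ⟨x, hx⟩ := hne
  have h1 : 0 < #S := Finset.card_pos.2 ⟨x, hx⟩
  have h2 : 0 < #(cycles S π) := Finset.card_pos.2 ⟨_, cyc_mem_cycles π hx⟩
  rw [orbitType_sum hS, orbitType_card]
  omega

/-- In genus at most one, the connected factorizations are counted by `factorCount`. -/
theorem wordCount_eq (r : ℕ) {S : Finset V} {π : Equiv.Perm V} (hne : S.Nonempty)
    (hS : SuppIn S π) (hr : r ≤ #S + #(cycles S π)) :
    wordCount S r π = factorCount r (orbitType S π) := by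
  induction r using Nat.strong_induction_on generalizing S π with
  | _ r ih =>
  rcases r with _ | r
  · exact wordCount_zero hS hne
  have hO : (cycles S π).Nonempty := by
    obtain ⟨x, hx⟩ := hne
    exact ⟨_, cyc_mem_cycles π hx⟩
  have hsum : ∑ C ∈ cycles S π, #C = #S := orbitType_sum hS
  rw [orbitType, SetAlg.factorCount_recurrence (fun C hC => card_pos_of_mem_cycles hC) hO
    (by omega)]
  refine wordCount_succ_eq hS (factorCount r) (fun M N => 2 ^ r * (r ! : ℚ) * (M.prod : ℚ) *
    (N.prod : ℚ) * pairGenus r M N) (fun ρ hρ hc => ih r (by omega) hne hρ (by omega)) ?_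
  intro A B ρ₁ ρ₂ hA hB hc1 hc2 h1 h2
  have e1 := orbitType_sum h1
  have e2 := orbitType_sum h2
  have e3 := orbitType_card A ρ₁
  have e4 := orbitType_card B ρ₂
  refine sum_choose_mul_factorCount (t := fun i => wordCount A i ρ₁)
    (u := fun i => wordCount B i ρ₂) (two_le_orbitType h1 hA) (two_le_orbitType h2 hB)
    (by omega) (fun i hi hi' => ih i (by omega) hA h1 (by omega))
    (fun i hi hi' => ih i (by omega) hB h2 (by omega))

end Induction

section Transitivity

variable {V : Type*} [DecidableEq V] [Fintype V]

theorem connects_univ_iff (l : List (V × V)) :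
    Connects Finset.univ l ↔ ∀ x y : V, ∃ τ ∈ Subgroup.closure
      {s | s ∈ l.map fun p => Equiv.swap p.1 p.2}, τ x = y := by
  classical
  constructor
  · intro h x
    set H := Subgroup.closure {s | s ∈ l.map fun p : V × V => Equiv.swap p.1 p.2} with hH
    set A : Finset V := Finset.univ.filter fun y => ∃ τ ∈ H, τ x = y with hA
    have hmem : ∀ p ∈ l, Equiv.swap p.1 p.2 ∈ H := fun p hp =>
      Subgroup.subset_closure (List.mem_map.2 ⟨p, hp, rfl⟩)
    have hr : Respects A l := by
      intro p hp
      simp only [hA, Finset.mem_filter, Finset.mem_univ, true_and]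
      constructor
      · rintro ⟨τ, hτ, h1⟩
        exact ⟨_, H.mul_mem (hmem p hp) hτ, by rw [Equiv.Perm.mul_apply, h1,
          Equiv.swap_apply_left]⟩
      · rintro ⟨τ, hτ, h1⟩
        exact ⟨_, H.mul_mem (hmem p hp) hτ, by rw [Equiv.Perm.mul_apply, h1,
          Equiv.swap_apply_right]⟩
    have hx : x ∈ A := Finset.mem_filter.2 ⟨Finset.mem_univ _, 1, H.one_mem, rfl⟩
    rcases h A (Finset.subset_univ _) hr with h1 | h1
    · simp [h1] at hx
    · intro y
      have hy : y ∈ A := h1 ▸ Finset.mem_univ y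
      exact (Finset.mem_filter.1 hy).2
  · intro h A _ hr
    rcases A.eq_empty_or_nonempty with h1 | ⟨x, hx⟩
    · exact Or.inl h1
    · refine Or.inr (Finset.eq_univ_of_forall fun y => ?_)
      obtain ⟨τ, hτ, rfl⟩ := h x y
      have key : ∀ z, τ z ∈ A ↔ z ∈ A := by
        induction hτ using Subgroup.closure_induction with
        | mem s hs =>
          obtain ⟨p, hp, rfl⟩ := List.mem_map.1 hs
          have h2 : Respects A [p] := by
            intro q hq
            rw [List.mem_singleton.1 hq]
            exact hr p hp
          intro z
          have h3 := h2.word_mem_iff z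
          rwa [word_cons, word_nil, mul_one] at h3
        | one => exact fun z => Iff.rfl
        | mul s t _ _ hs ht => exact fun z => by rw [Equiv.Perm.mul_apply, hs, ht]
        | inv s _ hs =>
          intro z
          rw [← hs, ← Equiv.Perm.mul_apply, mul_inv_cancel, Equiv.Perm.one_apply]
      exact (key x).2 hx

variable (V) in
/-- The set of transpositions. -/
def swaps : Finset (Equiv.Perm V) :=
  (Finset.univ : Finset V).offDiag.image fun p => Equiv.swap p.1 p.2

theorem mem_swaps {s : Equiv.Perm V} : s ∈ swaps V ↔ s.IsSwap := by
  simp [swaps, Equiv.Perm.IsSwap, eq_comm]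

theorem sum_offDiag_swap (G : Equiv.Perm V → ℚ) :
    ∑ p ∈ (Finset.univ : Finset V).offDiag, G (Equiv.swap p.1 p.2) =
      2 * ∑ s ∈ swaps V, G s := by
  classical
  have hmaps : ∀ p ∈ (Finset.univ : Finset V).offDiag,
      Equiv.swap p.1 p.2 ∈ swaps V := fun p hp =>
    Finset.mem_image_of_mem _ hp
  rw [← Finset.sum_fiberwise_of_maps_to hmaps, Finset.mul_sum]
  refine Finset.sum_congr rfl fun s hs => ?_
  obtain ⟨a, b, hab, rfl⟩ := mem_swaps.1 hs
  have h : (Finset.univ : Finset V).offDiag.filter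
      (fun p => Equiv.swap p.1 p.2 = Equiv.swap a b) = {(a, b), (b, a)} := by
    ext ⟨c, d⟩
    simp only [Finset.mem_filter, Finset.mem_offDiag, Finset.mem_univ, true_and,
      Finset.mem_insert, Finset.mem_singleton, Prod.mk.injEq]
    constructor
    · rintro ⟨hcd, h1⟩
      have h2 : Equiv.swap a b c = d := by rw [← h1, Equiv.swap_apply_left]
      rw [Equiv.swap_apply_def] at h2
      split_ifs at h2 with h3 h4
      · exact Or.inl ⟨h3, h2.symm⟩
      · exact Or.inr ⟨h4, h2.symm⟩
      · exact absurd h2 hcd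
    · rintro (⟨rfl, rfl⟩ | ⟨rfl, rfl⟩)
      · exact ⟨hab, rfl⟩
      · exact ⟨hab.symm, Equiv.swap_comm _ _⟩
  rw [h, Finset.sum_pair (fun h => hab (Prod.mk.inj h).1), Equiv.swap_comm b a]
  ring

theorem lsum_offDiag (r : ℕ) (F : List (Equiv.Perm V) → ℚ) :
    lsum (Finset.univ : Finset V).offDiag r
      (fun l => F (l.map fun p => Equiv.swap p.1 p.2)) =
        2 ^ r * lsum (swaps V) r F := by
  induction r generalizing F with
  | zero => simp [lsum_zero]
  | succ r ih =>
    rw [lsum_succ, lsum_succ]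
    have h : ∀ p ∈ (Finset.univ : Finset V).offDiag, (lsum (Finset.univ : Finset V).offDiag r
        fun l => F ((p :: l).map fun p => Equiv.swap p.1 p.2)) =
        2 ^ r * lsum (swaps V) r
          fun l => F (Equiv.swap p.1 p.2 :: l) := fun p _ =>
      ih fun l => F (Equiv.swap p.1 p.2 :: l)
    rw [Finset.sum_congr rfl h, sum_offDiag_swap fun s => 2 ^ r *
      lsum (swaps V) r fun l => F (s :: l),
      ← Finset.mul_sum]
    ring

end Transitivity

theorem lsum_eq_sum_piFinset {P : Type*} [DecidableEq P] (L : Finset P) (r : ℕ)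
    (F : List P → ℚ) :
    lsum L r F = ∑ σ ∈ Fintype.piFinset (fun _ : Fin r => L), F (List.ofFn σ) := by
  induction r generalizing F with
  | zero => simp [lsum_zero]
  | succ r ih =>
    simp only [lsum_succ, ih]
    rw [← Finset.sum_product']
    refine Finset.sum_nbij' (fun p => Fin.cons p.1 p.2) (fun σ => (σ 0, Fin.tail σ)) ?_ ?_ ?_ ?_ ?_
    · intro p hp
      obtain ⟨h1, h2⟩ := Finset.mem_product.1 hp
      exact Fintype.mem_piFinset.2 (Fin.cases h1 (Fintype.mem_piFinset.1 h2))
    · intro σ hσ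
      have := Fintype.mem_piFinset.1 hσ
      exact Finset.mem_product.2 ⟨this 0, Fintype.mem_piFinset.2 fun i => this i.succ⟩
    · intro p _
      rfl
    · intro σ _
      exact Fin.cons_self_tail σ
    · intro p _
      simp [List.ofFn_succ]

theorem lsum_indicator {P : Type*} [DecidableEq P] [Fintype P] (L : Finset P) (r : ℕ)
    (Q : List P → Prop) [DecidablePred Q] :
    lsum L r (fun l => if Q l then 1 else 0) =
      Nat.card {σ : Fin r → P // (∀ i, σ i ∈ L) ∧ Q (List.ofFn σ)} := by
  rw [lsum_eq_sum_piFinset, Finset.sum_boole, Nat.card_eq_fintype_card, Fintype.card_subtype]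
  congr 2
  ext σ
  simp [Fintype.mem_piFinset]

theorem wordCount_univ {V : Type*} [DecidableEq V] [Fintype V] (r : ℕ) (π : Equiv.Perm V) :
    wordCount Finset.univ r π = 2 ^ r * (Nat.card {σ : Fin r → Equiv.Perm V //
      (∀ i, (σ i).IsSwap) ∧ (List.ofFn σ).prod = π ∧
        ∀ x y : V, ∃ τ ∈ Subgroup.closure (Set.range σ), τ x = y} : ℚ) := by
  classical
  have h1 : wordCount Finset.univ r π = lsum (Finset.univ : Finset V).offDiag r fun l =>
      (fun L : List (Equiv.Perm V) => if L.prod = π ∧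
        ∀ x y : V, ∃ τ ∈ Subgroup.closure {s | s ∈ L}, τ x = y then (1 : ℚ) else 0)
          (l.map fun p => Equiv.swap p.1 p.2) := by
    rw [wordCount]
    refine lsum_congr fun l _ => ?_
    simp only [connects_univ_iff]
    exact if_congr Iff.rfl rfl rfl
  rw [h1]
  refine (lsum_offDiag r fun L : List (Equiv.Perm V) => if L.prod = π ∧
    ∀ x y : V, ∃ τ ∈ Subgroup.closure {s | s ∈ L}, τ x = y then (1 : ℚ) else 0).trans ?_
  rw [lsum_indicator]
  have h2 : ∀ σ : Fin r → Equiv.Perm V, {s | s ∈ List.ofFn σ} = Set.range σ := by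
    intro σ
    ext s
    simp [List.mem_ofFn]
  simp only [h2, mem_swaps]

theorem filter_orbitType {V : Type*} [DecidableEq V] [Fintype V] (π : Equiv.Perm V) :
    (orbitType Finset.univ π).filter (2 ≤ ·) = π.cycleType := by
  have hcyc : ∀ x ∈ π.support, (π.cycleOf x).support = cyc π x := by
    intro x hx
    ext y
    rw [Equiv.Perm.mem_support_cycleOf_iff, mem_cyc]
    exact and_iff_left hx
  have h1 : ∀ x, 2 ≤ #(cyc π x) ↔ x ∈ π.support := by
    intro x
    constructor
    · intro h
      rw [Equiv.Perm.mem_support]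
      intro hx
      have : cyc π x ⊆ {x} := cyc_subset (Finset.mem_singleton_self x) fun y hy => by
        rw [Finset.mem_singleton] at hy ⊢
        rw [hy, hx]
      have := Finset.card_le_card this
      rw [Finset.card_singleton] at this
      omega
    · intro hx
      exact Finset.one_lt_card.2 ⟨_, apply_mem_cyc.2 (self_mem_cyc π x), _, self_mem_cyc π x,
        Equiv.Perm.mem_support.1 hx⟩
  have h2 : (cycles Finset.univ π).filter (fun C => 2 ≤ #C) =
      π.cycleFactorsFinset.image Equiv.Perm.support := by
    ext C
    simp only [Finset.mem_filter, cycles, Finset.mem_image, Finset.mem_univ, true_and]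
    constructor
    · rintro ⟨⟨x, rfl⟩, h⟩
      have hx := (h1 x).1 h
      exact ⟨_, Equiv.Perm.cycleOf_mem_cycleFactorsFinset_iff.2 hx, hcyc x hx⟩
    · rintro ⟨c, hc, rfl⟩
      obtain ⟨x, hx⟩ := (Equiv.Perm.mem_cycleFactorsFinset_iff.1 hc).1.nonempty_support
      have hx' : x ∈ π.support := Equiv.Perm.mem_cycleFactorsFinset_support_le hc hx
      rw [Equiv.Perm.cycle_is_cycleOf hx hc, hcyc x hx']
      exact ⟨⟨x, rfl⟩, (h1 x).2 hx'⟩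
  have h3 : Set.InjOn Equiv.Perm.support (π.cycleFactorsFinset : Set (Equiv.Perm V)) := by
    intro c hc d hd h
    obtain ⟨x, hx⟩ := (Equiv.Perm.mem_cycleFactorsFinset_iff.1 hc).1.nonempty_support
    rw [Equiv.Perm.cycle_is_cycleOf hx hc, Equiv.Perm.cycle_is_cycleOf (h ▸ hx) hd]
  rw [orbitType, Multiset.filter_map]
  change ((cycles Finset.univ π).filter (fun C => 2 ≤ #C)).val.map Finset.card = _
  rw [h2, Finset.image_val_of_injOn h3, Multiset.map_map]
  rfl

theorem eq_of_filter_two_le {M N : Multiset ℕ} (hM : ∀ a ∈ M, 0 < a) (hN : ∀ a ∈ N, 0 < a)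
    (h : M.filter (2 ≤ ·) = N.filter (2 ≤ ·)) (hs : M.sum = N.sum) : M = N := by
  have key : ∀ K : Multiset ℕ, (∀ a ∈ K, 0 < a) →
      K.filter (fun a => ¬ 2 ≤ a) = Multiset.replicate (K.filter fun a => ¬ 2 ≤ a).card 1 := by
    intro K hK
    refine Multiset.eq_replicate_card.2 fun a ha => ?_
    obtain ⟨h1, h2⟩ := Multiset.mem_filter.1 ha
    have := hK a h1
    omega
  rw [← Multiset.filter_add_not (2 ≤ ·) M, ← Multiset.filter_add_not (2 ≤ ·) N, h, key M hM,
    key N hN] at hs ⊢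
  simp only [Multiset.sum_add, Multiset.sum_replicate, smul_eq_mul, mul_one] at hs
  rw [Nat.add_left_cancel hs]

theorem orbitType_eq_parts {n : ℕ} (α : n.Partition) {π : Equiv.Perm (Fin n)}
    (hπ : π.cycleType = α.parts.filter (fun i => 2 ≤ i)) :
    orbitType Finset.univ π = α.parts := by
  refine eq_of_filter_two_le ?_ (fun a ha => α.parts_pos ha) ((filter_orbitType π).trans hπ) ?_
  · intro a ha
    obtain ⟨C, hC, rfl⟩ := Multiset.mem_map.1 ha
    exact card_pos_of_mem_cycles (Finset.mem_def.2 hC)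
  · rw [orbitType_sum (fun x hx => absurd (Finset.mem_univ x) hx), α.parts_sum, Finset.card_univ,
      Fintype.card_fin]

theorem prod_mul_prod_treeCoeff {M : Multiset ℕ} (hM : ∀ a ∈ M, 0 < a) :
    (M.prod : ℚ) * (M.map treeCoeff).prod =
      (M.map fun i : ℕ => (i : ℚ) ^ i / ((i - 1)! : ℚ)).prod := by
  induction M using Multiset.induction_on with
  | empty => simp
  | cons a M ih =>
    rw [Multiset.prod_cons, Multiset.map_cons, Multiset.prod_cons, Multiset.map_cons,
      Multiset.prod_cons, ← ih fun b hb => hM b (Multiset.mem_cons_of_mem hb), treeCoeff]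
    obtain ⟨k, rfl⟩ := Nat.exists_eq_add_one_of_ne_zero (hM a (Multiset.mem_cons_self a M)).ne'
    rw [Nat.add_sub_cancel, Nat.factorial_succ]
    have h1 : ((k + 1 : ℕ) : ℚ) ≠ 0 := Nat.cast_ne_zero.2 k.succ_ne_zero
    have h2 : (k ! : ℚ) ≠ 0 := Nat.cast_ne_zero.2 k.factorial_ne_zero
    rw [Nat.cast_mul, Nat.cast_mul]
    field_simp

/-- **Hurwitz numbers for the torus** (Goulden–Jackson–Vainshtein conjecture).
For a partition `α` of `n ≥ 1` with `m` parts and a fixed permutation `π` of cycle type `α`,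
the number `c_1(α)` of tuples `(σ_1, …, σ_r)` of transpositions, `r = n + m`, with
`σ_1 ⋯ σ_r = π` and `⟨σ_1, …, σ_r⟩` transitive, equals
`(1/24) (n+m)! (∏ α_i^{α_i}/(α_i−1)!) (n^m − n^{m−1} − Σ_{i=2}^m (i−2)! e_i n^{m−i})`. -/
theorem hurwitz_torus (n : ℕ) (hn : 1 ≤ n) (α : n.Partition)
    (π : Equiv.Perm (Fin n)) (hπ : π.cycleType = α.parts.filter (fun i => 2 ≤ i)) :
    (Nat.card {σ : Fin (n + α.parts.card) → Equiv.Perm (Fin n) //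
        (∀ i, (σ i).IsSwap) ∧ (List.ofFn σ).prod = π ∧
        ∀ x y : Fin n, ∃ τ ∈ Subgroup.closure (Set.range σ), τ x = y} : ℚ) =
      (1 / 24) * ((n + α.parts.card)! : ℚ) * aProd α * npoly α := by
  have h1 : wordCount Finset.univ (n + α.parts.card) π =
      factorCount (n + α.parts.card) α.parts := by
    have : NeZero n := ⟨by omega⟩
    have hS : SuppIn Finset.univ π := fun x hx => absurd (Finset.mem_univ x) hx
    refine (wordCount_eq _ Finset.univ_nonempty hS ?_).trans ?_
    · rw [← orbitType_card, orbitType_eq_parts α hπ, Finset.card_univ, Fintype.card_fin]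
    · rw [orbitType_eq_parts α hπ]
  have h2 : (α.parts.map fun j => (j : ℚ)) = α.parts.map fun j : ℕ => (j : ℚ) := by
    simp [Multiset.bind_def, Multiset.pure_def]
  have h3 : genusOne α.parts = (1 / 24) * npoly α := by
    rw [npoly, genusOne, α.parts_sum, h2]
  have h4 : aProd α = (α.parts.prod : ℚ) * (α.parts.map treeCoeff).prod :=
    (prod_mul_prod_treeCoeff fun a ha => α.parts_pos ha).symm
  rw [wordCount_univ, factorCount, numGenus, α.parts_sum, if_neg (by omega), if_pos rfl, numOne,
    h3] at h1
  refine mul_left_cancel₀ (pow_ne_zero (n + α.parts.card) (two_ne_zero (α := ℚ))) ?_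
  rw [h1, h4]
  ring
end

section
/- In the field ℚ(X, Y, Z) of rational functions, with W_1(t) = t/(1−t), W_2(t) = t/(1−t)^3, W_3(t) = (t + 2t^2)/(1−t)^5, the following identity holds: (1/(Y−Z))·[ W_2(X)(W_3(Y)W_1(Z) − W_1(Y)W_3(Z)) − (W_2(X)+W_3(X))(W_2(Y)W_1(Z) − W_1(Y)W_2(Z)) ] + (1/(X−Z))·[ W_2(Y)(W_3(X)W_1(Z) − W_1(X)W_3(Z)) − (W_2(Y)+W_3(Y))(W_2(X)W_1(Z) − W_1(X)W_2(Z)) ] + (1/(X−Y))·[ W_2(Z)(W_3(X)W_1(Y) − W_1(X)W_3(Y)) − (W_2(Z)+W_3(Z))(W_2(X)W_1(Y) − W_1(X)W_2(Y)) ] − 2 W_2(X)W_2(Y)W_3(Z)(1−Z) − 2 W_2(X)W_3(Y)W_2(Z)(1−Y) − 2 W_3(X)W_2(Y)W_2(Z)(1−X) − 2 W_2(X)W_2(Y)W_2(Z)(X+Y+Z) = 0. -/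
/-- `W_1(t) = t/(1−t)`, the expression for `w⁽¹⁾` in terms of `w`. -/
noncomputable def W1 {K : Type*} [Field K] (t : K) : K := t / (1 - t)

/-- `W_2(t) = t/(1−t)³`, the expression for `w⁽²⁾` in terms of `w`. -/
noncomputable def W2 {K : Type*} [Field K] (t : K) : K := t / (1 - t) ^ 3

/-- `W_3(t) = (t+2t²)/(1−t)⁵`, the expression for `w⁽³⁾` in terms of `w`. -/
noncomputable def W3 {K : Type*} [Field K] (t : K) : K := (t + 2 * t ^ 2) / (1 - t) ^ 5

/-- The identity holds at any three pairwise distinct elements of a field, none of them `1`. -/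
theorem W_identity {K : Type*} [Field K] {X Y Z : K}
    (hX : 1 - X ≠ 0) (hY : 1 - Y ≠ 0) (hZ : 1 - Z ≠ 0)
    (hXY : X - Y ≠ 0) (hXZ : X - Z ≠ 0) (hYZ : Y - Z ≠ 0) :
    (1 / (Y - Z)) * (W2 X * (W3 Y * W1 Z - W1 Y * W3 Z) -
        (W2 X + W3 X) * (W2 Y * W1 Z - W1 Y * W2 Z)) +
      (1 / (X - Z)) * (W2 Y * (W3 X * W1 Z - W1 X * W3 Z) -
        (W2 Y + W3 Y) * (W2 X * W1 Z - W1 X * W2 Z)) +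
      (1 / (X - Y)) * (W2 Z * (W3 X * W1 Y - W1 X * W3 Y) -
        (W2 Z + W3 Z) * (W2 X * W1 Y - W1 X * W2 Y)) -
      2 * W2 X * W2 Y * W3 Z * (1 - Z) -
      2 * W2 X * W3 Y * W2 Z * (1 - Y) -
      2 * W3 X * W2 Y * W2 Z * (1 - X) -
      2 * W2 X * W2 Y * W2 Z * (X + Y + Z) = 0 := by
  unfold W1 W2 W3
  field_simp
  ring

/-- The symmetrized degree-three identity `ϖ_{1,2,3}(U_3) = 0` in the field `ℚ(X, Y, Z)`
of rational functions in three variables. -/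
theorem U3_identity :
    ∀ X Y Z : FractionRing (MvPolynomial (Fin 3) ℚ),
      X = algebraMap (MvPolynomial (Fin 3) ℚ) (FractionRing (MvPolynomial (Fin 3) ℚ))
            (MvPolynomial.X 0) →
      Y = algebraMap (MvPolynomial (Fin 3) ℚ) (FractionRing (MvPolynomial (Fin 3) ℚ))
            (MvPolynomial.X 1) →
      Z = algebraMap (MvPolynomial (Fin 3) ℚ) (FractionRing (MvPolynomial (Fin 3) ℚ))
            (MvPolynomial.X 2) →
      (1 / (Y - Z)) * (W2 X * (W3 Y * W1 Z - W1 Y * W3 Z) -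
          (W2 X + W3 X) * (W2 Y * W1 Z - W1 Y * W2 Z)) +
        (1 / (X - Z)) * (W2 Y * (W3 X * W1 Z - W1 X * W3 Z) -
          (W2 Y + W3 Y) * (W2 X * W1 Z - W1 X * W2 Z)) +
        (1 / (X - Y)) * (W2 Z * (W3 X * W1 Y - W1 X * W3 Y) -
          (W2 Z + W3 Z) * (W2 X * W1 Y - W1 X * W2 Y)) -
        2 * W2 X * W2 Y * W3 Z * (1 - Z) -
        2 * W2 X * W3 Y * W2 Z * (1 - Y) -
        2 * W3 X * W2 Y * W2 Z * (1 - X) -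
        2 * W2 X * W2 Y * W2 Z * (X + Y + Z) = 0 := by
  rintro X Y Z rfl rfl rfl
  have one_sub_ne (i : Fin 3) :
      1 - algebraMap (MvPolynomial (Fin 3) ℚ) (FractionRing (MvPolynomial (Fin 3) ℚ))
        (MvPolynomial.X i) ≠ 0 := by
    rw [← map_one (algebraMap (MvPolynomial (Fin 3) ℚ) _), sub_ne_zero,
      (IsFractionRing.injective _ _).ne_iff]
    intro h
    simpa using congrArg (MvPolynomial.eval 0) h
  have sub_ne {i j : Fin 3} (hij : i ≠ j) :
      algebraMap (MvPolynomial (Fin 3) ℚ) (FractionRing (MvPolynomial (Fin 3) ℚ))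
        (MvPolynomial.X i) - algebraMap (MvPolynomial (Fin 3) ℚ) _ (MvPolynomial.X j) ≠ 0 := by
    rw [sub_ne_zero, (IsFractionRing.injective _ _).ne_iff]
    exact fun h => hij (MvPolynomial.X_injective h)
  exact W_identity (one_sub_ne 0) (one_sub_ne 1) (one_sub_ne 2)
    (sub_ne (by decide)) (sub_ne (by decide)) (sub_ne (by decide))
end
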